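/- Let S be a domain that is either a complete local Noetherian ring, or finitely generated as an algebra over a field or over ℤ, or, more generally, finitely generated over a Noetherian integrally closed domain R with the property that every finitely generated R-algebra has module-finite integral closure. Let 𝔞_• be a filtration and 𝔟_• a graded family of nonzero ideals in S, and suppose that 𝔟_• is 𝔟-equivalent for some ideal 𝔟 ⊆ S. Then ρ̂(𝔞_•, 𝔟_•) = ρ̂(𝔞_•, 𝔟̄_•) = ρ(𝔞_•, 𝔟̄_•) = ρ̂(𝔞_•, 𝔟^•), where 𝔟^• = {𝔟^i}_{i≥1}. -/

import Mathlib

open Filter Polynomial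
open scoped ENNReal NNReal

set_option synthInstance.maxHeartbeats 1000000
set_option maxHeartbeats 1000000

universe u

section Preamble

variable {S : Type u} [CommRing S]

/-- A graded family of ideals: `a 0 = S` and `a p * a q ⊆ a (p + q)` for all `p, q`. -/
def GradedFamily (a : ℕ → Ideal S) : Prop :=
  a 0 = ⊤ ∧ ∀ p q : ℕ, a p * a q ≤ a (p + q)

/-- A filtration of ideals: a graded family which is descending. -/
def IdealFiltration (a : ℕ → Ideal S) : Prop :=
  GradedFamily a ∧ ∀ p : ℕ, a (p + 1) ≤ a p

/-- The integral closure of an ideal `I`: the ideal of all elements `x` satisfying an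
equation of integral dependence `x ^ n + c 1 * x ^ (n - 1) + ⋯ + c n = 0` with `c i ∈ I ^ i`. -/
noncomputable def intClosure (I : Ideal S) : Ideal S :=
  Ideal.span {x : S | ∃ n : ℕ, 0 < n ∧ ∃ c : ℕ → S,
    (∀ i, 1 ≤ i → i ≤ n → c i ∈ I ^ i) ∧
    x ^ n + ∑ i ∈ Finset.Icc 1 n, c i * x ^ (n - i) = 0}

/-- The resurgence `ρ(a, b) = sup { s / r : ¬ a s ⊆ b r }` (as an extended real number,
with `sSup ∅ = ⊥`). -/
noncomputable def resurgence (a b : ℕ → Ideal S) : EReal :=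
  sSup {x : EReal | ∃ s r : ℕ, 0 < s ∧ 0 < r ∧ ¬ a s ≤ b r ∧
    x = (((s : ℝ) / (r : ℝ) : ℝ) : EReal)}

/-- The asymptotic resurgence `ρ̂(a, b) = sup { s / r : ¬ a (s*t) ⊆ b (r*t) for all t ≫ 1}`. -/
noncomputable def asympResurgence (a b : ℕ → Ideal S) : EReal :=
  sSup {x : EReal | ∃ s r : ℕ, 0 < s ∧ 0 < r ∧
    (∀ᶠ t : ℕ in atTop, ¬ a (s * t) ≤ b (r * t)) ∧
    x = (((s : ℝ) / (r : ℝ) : ℝ) : EReal)}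

/-- The `k`-th Veronese subalgebra of the Rees algebra of the graded family `b` is a
standard graded `S`-algebra, i.e. `b (k*n) = (b k) ^ n` for all `n ≥ 1`. -/
def StdVeronese (b : ℕ → Ideal S) (k : ℕ) : Prop :=
  ∀ n : ℕ, 1 ≤ n → b (k * n) = b k ^ n

/-- The Rees algebra `ℛ(b) = ⊕ₙ bₙ tⁿ ⊆ S[t]` of a graded family, as a set of polynomials. -/
def ReesSet (b : ℕ → Ideal S) : Set (Polynomial S) :=
  {p : Polynomial S | ∀ n : ℕ, p.coeff n ∈ b n}

/-- `ℛ(b')` is a finitely generated `ℛ(b)`-module: there is a finite set `G ⊆ ℛ(b')`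
such that every element of `ℛ(b')` is an `ℛ(b)`-linear combination of elements of `G`. -/
def ReesFGModule (b b' : ℕ → Ideal S) : Prop :=
  ∃ G : Finset (Polynomial S), (G : Set (Polynomial S)) ⊆ ReesSet b' ∧
    ∀ p ∈ ReesSet b', ∃ c : Polynomial S → Polynomial S,
      (∀ g ∈ G, c g ∈ ReesSet b) ∧ p = ∑ g ∈ G, c g * g

/-- A graded family `b` is `bb`-equivalent (for an ideal `bb`) if for some `k`,
`b (i + k) ⊆ bb ^ i ⊆ b i` for all `i ≥ 1`. -/
def BEquivalent (bb : Ideal S) (b : ℕ → Ideal S) : Prop :=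
  ∃ k : ℕ, ∀ i : ℕ, 1 ≤ i → b (i + k) ≤ bb ^ i ∧ bb ^ i ≤ b i

/-- `β_n(a, b) = inf { d ≥ 1 : ¬ a n ⊆ b d }`, with `inf ∅ = ∞`. -/
noncomputable def betaIdx (a b : ℕ → Ideal S) (n : ℕ) : ℕ∞ :=
  sInf {d : ℕ∞ | ∃ m : ℕ, 0 < m ∧ ¬ a n ≤ b m ∧ d = (m : ℕ∞)}

/-- `ρ^n(a, b) = sup { s / β_s(a, b) : s ≥ n, β_s(a, b) < ∞ }`. -/
noncomputable def rhoN (a b : ℕ → Ideal S) (n : ℕ) : EReal :=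
  sSup {x : EReal | ∃ s d : ℕ, n ≤ s ∧ 0 < s ∧ betaIdx a b s = (d : ℕ∞) ∧
    x = (((s : ℝ) / (d : ℝ) : ℝ) : EReal)}

/-- `ρ^lim(a, b) = lim_{n → ∞} ρ^n(a, b)`, the limit of the nonincreasing sequence `ρ^n`,
i.e. its infimum. -/
noncomputable def rhoLim (a b : ℕ → Ideal S) : EReal :=
  ⨅ n : ℕ, rhoN a b n

end Preamble

section Valuations

variable {S : Type u} [CommRing S] [IsDomain S]

/-- A (discrete) valuation of the quotient field `K` of `S`: a function `v : K → ℤ` with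
`v (x * y) = v x + v y` and `v (x + y) ≥ min (v x) (v y)` (for nonzero elements). -/
structure ValuationOn (S : Type u) [CommRing S] [IsDomain S] where
  v : FractionRing S → ℤ
  map_mul : ∀ x y : FractionRing S, x ≠ 0 → y ≠ 0 → v (x * y) = v x + v y
  min_le_map_add : ∀ x y : FractionRing S, x ≠ 0 → y ≠ 0 → x + y ≠ 0 →
    min (v x) (v y) ≤ v (x + y)

/-- A valuation of the quotient field is supported on `S` if it is nonnegative on `S`. -/
def ValuationOn.Supported (w : ValuationOn S) : Prop :=
  ∀ x : S, x ≠ 0 → 0 ≤ w.v (algebraMap S (FractionRing S) x)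

/-- `v(I) = min { v x : x ∈ I, x ≠ 0 }`. -/
noncomputable def idealVal (w : ValuationOn S) (I : Ideal S) : ℤ :=
  sInf {m : ℤ | ∃ x ∈ I, x ≠ 0 ∧ w.v (algebraMap S (FractionRing S) x) = m}

/-- The skew Waldschmidt constant `v̂(a) = inf_{n ≥ 1} v(a n) / n (= lim_{n → ∞} v(a n)/n)`. -/
noncomputable def skewWald (w : ValuationOn S) (a : ℕ → Ideal S) : ℝ :=
  sInf {t : ℝ | ∃ n : ℕ, 0 < n ∧ t = (idealVal w (a n) : ℝ) / (n : ℝ)}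

/-- `β_n^v(a, b) = inf { d ≥ 1 : v(a n) < v(b d) }`, with `inf ∅ = ∞`. -/
noncomputable def betaVal (w : ValuationOn S) (a b : ℕ → Ideal S) (n : ℕ) : ℕ∞ :=
  sInf {d : ℕ∞ | ∃ m : ℕ, 0 < m ∧ idealVal w (a n) < idealVal w (b m) ∧ d = (m : ℕ∞)}

end Valuations

section Domains

/-- `S` is a finitely generated algebra over a field. -/
structure FieldBase (S : Type u) [CommRing S] where
  F : Type u
  [fld : Field F]
  [alg : Algebra F S]
  fg : Algebra.FiniteType F S

/-- `S` is finitely generated over a Noetherian integrally closed domain `R` with the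
property that every finitely generated `R`-algebra (domain) has module-finite integral
closure (in its fraction field). -/
structure NagataBase (S : Type u) [CommRing S] where
  R : Type u
  [cring : CommRing R]
  [dom : IsDomain R]
  [noeth : IsNoetherianRing R]
  [intClosed : IsIntegrallyClosed R]
  [alg : Algebra R S]
  fg : Algebra.FiniteType R S
  finiteIntegralClosure : ∀ (A : Type u) [CommRing A] [IsDomain A] [Algebra R A],
    Algebra.FiniteType R A → Module.Finite A (integralClosure A (FractionRing A))

/-- `S` is a complete local Noetherian ring, or finitely generated over a field or over `ℤ`,
or, more generally, finitely generated over a Noetherian integrally closed domain `R` such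
that every finitely generated `R`-algebra has a module-finite integral closure. -/
def AdmissibleDomain (S : Type u) [CommRing S] : Prop :=
  (IsNoetherianRing S ∧ ∃ m : Ideal S, m.IsMaximal ∧ (∀ I : Ideal S, I.IsMaximal → I = m) ∧
    IsAdicComplete m S)
  ∨ Nonempty (FieldBase S) ∨ Algebra.FiniteType ℤ S ∨ Nonempty (NagataBase S)

end Domains

section IntegralClosureOfIdeals

variable {S : Type u} [CommRing S]

theorem Ideal.exists_mul_pow_mem_of_integral_equation [IsDomain S] {I : Ideal S} {x : S} {N : ℕ}
    (hN : 0 < N) {c : ℕ → S} (hc : ∀ i, 1 ≤ i → i ≤ N → c i ∈ I ^ i)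
    (h : x ^ N + ∑ i ∈ Finset.Icc 1 N, c i * x ^ (N - i) = 0) :
    ∃ d : S, d ≠ 0 ∧ ∀ n : ℕ, d * x ^ n ∈ I ^ n := by
  by_cases hI : I = ⊥
  · subst hI
    have hx : x = 0 := by
      have h0 : ∑ i ∈ Finset.Icc 1 N, c i * x ^ (N - i) = 0 := by
        refine Finset.sum_eq_zero fun i hi => ?_
        rw [Finset.mem_Icc] at hi
        have := hc i hi.1 hi.2
        rw [← Ideal.zero_eq_bot, zero_pow (by omega), Ideal.zero_eq_bot, Ideal.mem_bot] at this
        rw [this, zero_mul]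
      rw [h0, add_zero] at h
      exact pow_eq_zero_iff (by omega) |>.1 h
    refine ⟨1, one_ne_zero, fun n => ?_⟩
    subst hx
    rcases Nat.eq_zero_or_pos n with rfl | hn
    · simp
    · rw [zero_pow (by omega), mul_zero]; exact zero_mem _
  · obtain ⟨y, hy, hy0⟩ := Submodule.exists_mem_ne_zero_of_ne_bot hI
    refine ⟨y ^ N, pow_ne_zero _ hy0, fun n => ?_⟩
    induction n using Nat.strong_induction_on with
    | _ n ih =>
      rcases lt_or_ge n N with hn | hn
      · exact Ideal.mul_mem_right _ _ (Ideal.pow_le_pow_right hn.le (Ideal.pow_mem_pow hy N))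
      · have hx : y ^ N * x ^ n = -∑ i ∈ Finset.Icc 1 N, c i * (y ^ N * x ^ (n - i)) := by
          have hx1 : x ^ N = -∑ i ∈ Finset.Icc 1 N, c i * x ^ (N - i) := by linear_combination h
          have hx2 : x ^ n = x ^ (n - N) * x ^ N := by rw [← pow_add]; congr 1; omega
          rw [hx2, hx1, mul_neg, mul_neg, Finset.mul_sum, Finset.mul_sum]
          congr 1
          refine Finset.sum_congr rfl fun i hi => ?_
          rw [Finset.mem_Icc] at hi
          have : x ^ (n - i) = x ^ (n - N) * x ^ (N - i) := by rw [← pow_add]; congr 1; omega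
          rw [this]; ring
        rw [hx]
        refine neg_mem (Submodule.sum_mem _ fun i hi => ?_)
        rw [Finset.mem_Icc] at hi
        have := Ideal.mul_mem_mul (hc i hi.1 hi.2) (ih (n - i) (by omega))
        rwa [← pow_add, Nat.add_sub_cancel' (by omega)] at this

theorem exists_mul_pow_mem_of_mem_intClosure [IsDomain S] {I : Ideal S} {x : S}
    (hx : x ∈ intClosure I) : ∃ d : S, d ≠ 0 ∧ ∀ n : ℕ, d * x ^ n ∈ I ^ n := by
  induction hx using Submodule.span_induction with
  | mem x hx =>
    obtain ⟨N, hN, c, hc, h⟩ := hx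
    exact Ideal.exists_mul_pow_mem_of_integral_equation hN hc h
  | zero =>
    refine ⟨1, one_ne_zero, fun n => ?_⟩
    rcases Nat.eq_zero_or_pos n with rfl | hn
    · simp
    · rw [zero_pow (by omega), mul_zero]; exact zero_mem _
  | add x y _ _ hx hy =>
    obtain ⟨d, hd, hx⟩ := hx
    obtain ⟨e, he, hy⟩ := hy
    refine ⟨d * e, mul_ne_zero hd he, fun n => ?_⟩
    rw [add_pow, Finset.mul_sum]
    refine Submodule.sum_mem _ fun i hi => ?_
    rw [Finset.mem_range] at hi
    have := Ideal.mul_mem_mul (hx i) (hy (n - i))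
    rw [← pow_add, Nat.add_sub_cancel' (by omega)] at this
    have h2 := Ideal.mul_mem_right (n.choose i : S) _ this
    convert h2 using 1; ring
  | smul r x _ hx =>
    obtain ⟨d, hd, hx⟩ := hx
    refine ⟨d, hd, fun n => ?_⟩
    have := Ideal.mul_mem_left _ (r ^ n) (hx n)
    convert this using 1; rw [smul_eq_mul]; ring

theorem mem_intClosure_of_mul_pow_mem [IsDomain S] [IsNoetherianRing S] {I : Ideal S} {x d : S}
    (hd : d ≠ 0) (hx : ∀ n : ℕ, d * x ^ n ∈ I ^ n) : x ∈ intClosure I := by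
  let g : ℕ → reesAlgebra I := fun n =>
    ⟨monomial n (d * x ^ n), reesAlgebra.monomial_mem.2 (hx n)⟩
  let M : ℕ →o Ideal (reesAlgebra I) :=
    ⟨fun N => Ideal.span (g '' Set.Iio N), fun m n h =>
      Ideal.span_mono (Set.image_mono (Set.Iio_subset_Iio h))⟩
  obtain ⟨N, hN⟩ := monotone_stabilizes_iff_noetherian.2 inferInstance M
  have hmem : g (N + 1) ∈ Ideal.span (g '' (Finset.range (N + 1) : Set ℕ)) := by
    have h1 : g (N + 1) ∈ M (N + 2) := Ideal.subset_span ⟨N + 1, by simp, rfl⟩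
    rw [← hN (N + 2) (by omega), hN (N + 1) (by omega)] at h1
    rw [Finset.coe_range]; exact h1
  obtain ⟨c, hc⟩ := (Submodule.mem_span_image_finset_iff_exists_fun' _).1 hmem
  have hc' := congrArg (fun p : reesAlgebra I => (p : S[X]).coeff (N + 1)) hc
  have hcoeff : ∀ i ∈ Finset.range (N + 1),
      ((c i * g i : reesAlgebra I) : S[X]).coeff (N + 1) =
        (c i : S[X]).coeff (N + 1 - i) * (d * x ^ i) := by
    intro i hi
    rw [Finset.mem_range] at hi
    have : N + 1 = (N + 1 - i) + i := by omega
    simp only [MulMemClass.coe_mul, g]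
    conv_lhs => rw [this]
    exact coeff_mul_monomial _ _ _ _
  simp only [smul_eq_mul, AddSubmonoidClass.coe_finsetSum, finsetSum_coeff] at hc'
  rw [Finset.sum_congr rfl hcoeff] at hc'
  simp only [g, coeff_monomial_same] at hc'
  refine Ideal.subset_span ⟨N + 1, by omega, fun i => -(c (N + 1 - i) : S[X]).coeff i, ?_, ?_⟩
  · intro i _ _
    exact neg_mem ((mem_reesAlgebra_iff _ _).1 (c (N + 1 - i)).2 i)
  · apply mul_left_cancel₀ hd
    rw [mul_add, ← hc', mul_zero, Finset.mul_sum]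
    have : ∑ i ∈ Finset.Icc 1 (N + 1),
        d * (-(c (N + 1 - i) : S[X]).coeff i * x ^ (N + 1 - i)) =
        ∑ i ∈ Finset.range (N + 1), -((c i : S[X]).coeff (N + 1 - i) * (d * x ^ i)) := by
      refine Finset.sum_bij' (fun i _ => N + 1 - i) (fun i _ => N + 1 - i) ?_ ?_ ?_ ?_ ?_
      · intro i hi; simp at hi ⊢; omega
      · intro i hi; simp at hi ⊢; omega
      · intro i hi; simp at hi ⊢; omega
      · intro i hi; simp at hi ⊢; omega
      · intro i hi
        simp only [Finset.mem_Icc] at hi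
        have : N + 1 - (N + 1 - i) = i := by omega
        rw [this]; ring
    rw [this, Finset.sum_neg_distrib, add_neg_cancel]

theorem le_intClosure (I : Ideal S) : I ≤ intClosure I := by
  intro x hx
  refine Ideal.subset_span ⟨1, one_pos, fun _ => -x, ?_, by simp⟩
  intro i h1 h2
  obtain rfl : i = 1 := by omega
  simpa using hx

theorem mem_intClosure_of_pow_mem [IsDomain S] [IsNoetherianRing S] {I : Ideal S} {x : S} {t : ℕ}
    (ht : 0 < t) (hx : x ^ t ∈ intClosure (I ^ t)) : x ∈ intClosure I := by
  by_cases hI : I = ⊥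
  · subst hI
    obtain ⟨d, hd, h⟩ := exists_mul_pow_mem_of_mem_intClosure hx
    have := h 1
    rw [pow_one, pow_one, ← Ideal.zero_eq_bot, zero_pow (by omega), Ideal.zero_eq_bot,
      Ideal.mem_bot] at this
    have hx : x = 0 := by
      rcases mul_eq_zero.1 this with h | h
      · exact absurd h hd
      · exact pow_eq_zero_iff (by omega) |>.1 h
    rw [hx]; exact zero_mem _
  obtain ⟨y, hy, hy0⟩ := Submodule.exists_mem_ne_zero_of_ne_bot hI
  obtain ⟨d, hd, h⟩ := exists_mul_pow_mem_of_mem_intClosure hx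
  refine mem_intClosure_of_mul_pow_mem (mul_ne_zero hd (pow_ne_zero t hy0)) fun n => ?_
  have hdiv := Nat.div_add_mod n t
  have hlt := Nat.mod_lt n ht
  have h1 := Ideal.mul_mem_mul (h (n / t)) (Ideal.pow_mem_pow hy t)
  rw [← pow_mul, ← pow_mul, ← pow_add] at h1
  have h2 := Ideal.mul_mem_right (x ^ (n % t)) _
      (Ideal.pow_le_pow_right (by omega : n ≤ t * (n / t) + t) h1)
  convert h2 using 1
  conv_lhs => rw [← hdiv, pow_add]
  ring

end IntegralClosureOfIdeals

section Resurgence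

variable {S : Type u} [CommRing S]

theorem GradedFamily.pow_le {a : ℕ → Ideal S} (ha : GradedFamily a) (s t : ℕ) :
    a s ^ t ≤ a (s * t) := by
  induction t with
  | zero => rw [mul_zero, ha.1]; exact le_top
  | succ t ih =>
    rw [pow_succ, mul_add_one]
    exact (Ideal.mul_mono_left ih).trans (ha.2 _ _)

theorem intClosure_eq_of_bEquivalent [IsDomain S] [IsNoetherianRing S] {bb : Ideal S}
    {b : ℕ → Ideal S} (hb : GradedFamily b) (hbnz : ∀ i : ℕ, 1 ≤ i → b i ≠ ⊥)
    (heq : BEquivalent bb b) {r : ℕ} (hr : 1 ≤ r) : intClosure (b r) = intClosure (bb ^ r) := by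
  obtain ⟨k, hk⟩ := heq
  have hbb : bb ≠ ⊥ := by
    intro h
    have := (hk 1 le_rfl).1
    rw [pow_one, h, le_bot_iff] at this
    exact hbnz _ (by omega) this
  obtain ⟨y, hy, hy0⟩ := Submodule.exists_mem_ne_zero_of_ne_bot hbb
  apply le_antisymm
  · intro x hx
    obtain ⟨d, hd, h⟩ := exists_mul_pow_mem_of_mem_intClosure hx
    refine mem_intClosure_of_mul_pow_mem (mul_ne_zero hd (pow_ne_zero k hy0)) fun n => ?_
    rw [← pow_mul]
    have h1 : d * x ^ n ∈ b (r * n) := hb.pow_le r n (h n)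
    rcases le_or_gt (r * n) k with hle | hlt
    · have := Ideal.mul_mem_left _ (d * x ^ n)
        (Ideal.pow_le_pow_right hle (Ideal.pow_mem_pow hy k))
      convert this using 1; ring
    · have h2 : d * x ^ n ∈ bb ^ (r * n - k) := by
        apply (hk (r * n - k) (by omega)).1
        rwa [Nat.sub_add_cancel hlt.le]
      have := Ideal.mul_mem_mul h2 (Ideal.pow_mem_pow hy k)
      rw [← pow_add, Nat.sub_add_cancel hlt.le] at this
      convert this using 1; ring
  · refine Ideal.span_mono ?_
    rintro x ⟨n, hn, c, hc, h⟩
    exact ⟨n, hn, c, fun i h1 h2 => Ideal.pow_right_mono (hk r hr).2 i (hc i h1 h2), h⟩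

theorem asympResurgence_anti (a : ℕ → Ideal S) {b c : ℕ → Ideal S}
    (h : ∀ i, 1 ≤ i → b i ≤ c i) : asympResurgence a c ≤ asympResurgence a b := by
  refine sSup_le_sSup ?_
  rintro _ ⟨s, r, hs, hr, hst, rfl⟩
  refine ⟨s, r, hs, hr, ?_, rfl⟩
  filter_upwards [hst, eventually_gt_atTop 0] with t ht ht0 hle
  exact ht (hle.trans (h _ (Nat.mul_pos hr ht0)))

theorem resurgence_le_asympResurgence [IsDomain S] [IsNoetherianRing S] {bb : Ideal S}
    {a b : ℕ → Ideal S} (ha : GradedFamily a)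
    (hb : ∀ r, 1 ≤ r → b r = intClosure (bb ^ r)) :
    resurgence a b ≤ asympResurgence a b := by
  refine sSup_le_sSup ?_
  rintro _ ⟨s, r, hs, hr, hst, rfl⟩
  refine ⟨s, r, hs, hr, ?_, rfl⟩
  filter_upwards [eventually_gt_atTop 0] with t ht hle
  refine hst fun x hx => ?_
  rw [hb r hr]
  apply mem_intClosure_of_pow_mem ht
  rw [← pow_mul, ← hb _ (Nat.mul_pos hr ht)]
  exact hle (ha.pow_le s t (Ideal.pow_mem_pow hx t))

theorem asympResurgence_pow_le_resurgence {bb : Ideal S} {a b : ℕ → Ideal S} {c : ℕ}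
    (hbc : ∀ n, 1 ≤ n → b (n + c) ≤ bb ^ n) :
    asympResurgence a (fun i => bb ^ i) ≤ resurgence a b := by
  refine sSup_le ?_
  rintro _ ⟨s, r, hs, hr, hst, rfl⟩
  have hlim : Tendsto (fun t : ℕ => (((s * t : ℕ) : ℝ) / ((r * t + c : ℕ) : ℝ) : ℝ)) atTop
      (nhds ((s : ℝ) / r)) := by
    have hr' : (r : ℝ) ≠ 0 := by positivity
    have h1 : Tendsto (fun t : ℕ => (s : ℝ) / ((r : ℝ) + (c : ℝ) / t)) atTop
        (nhds ((s : ℝ) / (r + 0))) :=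
      tendsto_const_nhds.div (tendsto_const_nhds.add (tendsto_const_div_atTop_nhds_zero_nat _))
        (by simpa using hr')
    rw [add_zero] at h1
    refine h1.congr' ?_
    filter_upwards [eventually_gt_atTop 0] with t ht
    have : (t : ℝ) ≠ 0 := by positivity
    push_cast
    field_simp
  refine le_of_tendsto ((continuous_coe_real_ereal.tendsto _).comp hlim) ?_
  filter_upwards [hst, eventually_gt_atTop 0] with t ht ht0
  refine le_sSup ⟨s * t, r * t + c, Nat.mul_pos hs ht0, ?_, fun h => ht ?_, rfl⟩
  · have := Nat.mul_pos hr ht0; omega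
  · exact h.trans (hbc _ (Nat.mul_pos hr ht0))

/-- The equality of the four resurgence numbers, given linear comparison of the integral closures
of the powers of `bb` with the powers of `bb`. -/
theorem resurgence_eqs_of_intClosure_pow_le [IsDomain S] [IsNoetherianRing S]
    {a b : ℕ → Ideal S} (ha : GradedFamily a) (hb : GradedFamily b)
    (hbnz : ∀ i : ℕ, 1 ≤ i → b i ≠ ⊥) {bb : Ideal S} (heq : BEquivalent bb b)
    (hc : ∃ c, ∀ n, intClosure (bb ^ (n + c)) ≤ bb ^ n) :
    asympResurgence a b = asympResurgence a (fun i => intClosure (b i)) ∧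
      asympResurgence a (fun i => intClosure (b i)) =
        resurgence a (fun i => intClosure (b i)) ∧
      resurgence a (fun i => intClosure (b i)) =
        asympResurgence a (fun i => bb ^ i) := by
  obtain ⟨c, hc⟩ := hc
  have hcl := fun r (hr : 1 ≤ r) => intClosure_eq_of_bEquivalent hb hbnz heq hr
  have h1 : resurgence a (fun i => intClosure (b i)) ≤
      asympResurgence a (fun i => intClosure (b i)) := resurgence_le_asympResurgence ha hcl
  have h2 : asympResurgence a (fun i => intClosure (b i)) ≤ asympResurgence a b :=
    asympResurgence_anti a fun i _ => le_intClosure _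
  have h3 : asympResurgence a b ≤ asympResurgence a (fun i => bb ^ i) := by
    obtain ⟨k, hk⟩ := heq
    exact asympResurgence_anti a fun i hi => (hk i hi).2
  have h4 : asympResurgence a (fun i => bb ^ i) ≤ resurgence a (fun i => intClosure (b i)) :=
    asympResurgence_pow_le_resurgence (c := c) fun n hn => by
      rw [hcl _ (by omega)]; exact hc n
  exact ⟨le_antisymm (h3.trans (h4.trans h1)) h2,
    le_antisymm (h2.trans (h3.trans h4)) h1, le_antisymm (h1.trans (h2.trans h3)) h4⟩

end Resurgence

/-- A commutative ring is N-1 if its integral closure in its total ring of fractions is a finite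
module over it. -/
def IsNOne (A : Type*) [CommRing A] : Prop :=
  Module.Finite A (integralClosure A (FractionRing A))

section ReesBound

variable {S : Type*} [CommRing S] [IsDomain S]

/-- Linear comparison of `intClosure (I ^ n)` with `I ^ n`, given a Noetherian N-1 domain between
the Rees algebra of `I` and its completion inside the power series ring. -/
theorem exists_intClosure_pow_le_of_isNOne {I : Ideal S} {T : Type*} [CommRing T] [IsDomain T]
    [IsNoetherianRing T] (hT : IsNOne T) (φ : T →+* PowerSeries S) (hφ : Function.Injective φ)
    (hcoeff : ∀ t n, PowerSeries.coeff n (φ t) ∈ I ^ n)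
    (hmon : ∀ n, ∀ x ∈ I ^ n, ∃ t, φ t = PowerSeries.monomial n x) :
    ∃ c, ∀ n, intClosure (I ^ (n + c)) ≤ I ^ n := by
  by_cases hI : I = ⊥
  · refine ⟨1, fun n x hx => ?_⟩
    obtain ⟨d, hd, h⟩ := exists_mul_pow_mem_of_mem_intClosure hx
    have h1 := h 1
    rw [pow_one, pow_one, hI, ← Ideal.zero_eq_bot, zero_pow (by omega), Ideal.zero_eq_bot,
      Ideal.mem_bot] at h1
    rw [(mul_eq_zero.1 h1).resolve_left hd]
    exact zero_mem _
  obtain ⟨y, hy, hy0⟩ := Submodule.exists_mem_ne_zero_of_ne_bot hI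
  let K := FractionRing T
  let Q := FractionRing (PowerSeries S)
  let ι : PowerSeries S →+* Q := algebraMap _ _
  have hι : Function.Injective ι := IsFractionRing.injective _ _
  let ψ : K →+* Q := IsFractionRing.lift (A := T) (g := ι.comp φ) (hι.comp hφ)
  have hψ : ∀ t, ψ (algebraMap T K t) = ι (φ t) := fun t => IsFractionRing.lift_algebraMap _ t
  have hψinj : Function.Injective ψ := ψ.injective
  let E : Set K := {e | ∃ n, ∃ x ∈ intClosure (I ^ n), ψ e = ι (PowerSeries.monomial n x)}
  have hE : ∀ n, ∀ x ∈ intClosure (I ^ n), ∃ e ∈ E, ψ e = ι (PowerSeries.monomial n x) := by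
    intro n x hx
    obtain ⟨u, hu⟩ := hmon n (y ^ n * x) (Ideal.mul_mem_right _ _ (Ideal.pow_mem_pow hy n))
    obtain ⟨v, hv⟩ := hmon 0 (y ^ n) (by simp)
    have hψe : ψ (algebraMap T K u / algebraMap T K v) = ι (PowerSeries.monomial n x) := by
      rw [map_div₀, hψ, hψ, div_eq_iff, ← map_mul, hu, hv]
      · congr 1
        rw [PowerSeries.monomial_mul_monomial, add_zero, mul_comm]
      · rw [hv, Ne, map_eq_zero_iff ι hι]
        intro h
        have := congrArg (PowerSeries.coeff 0) h
        rw [PowerSeries.coeff_monomial_same, map_zero] at this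
        exact pow_ne_zero n hy0 this
    exact ⟨_, ⟨n, x, hx, hψe⟩, hψe⟩
  have hEC : ∀ e ∈ E, e ∈ integralClosure T K := by
    rintro e ⟨n, x, hx, he⟩
    obtain ⟨d, hd, h⟩ := exists_mul_pow_mem_of_mem_intClosure hx
    obtain ⟨w, hw⟩ := hmon 0 d (by simp)
    have hw0 : w ≠ 0 := by
      rintro rfl
      have := congrArg (PowerSeries.coeff 0) hw
      rw [PowerSeries.coeff_monomial_same, map_zero, map_zero] at this
      exact hd this.symm
    refine IsAlmostIntegral.isIntegral ⟨w, mem_nonZeroDivisors_of_ne_zero hw0, fun m => ?_⟩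
    obtain ⟨t, ht⟩ := hmon (n * m) (d * x ^ m) (by rw [pow_mul]; exact h m)
    refine ⟨t, hψinj ?_⟩
    rw [hψ, Algebra.smul_def, map_mul, map_pow, hψ, he, ht, hw, ← map_pow, ← map_mul]
    congr 1
    rw [PowerSeries.monomial_pow, PowerSeries.monomial_mul_monomial, zero_add, mul_comm n m]
  have hfin : (Submodule.span T E).FG := by
    have : IsNoetherian T (integralClosure T K) :=
      have : Module.Finite T (integralClosure T K) := hT
      isNoetherian_of_isNoetherianRing_of_finite _ _
    have hle : Submodule.span T E ≤ Subalgebra.toSubmodule (integralClosure T K) :=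
      Submodule.span_le.2 hEC
    exact (isNoetherian_submodule.1 (this : IsNoetherian T
      (Subalgebra.toSubmodule (integralClosure T K)))) _ hle
  obtain ⟨F, hFE, hF⟩ := Submodule.fg_span_iff_fg_span_finset_subset E |>.1 hfin
  choose! deg X hX hψX using fun e (he : e ∈ E) => he
  refine ⟨F.sup deg, fun n x hx => ?_⟩
  obtain ⟨e, heE, he⟩ := hE _ x hx
  have hmem : e ∈ Submodule.span T (F : Set K) := hF ▸ Submodule.subset_span heE
  obtain ⟨f, -, hf⟩ := Submodule.mem_span_finset.1 hmem
  have hkey : ∑ a ∈ F, φ (f a) * PowerSeries.monomial (deg a) (X a) =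
      PowerSeries.monomial (n + F.sup deg) x := by
    apply hι
    rw [← he, ← hf, map_sum, map_sum]
    refine Finset.sum_congr rfl fun a ha => ?_
    rw [Algebra.smul_def, map_mul, map_mul, hψ, hψX a (hFE ha)]
  have hkey2 := congrArg (PowerSeries.coeff (n + F.sup deg)) hkey
  rw [PowerSeries.coeff_monomial_same, map_sum] at hkey2
  rw [← hkey2]
  refine Submodule.sum_mem _ fun a ha => ?_
  have hle : deg a ≤ F.sup deg := Finset.le_sup ha
  have h1 : n + F.sup deg = (n + (F.sup deg - deg a)) + deg a := by omega
  have h2 : PowerSeries.monomial (deg a) (X a) =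
      PowerSeries.C (X a) * PowerSeries.X ^ deg a := by
    rw [PowerSeries.X_pow_eq, ← PowerSeries.monomial_zero_eq_C_apply,
      PowerSeries.monomial_mul_monomial, zero_add, mul_one]
  rw [h2, ← mul_assoc, h1, PowerSeries.coeff_mul_X_pow, mul_comm, PowerSeries.coeff_C_mul]
  exact Ideal.mul_mem_left _ _ (Ideal.pow_le_pow_right (by omega) (hcoeff _ _))

theorem exists_intClosure_pow_le_of_isNOne_reesAlgebra [IsNoetherianRing S] {I : Ideal S}
    (h : IsNOne (reesAlgebra I)) : ∃ c, ∀ n, intClosure (I ^ (n + c)) ≤ I ^ n := by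
  refine exists_intClosure_pow_le_of_isNOne h
    ((Polynomial.coeToPowerSeries.ringHom (R := S)).comp (reesAlgebra I).subtype) ?_ ?_ ?_
  · exact (Polynomial.coe_injective S).comp (Subtype.val_injective (p := (· ∈ reesAlgebra I)))
  · intro t n
    simpa using (mem_reesAlgebra_iff _ _).1 t.2 n
  · intro n x hx
    exact ⟨⟨monomial n x, reesAlgebra.monomial_mem.2 hx⟩, by simp⟩

end ReesBound

section PurelyInseparable

open IntermediateField

theorem isPurelyInseparable_fixedField_top (K N : Type*) [Field K] [Field N] [Algebra K N]
    [FiniteDimensional K N] [Normal K N] :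
    IsPurelyInseparable K (fixedField (⊤ : Subgroup (N ≃ₐ[K] N))) := by
  refine isPurelyInseparable_iff.2 fun x => ⟨Algebra.IsIntegral.isIntegral x, fun hx => ?_⟩
  have hint : IsIntegral K (x : N) := Algebra.IsIntegral.isIntegral _
  have hmp : minpoly K (x : N) = minpoly K x := (minpoly_eq x).symm
  have hroot : ∀ y ∈ (minpoly K (x : N)).rootSet N, y = x := by
    intro y hy
    rw [mem_rootSet] at hy
    obtain ⟨σ, hσ⟩ := minpoly.exists_algEquiv_of_root'
      (Algebra.IsAlgebraic.isAlgebraic (x : N)) hy.2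
    have := x.2 ⟨σ, trivial⟩
    rw [← hσ]; exact this
  have hcard : Fintype.card ((minpoly K (x : N)).rootSet N) = (minpoly K (x : N)).natDegree := by
    apply card_rootSet_eq_natDegree
    · rw [hmp]; exact hx
    · exact Normal.splits inferInstance _
  have hle : Fintype.card ((minpoly K (x : N)).rootSet N) ≤ 1 := by
    rw [Fintype.card_le_one_iff]
    intro a b
    exact Subtype.ext ((hroot a a.2).trans (hroot b b.2).symm)
  have hdeg : (minpoly K x).natDegree = 1 := by
    rw [← hmp]
    have := minpoly.natDegree_pos hint
    omega
  exact minpoly.mem_range_of_degree_eq_one K x ((degree_eq_iff_natDegree_eq_of_pos one_pos).2 hdeg)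

end PurelyInseparable

section NTwo

/-- A domain is N-2 if its integral closure in every finite extension of its fraction field is
a finite module. -/
def IsNTwo (A : Type u) [CommRing A] [IsDomain A] : Prop :=
  ∀ (K L : Type u) [Field K] [Field L] [Algebra A K] [IsFractionRing A K] [Algebra K L]
    [Algebra A L] [IsScalarTower A K L] [FiniteDimensional K L],
    Module.Finite A (integralClosure A L)

theorem Module.Finite.integralClosure_of_algHom {A L N : Type*} [CommRing A] [IsNoetherianRing A]
    [CommRing L] [CommRing N] [Algebra A L] [Algebra A N] (f : L →ₐ[A] N)
    (hf : Function.Injective f) (h : Module.Finite A (integralClosure A N)) :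
    Module.Finite A (integralClosure A L) := by
  let g : integralClosure A L →ₗ[A] integralClosure A N :=
    { toFun := fun x => ⟨f x, x.2.map f⟩
      map_add' := fun x y => Subtype.ext (map_add f _ _)
      map_smul' := fun a x => Subtype.ext (map_smul f _ _) }
  exact Module.Finite.of_injective g fun x y hxy =>
    Subtype.ext (hf (congrArg Subtype.val hxy))

theorem Module.Finite.integralClosure_of_tower (A C F N : Type*) [CommRing A] [CommRing C]
    [IsDomain C] [IsNoetherianRing C] [IsIntegrallyClosed C] [Algebra A C] [Module.Finite A C]
    [Field F] [Field N] [Algebra C F] [IsFractionRing C F] [Algebra F N] [FiniteDimensional F N]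
    [Algebra.IsSeparable F N] [Algebra A N] [Algebra C N] [IsScalarTower C F N]
    [IsScalarTower A C N] : Module.Finite A (integralClosure A N) := by
  have hfin : Module.Finite C (integralClosure C N) :=
    IsIntegralClosure.finite C F N (integralClosure C N)
  have : Module.Finite A (integralClosure C N) := Module.Finite.trans C _
  let e : integralClosure C N →ₗ[A] integralClosure A N :=
    { toFun := fun x => ⟨x, isIntegral_trans (R := A) (A := C) _ x.2⟩
      map_add' := fun _ _ => rfl
      map_smul' := fun a x => Subtype.ext (by simp) }
  exact Module.Finite.of_surjective e fun y => ⟨⟨y, y.2.tower_top⟩, rfl⟩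

/-- A Noetherian integrally closed domain with finite integral closure in every finite purely
inseparable extension is N-2. -/
theorem IsNTwo.of_isPurelyInseparable {A : Type u} [CommRing A] [IsDomain A] [IsNoetherianRing A]
    [IsIntegrallyClosed A]
    (h : ∀ (K L : Type u) [Field K] [Field L] [Algebra A K] [IsFractionRing A K] [Algebra K L]
      [Algebra A L] [IsScalarTower A K L] [FiniteDimensional K L] [IsPurelyInseparable K L],
      Module.Finite A (integralClosure A L)) : IsNTwo A := by
  intro K L _ _ _ _ _ _ _ _
  let N := IntermediateField.normalClosure K L (AlgebraicClosure L)
  let _ : Algebra A N := ((algebraMap K N).comp (algebraMap A K)).toAlgebra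
  have : IsScalarTower A K N := IsScalarTower.of_algebraMap_eq fun _ => rfl
  have : Normal K N := normalClosure.normal K L (AlgebraicClosure L)
  have : IsScalarTower A L N := by
    refine IsScalarTower.of_algebraMap_eq fun x => ?_
    rw [IsScalarTower.algebraMap_apply A K L, ← IsScalarTower.algebraMap_apply K L N]
    rfl
  refine Module.Finite.integralClosure_of_algHom (IsScalarTower.toAlgHom A L N)
    (algebraMap L N).injective ?_
  let F := IntermediateField.fixedField (⊤ : Subgroup (N ≃ₐ[K] N))
  have : IsPurelyInseparable K F := isPurelyInseparable_fixedField_top K N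
  let _ : Algebra A F := ((algebraMap K F).comp (algebraMap A K)).toAlgebra
  have : IsScalarTower A K F := IsScalarTower.of_algebraMap_eq fun _ => rfl
  have : IsScalarTower A F N := IsScalarTower.of_algebraMap_eq fun _ => rfl
  let C := integralClosure A F
  have hC : Module.Finite A C := h K F
  have : IsNoetherianRing C := IsNoetherianRing.of_finite A C
  have : IsFractionRing C F := integralClosure.isFractionRing_of_finite_extension K F
  have : IsIntegrallyClosed C := integralClosure.isIntegrallyClosedOfFiniteExtension K
  have : IsGalois F N := by
    refine IsGalois.of_fixedField_eq_bot F N (eq_bot_iff.2 fun x hx => ?_)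
    have hxF : x ∈ F := by
      rintro ⟨σ, -⟩
      exact hx ⟨AlgEquiv.ofRingEquiv (f := σ.toRingEquiv) fun y => y.2 ⟨σ, trivial⟩, trivial⟩
    exact IntermediateField.mem_bot.2 ⟨⟨x, hxF⟩, rfl⟩
  exact Module.Finite.integralClosure_of_tower A C F N

end NTwo

section NTwoConsequences

theorem IsNTwo.of_charZero {A : Type u} [CommRing A] [IsDomain A] [IsNoetherianRing A]
    [IsIntegrallyClosed A] [CharZero A] : IsNTwo A := by
  intro K L _ _ _ _ _ _ _ _
  have : CharZero K := charZero_of_injective_algebraMap (IsFractionRing.injective A K)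
  exact IsIntegralClosure.finite A K L (integralClosure A L)

/-- The integral closure of an N-2 domain in a field generated by a finite extension is finite. -/
theorem IsNTwo.isNOne_of_finite {A : Type u} [CommRing A] [IsDomain A] [IsNoetherianRing A]
    (hA : IsNTwo A)
    {B : Type u} [CommRing B] [IsDomain B] [Algebra A B] [Module.Finite A B] [FaithfulSMul A B] :
    IsNOne B := by
  let K := FractionRing A
  let L := FractionRing B
  let _ : Algebra K L := FractionRing.liftAlgebra A L
  have : IsScalarTower A K L := inferInstance
  have : FiniteDimensional K L := by
    obtain ⟨G, hG⟩ := Module.Finite.fg_top (R := A) (M := B)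
    let E := IntermediateField.adjoin K (algebraMap B L '' G)
    have hfin : FiniteDimensional K E := by
      have : Finite (algebraMap B L '' (G : Set B)) := (G.finite_toSet.image _).to_subtype
      refine IntermediateField.finiteDimensional_adjoin ?_
      rintro _ ⟨g, -, rfl⟩
      exact ((Algebra.IsIntegral.isIntegral (R := A) g).map
        (IsScalarTower.toAlgHom A B L)).tower_top
    have hB : ∀ b : B, algebraMap B L b ∈ E := by
      intro b
      have hb : b ∈ Submodule.span A (G : Set B) := hG ▸ Submodule.mem_top
      induction hb using Submodule.span_induction with
      | mem g hg => exact IntermediateField.subset_adjoin K _ ⟨g, hg, rfl⟩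
      | zero => simp
      | add x y _ _ hx hy => rw [map_add]; exact add_mem hx hy
      | smul a x _ hx =>
        rw [Algebra.smul_def, map_mul, ← IsScalarTower.algebraMap_apply,
          IsScalarTower.algebraMap_apply A K L]
        exact mul_mem (E.algebraMap_mem _) hx
    have hE : E = ⊤ := by
      refine eq_top_iff.2 fun x _ => ?_
      obtain ⟨b, c, -, rfl⟩ := IsFractionRing.div_surjective (A := B) x
      exact div_mem (hB b) (hB c)
    rw [hE] at hfin
    exact Module.Finite.equiv IntermediateField.topEquiv.toLinearEquiv
  have h : Module.Finite A (integralClosure A L) := hA K L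
  let e : integralClosure A L →ₗ[A] integralClosure B L :=
    { toFun := fun x => ⟨x, x.2.tower_top⟩
      map_add' := fun _ _ => rfl
      map_smul' := fun a x => Subtype.ext (by simp) }
  have : Module.Finite A (integralClosure B L) := Module.Finite.of_surjective e fun y =>
    ⟨⟨y, isIntegral_trans (R := A) (A := B) _ y.2⟩, rfl⟩
  exact Module.Finite.of_restrictScalars_finite A B _

end NTwoConsequences

section Roots

/-- If `L` is generated over the fraction field of `A` by `p ^ e`-th roots of elements of `A`
that become `p ^ e`-th powers in a finite integrally closed extension of `A`, then the integral
closure of `A` in `L` is finite. -/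
theorem Module.Finite.integralClosure_of_roots {A C K L : Type u} [CommRing A] [IsDomain A]
    [IsNoetherianRing A] [CommRing C] [IsDomain C] [IsIntegrallyClosed C] [Algebra A C]
    [Module.Finite A C] [FaithfulSMul A C] [Field K] [Field L] [Algebra A K] [IsFractionRing A K]
    [Algebra K L] [Algebra A L] [IsScalarTower A K L] [FiniteDimensional K L]
    (p : ℕ) [ExpChar A p] (e : ℕ) {G : Set L} (hG : IntermediateField.adjoin K G = ⊤)
    (hroot : ∀ g ∈ G, ∃ (a : A) (γ : C), g ^ p ^ e = algebraMap A L a ∧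
      γ ^ p ^ e = algebraMap A C a) :
    Module.Finite A (integralClosure A L) := by
  let F := FractionRing C
  let Ω := AlgebraicClosure F
  have hAF : Function.Injective (algebraMap A F) := FaithfulSMul.algebraMap_injective A F
  let _ : Algebra K F := (IsFractionRing.lift hAF : K →+* F).toAlgebra
  have : IsScalarTower A K F :=
    .of_algebraMap_eq fun x => (IsFractionRing.lift_algebraMap hAF x).symm
  let _ : Algebra K Ω := inferInstance
  have : IsScalarTower K F Ω := inferInstance
  have : IsScalarTower A K Ω := .of_algebraMap_eq fun x => by
    rw [IsScalarTower.algebraMap_apply K F Ω, ← IsScalarTower.algebraMap_apply A K F,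
      ← IsScalarTower.algebraMap_apply A F Ω]
  have hAΩ : Function.Injective (algebraMap A Ω) := by
    rw [IsScalarTower.algebraMap_eq A F Ω]
    exact (algebraMap F Ω).injective.comp hAF
  have : ExpChar Ω p := expChar_of_injective_algebraMap hAΩ p
  let f : L →ₐ[K] Ω := IsAlgClosed.lift
  let E : IntermediateField K Ω := (IsScalarTower.toAlgHom K F Ω).fieldRange
  have hfA : ∀ a, f (algebraMap A L a) = algebraMap A Ω a := fun a => by
    rw [IsScalarTower.algebraMap_apply A K L, f.commutes, ← IsScalarTower.algebraMap_apply]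
  have hfE : ∀ x, f x ∈ E := by
    have h : (⊤ : IntermediateField K L) ≤ E.comap f := by
      rw [← hG, IntermediateField.adjoin_le_iff]
      intro g hg
      obtain ⟨a, γ, h1, h2⟩ := hroot g hg
      refine ⟨algebraMap C F γ, ?_⟩
      apply iterateFrobenius_inj Ω p e
      simp only [iterateFrobenius_def]
      have h3 : f g ^ p ^ e = algebraMap A Ω a := by rw [← map_pow, h1, hfA]
      refine Eq.trans ?_ h3.symm
      change (algebraMap F Ω (algebraMap C F γ)) ^ p ^ e = _
      rw [← map_pow, ← map_pow, h2, ← IsScalarTower.algebraMap_apply A C F,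
        ← IsScalarTower.algebraMap_apply A F Ω]
    exact fun x => h (IntermediateField.mem_top (x := x))
  let fA : L →ₐ[A] Ω := f.restrictScalars A
  let R := LinearMap.range ((IsScalarTower.toAlgHom A F Ω).comp
    (IsScalarTower.toAlgHom A C F)).toLinearMap
  have hR : ∀ x : integralClosure A L, fA x ∈ R := by
    intro x
    obtain ⟨y, hy⟩ := hfE x
    have hy' : algebraMap F Ω y = fA x := hy
    have hint : IsIntegral A (algebraMap F Ω y) := by
      rw [hy']; exact x.2.map fA
    have hint2 : IsIntegral A y :=
      (isIntegral_algebraMap_iff (algebraMap F Ω).injective).1 hint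
    obtain ⟨c, hc⟩ := IsIntegrallyClosed.isIntegral_iff.1 (hint2.tower_top (A := C))
    exact ⟨c, by rw [← hy', ← hc]; rfl⟩
  let g : integralClosure A L →ₗ[A] R :=
    (fA.toLinearMap.comp (integralClosure A L).val.toLinearMap).codRestrict R hR
  exact Module.Finite.of_injective g fun x y hxy =>
    Subtype.ext (f.injective (congrArg Subtype.val hxy))

/-- A finite purely inseparable extension is generated by finitely many `p ^ e`-th roots of
elements of a given ring with the right fraction field. -/
theorem IsPurelyInseparable.exists_adjoin_eq_top (A K L : Type*) [CommRing A]
    [IsDomain A] [Field K] [Field L] [Algebra A K] [IsFractionRing A K]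
    [Algebra K L] [Algebra A L] [IsScalarTower A K L] [FiniteDimensional K L]
    [IsPurelyInseparable K L] (p : ℕ) [ExpChar A p] :
    ∃ (e : ℕ) (G : Finset L), IntermediateField.adjoin K (G : Set L) = ⊤ ∧
      ∀ g ∈ G, ∃ a : A, g ^ p ^ e = algebraMap A L a := by
  classical
  have : ExpChar K p := expChar_of_injective_algebraMap (IsFractionRing.injective A K) p
  obtain ⟨G, hG⟩ := Module.Finite.fg_top (R := K) (M := L)
  have hex : ∀ x : L, ∃ d : A, d ≠ 0 ∧
      ∃ a : A, (d • x) ^ p ^ exponent K L = algebraMap A L a := by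
    intro x
    obtain ⟨k, hk⟩ := exponent_def' K p x
    obtain ⟨a, d, hd, rfl⟩ := IsFractionRing.div_surjective (A := A) k
    have hd0 : d ≠ 0 := nonZeroDivisors.ne_zero hd
    have hdK : algebraMap A K d ≠ 0 := by
      simpa using hd0
    refine ⟨d, hd0, a * d ^ (p ^ exponent K L - 1), ?_⟩
    rw [_root_.smul_pow, ← hk, Algebra.smul_def, IsScalarTower.algebraMap_apply A K L, ← map_mul,
      IsScalarTower.algebraMap_apply A K L]
    congr 1
    obtain ⟨m, hm⟩ := Nat.exists_eq_succ_of_ne_zero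
      (pow_ne_zero (exponent K L) (expChar_ne_zero K p))
    rw [hm, map_pow, map_mul, map_pow]
    field_simp
    simp only [Nat.succ_eq_add_one, Nat.add_sub_cancel, pow_succ]
    ring
  choose d hd0 hd using hex
  refine ⟨exponent K L, G.image fun x => d x • x, ?_, ?_⟩
  · rw [eq_top_iff]
    intro x _
    have hx : x ∈ Submodule.span K (G : Set L) := hG ▸ Submodule.mem_top
    induction hx using Submodule.span_induction with
    | mem g hg =>
      have h1 : d g • g ∈
          IntermediateField.adjoin K ((G.image fun x => d x • x : Finset L) : Set L) :=
        IntermediateField.subset_adjoin K _ (by simpa using ⟨g, hg, rfl⟩)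
      have hdK : algebraMap A K (d g) ≠ 0 := by simpa using hd0 g
      have h2 := IntermediateField.smul_mem _ h1 (x := (algebraMap A K (d g))⁻¹)
      rwa [← algebraMap_smul K (d g) g, inv_smul_smul₀ hdK] at h2
    | zero => exact zero_mem _
    | add x y _ _ hx hy => exact add_mem (hx trivial) (hy trivial)
    | smul a x _ hx => exact IntermediateField.smul_mem _ (hx trivial)
  · intro g hg
    obtain ⟨x, -, rfl⟩ := Finset.mem_image.1 hg
    exact hd x

end Roots

section Fields

theorem IsNTwo.mvPolynomial (F : Type u) [Field F] (n : ℕ) : IsNTwo (MvPolynomial (Fin n) F) := by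
  classical
  refine IsNTwo.of_isPurelyInseparable fun K L _ _ _ _ _ _ _ _ _ => ?_
  obtain ⟨p, hp⟩ := ExpChar.exists F
  have : ExpChar (MvPolynomial (Fin n) F) p :=
    expChar_of_injective_algebraMap (MvPolynomial.C_injective (Fin n) F) p
  obtain ⟨e, G, hG, hGA⟩ := IsPurelyInseparable.exists_adjoin_eq_top (MvPolynomial (Fin n) F) K L p
  choose! a ha using hGA
  have hq : p ^ e ≠ 0 := pow_ne_zero e (expChar_ne_zero F p)
  let Ω := AlgebraicClosure F
  have hz : ∀ c : F, ∃ z : Ω, z ^ p ^ e = algebraMap F Ω c := fun c =>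
    IsAlgClosed.exists_pow_nat_eq _ (Nat.pos_of_ne_zero hq)
  choose z hz using hz
  let Z : Set Ω := z '' (G.biUnion fun g => (a g).coeffs : Finset F)
  let F' := IntermediateField.adjoin F Z
  have : FiniteDimensional F F' := by
    have : Finite Z := (Finset.finite_toSet _).image _ |>.to_subtype
    exact IntermediateField.finiteDimensional_adjoin fun x _ => Algebra.IsIntegral.isIntegral x
  have : ExpChar F' p := expChar_of_injective_algebraMap (algebraMap F F').injective p
  let C := MvPolynomial (Fin n) F'
  let ι : MvPolynomial (Fin n) F →+* C :=
    ((MvPolynomial.expand (p ^ e) : C →ₐ[F'] C) : C →+* C).comp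
      (MvPolynomial.map (algebraMap F F'))
  let _ : Algebra (MvPolynomial (Fin n) F) C := ι.toAlgebra
  have hι : ∀ x, algebraMap (MvPolynomial (Fin n) F) C x = ι x := fun _ => rfl
  have : IsScalarTower F (MvPolynomial (Fin n) F) C := .of_algebraMap_eq fun x => by
    rw [hι, MvPolynomial.algebraMap_eq]
    simp only [ι, RingHom.comp_apply]
    rw [IsScalarTower.algebraMap_apply F F' C]
    simp [C, MvPolynomial.algebraMap_eq]
  have : Algebra.FiniteType F C := .trans (S := F') inferInstance inferInstance
  have : Algebra.FiniteType (MvPolynomial (Fin n) F) C :=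
    .of_restrictScalars_finiteType F _ _
  have : Algebra.IsIntegral (MvPolynomial (Fin n) F) C := by
    refine ⟨fun x => ?_⟩
    induction x using MvPolynomial.induction_on with
    | C y =>
      have h : IsIntegral F (algebraMap F' C y) :=
        (Algebra.IsIntegral.isIntegral (R := F) y).map (IsScalarTower.toAlgHom F F' C)
      exact h.tower_top
    | add x y hx hy => exact hx.add hy
    | mul_X x i hx =>
      refine hx.mul (IsIntegral.of_pow (Nat.pos_of_ne_zero hq) ?_)
      have : (MvPolynomial.X i : C) ^ p ^ e =
          algebraMap (MvPolynomial (Fin n) F) C (MvPolynomial.X i) := by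
        rw [hι]; simp [ι, C]
      rw [this]
      exact isIntegral_algebraMap
  have : Module.Finite (MvPolynomial (Fin n) F) C := Algebra.IsIntegral.finite
  have : FaithfulSMul (MvPolynomial (Fin n) F) C := by
    rw [faithfulSMul_iff_algebraMap_injective]
    exact (MvPolynomial.expand_injective (Nat.pos_of_ne_zero hq)).comp
      (MvPolynomial.map_injective _ (algebraMap F F').injective)
  refine Module.Finite.integralClosure_of_roots (C := C) p e hG fun g hg => ?_
  have hγ : MvPolynomial.map (algebraMap F F') (a g) ∈
      Set.range (MvPolynomial.map (iterateFrobenius F' p e)) := by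
    rw [MvPolynomial.mem_range_map_iff_coeffs_subset]
    intro c hc
    obtain ⟨c', hc', rfl⟩ : ∃ c' ∈ (a g).coeffs, algebraMap F F' c' = c := by
      have := MvPolynomial.coeffs_map (algebraMap F F') (a g) hc
      simpa using this
    have hmem : z c' ∈ F' := IntermediateField.subset_adjoin F Z
      ⟨c', by simpa using ⟨g, hg, hc'⟩, rfl⟩
    exact ⟨⟨z c', hmem⟩, Subtype.ext (by simpa [iterateFrobenius_def] using hz c')⟩
  obtain ⟨γ, hγ⟩ := hγ
  refine ⟨a g, γ, ha g hg, ?_⟩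
  rw [hι, ← MvPolynomial.map_iterateFrobenius_expand, MvPolynomial.map_expand, hγ]
  rfl

theorem isNOne_of_finiteType_field (F B : Type u) [Field F] [CommRing B] [IsDomain B] [Algebra F B]
    [Algebra.FiniteType F B] : IsNOne B := by
  obtain ⟨s, g, hg, hfin⟩ := exists_finite_inj_algHom_of_fg F B
  let _ : Algebra (MvPolynomial (Fin s) F) B := g.toRingHom.toAlgebra
  have : Module.Finite (MvPolynomial (Fin s) F) B := hfin
  have : FaithfulSMul (MvPolynomial (Fin s) F) B :=
    (faithfulSMul_iff_algebraMap_injective _ _).2 hg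
  exact (IsNTwo.mvPolynomial F s).isNOne_of_finite

theorem isNOne_reesAlgebra_of_fieldBase {S : Type u} [CommRing S] [IsDomain S] [IsNoetherianRing S]
    (h : FieldBase S) (I : Ideal S) : IsNOne (reesAlgebra I) := by
  let _ := h.fld
  let _ := h.alg
  have := h.fg
  have : Algebra.FiniteType h.F (reesAlgebra I) := .trans (S := S) inferInstance inferInstance
  exact isNOne_of_finiteType_field h.F _

theorem isNOne_reesAlgebra_of_nagataBase {S : Type u} [CommRing S] [IsDomain S]
    [IsNoetherianRing S] (h : NagataBase S) (I : Ideal S) : IsNOne (reesAlgebra I) := by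
  let _ := h.cring
  let _ := h.alg
  have := h.fg
  have : Algebra.FiniteType h.R (reesAlgebra I) := .trans (S := S) inferInstance inferInstance
  exact h.finiteIntegralClosure _ this

end Fields

section Heights

/-- In a domain, dividing by a nonzero ideal lowers the height of a prime containing it. -/
theorem Ideal.height_map_quotientMk_add_one_le {R : Type*} [CommRing R] [IsDomain R]
    [IsNoetherianRing R] {J P : Ideal R} [P.IsPrime] (hJ : J ≠ ⊥) (hJP : J ≤ P) :
    (P.map (Ideal.Quotient.mk J)).height + 1 ≤ P.height := by
  have hP' : (P.map (Ideal.Quotient.mk J)).IsPrime :=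
    Ideal.map_isPrime_of_surjective Ideal.Quotient.mk_surjective (by simpa using hJP)
  obtain ⟨l, hl, hlen⟩ := Ideal.exists_ltSeries_length_eq_height (P.map (Ideal.Quotient.mk J))
  have hmono := RingHom.strictMono_comap_of_surjective
    (f := Ideal.Quotient.mk J) Ideal.Quotient.mk_surjective
  set l' := l.map (PrimeSpectrum.comap (Ideal.Quotient.mk J)) hmono with hl'
  have hbot : (⊥ : PrimeSpectrum R) < l'.head := by
    refine bot_lt_iff_ne_bot.2 fun h => hJ ?_
    have h1 : J ≤ (l'.head).asIdeal := by
      intro x hx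
      have : l'.head = PrimeSpectrum.comap (Ideal.Quotient.mk J) l.head := rfl
      rw [this, PrimeSpectrum.comap_asIdeal, Ideal.mem_comap,
        Ideal.Quotient.eq_zero_iff_mem.2 hx]
      exact zero_mem _
    rw [h] at h1
    exact le_bot_iff.1 h1
  have hlast : (l'.cons ⊥ hbot).last = ⟨P, inferInstance⟩ := by
    rw [RelSeries.last_cons]
    have : l'.last = PrimeSpectrum.comap (Ideal.Quotient.mk J) l.last := rfl
    rw [this, hl]
    ext1
    rw [PrimeSpectrum.comap_asIdeal]
    change Ideal.comap _ (Ideal.map _ P) = P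
    rw [Ideal.comap_map_of_surjective _ Ideal.Quotient.mk_surjective, ← RingHom.ker_eq_comap_bot,
      Ideal.mk_ker, sup_eq_left.2 hJP]
  have := Order.length_le_height (p := l'.cons ⊥ hbot) (x := ⟨P, inferInstance⟩) hlast.le
  rw [← hlen]
  rw [← PrimeSpectrum.height_eq_orderHeight] at this
  refine le_trans (le_of_eq ?_) this
  simp [hl']

/-- A Noetherian algebra over a Noetherian domain which is zero-dimensional in the fiber over a
prime of small height is a faithful algebra. -/
theorem Ideal.algebraMap_injective_of_height_le {D B : Type*} [CommRing D] [IsDomain D]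
    [IsNoetherianRing D] [CommRing B] [IsNoetherianRing B] [Algebra D B]
    (n : Ideal D) [n.IsPrime] (m : Ideal B) [m.IsPrime] [m.LiesOver n]
    (hmin : m ∈ (n.map (algebraMap D B)).minimalPrimes) (h : n.height ≤ m.height) :
    Function.Injective (algebraMap D B) := by
  rw [RingHom.injective_iff_ker_eq_bot]
  by_contra hJ
  set J := RingHom.ker (algebraMap D B) with hJdef
  have hn : n = m.comap (algebraMap D B) := Ideal.LiesOver.over
  have hJn : J ≤ n := by
    rw [hn]; exact Ideal.comap_mono bot_le
  let _ : Algebra (D ⧸ J) B := (RingHom.kerLift (algebraMap D B)).toAlgebra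
  have hcomp : (algebraMap (D ⧸ J) B).comp (Ideal.Quotient.mk J) = algebraMap D B := rfl
  have hprime : (n.map (Ideal.Quotient.mk J)).IsPrime :=
    Ideal.map_isPrime_of_surjective Ideal.Quotient.mk_surjective (by simpa using hJn)
  have hover : m.LiesOver (n.map (Ideal.Quotient.mk J)) := by
    refine ⟨?_⟩
    apply Ideal.comap_injective_of_surjective _ (Ideal.Quotient.mk_surjective (I := J))
    rw [Ideal.comap_map_of_surjective _ Ideal.Quotient.mk_surjective, ← RingHom.ker_eq_comap_bot,
      Ideal.mk_ker, sup_eq_left.2 hJn, Ideal.under_def, Ideal.comap_comap, hcomp, hn]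
  have h1 := Ideal.height_le_height_add_of_liesOver (n.map (Ideal.Quotient.mk J)) m
  have hmap : Ideal.map (algebraMap (D ⧸ J) B) (n.map (Ideal.Quotient.mk J)) =
      n.map (algebraMap D B) := by
    rw [Ideal.map_map, hcomp]
  rw [hmap] at h1
  have h2 : (m.map (Ideal.Quotient.mk (n.map (algebraMap D B)))).height = 0 := by
    have hp : (m.map (Ideal.Quotient.mk (n.map (algebraMap D B)))).IsPrime :=
      Ideal.map_isPrime_of_surjective Ideal.Quotient.mk_surjective (by simpa using hmin.1.2)
    rw [Ideal.height_eq_zero_iff]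
    refine ⟨⟨hp, bot_le⟩, fun q hq hqm => ?_⟩
    have hqp := hq.1
    have : m ≤ q.comap (Ideal.Quotient.mk (n.map (algebraMap D B))) := by
      refine hmin.2 ⟨inferInstance, ?_⟩ ?_
      · conv_lhs => rw [← Ideal.mk_ker (I := n.map (algebraMap D B))]
        exact Ideal.comap_mono bot_le
      · refine (Ideal.comap_mono hqm).trans ?_
        rw [Ideal.comap_map_of_surjective _ Ideal.Quotient.mk_surjective,
          ← RingHom.ker_eq_comap_bot, Ideal.mk_ker, sup_eq_left.2 hmin.1.2]
    exact Ideal.map_le_iff_le_comap.2 this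
  rw [h2, add_zero] at h1
  have h3 := (Ideal.height_map_quotientMk_add_one_le hJ hJn).trans (h.trans h1)
  have h4 : (n.map (Ideal.Quotient.mk J)).height ≠ ⊤ := Ideal.height_ne_top hprime.ne_top
  exact absurd h3 (not_le.2 (ENat.lt_add_one_iff h4 |>.2 le_rfl))

end Heights

section Local

/-- Finiteness of the integral closure can be checked locally. -/
theorem isNOne_of_forall_isMaximal {B : Type*} [CommRing B] [IsNoetherianRing B]
    (h : ∀ m : Ideal B, m.IsMaximal → ∃ s ∉ m, ∃ N : Submodule B (FractionRing B), N.FG ∧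
      ∀ y ∈ integralClosure B (FractionRing B), ∃ k : ℕ, s ^ k • y ∈ N) : IsNOne B := by
  choose! s hs N hN hy using h
  have htop : Ideal.span (s '' {m : Ideal B | m.IsMaximal}) = ⊤ := by
    by_contra hne
    obtain ⟨m, hm, hle⟩ := Ideal.exists_le_maximal _ hne
    exact hs m hm (hle (Ideal.subset_span ⟨m, hm, rfl⟩))
  obtain ⟨t, ht, htop'⟩ := (Ideal.span_eq_top_iff_finite _).1 htop
  classical
  obtain ⟨M, hM, rfl⟩ := Finset.subset_set_image_iff.1 ht
  set N' : Submodule B (FractionRing B) := ⨆ m ∈ M, N m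
  have hN' : N'.FG := Submodule.fg_biSup _ _ fun m hm => hN m (hM hm)
  have hle : Subalgebra.toSubmodule (integralClosure B (FractionRing B)) ≤ N' := by
    intro y hyi
    refine Submodule.mem_of_span_eq_top_of_smul_pow_mem N' _ htop' y ?_
    rintro ⟨_, hr⟩
    obtain ⟨m, hm, rfl⟩ := Finset.mem_image.1 hr
    obtain ⟨k, hk⟩ := hy m (hM hm) y hyi
    exact ⟨k, (le_iSup₂_of_le (f := fun m (_ : m ∈ M) => N m) m hm le_rfl) hk⟩
  have : IsNoetherian B N' := isNoetherian_of_fg_of_noetherian _ hN'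
  exact Module.Finite.of_injective (Submodule.inclusion hle) (Submodule.inclusion_injective hle)

theorem exists_isIntegral_pow_mul {D B L : Type*} [CommRing D] [CommRing B] [Algebra D B]
    [CommRing L] [Algebra B L] (S' : Subalgebra D B) (r : S')
    (h : ∀ b : B, ∃ k : ℕ, (r : B) ^ k * b ∈ S') {y : L} (hy : IsIntegral B y) :
    ∃ k : ℕ, ∃ f : S'[X], f.Monic ∧ f.eval₂ ((algebraMap B L).comp S'.val.toRingHom)
      ((r : B) ^ k • y) = 0 := by
  obtain ⟨f, hf, hfy⟩ := hy
  choose k hk using h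
  set K := ∑ i ∈ Finset.range (f.natDegree), k (f.coeff i)
  have hmem : ∀ i, (f.scaleRoots ((r : B) ^ K)).coeff i ∈ S' := by
    intro i
    rw [coeff_scaleRoots]
    rcases lt_trichotomy i f.natDegree with hi | rfl | hi
    · obtain ⟨d, hd⟩ : ∃ d, f.natDegree - i = d + 1 := ⟨f.natDegree - i - 1, by omega⟩
      have hK : k (f.coeff i) ≤ K :=
        Finset.single_le_sum (f := fun i => k (f.coeff i)) (fun _ _ => zero_le)
          (Finset.mem_range.2 hi)
      obtain ⟨e, he⟩ := Nat.exists_eq_add_of_le hK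
      have : f.coeff i * ((r : B) ^ K) ^ (f.natDegree - i) =
          ((r : B) ^ k (f.coeff i) * f.coeff i) * ((r : B) ^ e * ((r : B) ^ K) ^ d) := by
        rw [hd, he]; ring
      rw [this]
      exact S'.mul_mem (hk _) (S'.mul_mem (pow_mem r.2 _) (pow_mem (pow_mem r.2 _) _))
    · simp [hf.coeff_natDegree]
    · simp [coeff_eq_zero_of_natDegree_lt hi]
  have hlift : f.scaleRoots ((r : B) ^ K) ∈ lifts S'.val.toRingHom := by
    rw [lifts_iff_coeff_lifts]
    exact fun i => ⟨⟨_, hmem i⟩, rfl⟩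
  obtain ⟨g, hg, -, hgm⟩ := lifts_and_natDegree_eq_and_monic hlift (monic_scaleRoots_iff _ |>.2 hf)
  refine ⟨K, g, hgm, ?_⟩
  rw [← eval₂_map, hg, Algebra.smul_def]
  exact scaleRoots_eval₂_eq_zero _ hfy

/-- If a Noetherian domain `B` agrees with an N-1 subring `S'` after inverting `r`, then the
integral closure of `B` is finite after inverting `r`. -/
theorem exists_fg_of_isNOne_subalgebra {D B : Type*} [CommRing D] [CommRing B] [IsDomain B]
    [Algebra D B] (S' : Subalgebra D B) [IsNoetherianRing S'] (r : S') (hr : r ≠ 0)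
    (h : ∀ b : B, ∃ k : ℕ, (r : B) ^ k * b ∈ S') (hN : IsNOne S') :
    ∃ N : Submodule B (FractionRing B), N.FG ∧
      ∀ y ∈ integralClosure B (FractionRing B), ∃ k : ℕ, (r : B) ^ k • y ∈ N := by
  set L := FractionRing B
  have hinj : Function.Injective (algebraMap B L) := IsFractionRing.injective B L
  have hmap : ∀ s : S', algebraMap S' L s = algebraMap B L (s : B) := fun s => rfl
  have hr' : (r : B) ≠ 0 := fun h => hr (Subtype.ext h)
  have hfs : FaithfulSMul S' L := (faithfulSMul_iff_algebraMap_injective _ _).2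
    (hinj.comp Subtype.val_injective)
  have hfrac : IsFractionRing S' L := by
    refine IsFractionRing.of_field S' L fun z => ?_
    obtain ⟨a, b, hb, rfl⟩ := IsFractionRing.div_surjective (A := B) z
    obtain ⟨k, hk⟩ := h a
    obtain ⟨l, hl⟩ := h b
    refine ⟨⟨_, S'.mul_mem hk (pow_mem r.2 l)⟩, ⟨_, S'.mul_mem hl (pow_mem r.2 k)⟩, ?_⟩
    rw [hmap, hmap]
    have hb0 : algebraMap B L b ≠ 0 := by
      simpa using nonZeroDivisors.ne_zero hb
    have hr0 : algebraMap B L r ≠ 0 := by simpa using hr'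
    simp only [map_mul, map_pow]
    rw [div_eq_div_iff hb0 (mul_ne_zero (mul_ne_zero (pow_ne_zero _ hr0) hb0) (pow_ne_zero _ hr0))]
    ring
  have hfin : Module.Finite S' (integralClosure S' L) :=
    Module.Finite.integralClosure_of_algHom
      (FractionRing.algEquiv S' L).symm.toAlgHom (FractionRing.algEquiv S' L).symm.injective hN
  obtain ⟨G, hG⟩ := (Module.Finite.iff_fg
    (N := Subalgebra.toSubmodule (integralClosure S' L))).1 hfin
  refine ⟨Submodule.span B G, ⟨G, rfl⟩, fun y hy => ?_⟩
  obtain ⟨k, f, hf, hfy⟩ := exists_isIntegral_pow_mul S' r h hy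
  refine ⟨k, ?_⟩
  have h1 : (r : B) ^ k • y ∈ Subalgebra.toSubmodule (integralClosure S' L) := ⟨f, hf, hfy⟩
  rw [← hG] at h1
  exact Submodule.span_le_restrictScalars S' B (G : Set L) h1

end Local

section ZariskiMain

theorem Algebra.QuasiFiniteAt.of_mem_minimalPrimes_map {D B : Type*} [CommRing D]
    [CommRing B] [IsNoetherianRing B] [Algebra D B] [Algebra.FiniteType D B] (m : Ideal B)
    [hm : m.IsMaximal]
    (hmin : m ∈ ((m.comap (algebraMap D B)).map (algebraMap D B)).minimalPrimes) :
    Algebra.QuasiFiniteAt D m := by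
  set I := (m.comap (algebraMap D B)).map (algebraMap D B)
  have hfin := Ideal.finite_minimalPrimes_of_isNoetherianRing B I
  obtain ⟨f, hf, hfm⟩ : ∃ f ∈ ∏ P ∈ (hfin.toFinset.erase m), P, f ∉ m := by
    rw [← SetLike.not_le_iff_exists]
    intro h
    obtain ⟨P, hP, hPm⟩ := (Ideal.IsPrime.prod_le hm.isPrime).1 h
    rw [Finset.mem_erase, Set.Finite.mem_toFinset] at hP
    exact hP.1 (le_antisymm hPm (hmin.2 hP.2.1 hPm))
  refine Algebra.QuasiFiniteAt.of_isOpen_singleton_fiber (⟨m, hm.isPrime⟩ : PrimeSpectrum B) ?_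
  rw [isOpen_induced_iff]
  refine ⟨PrimeSpectrum.basicOpen f, PrimeSpectrum.isOpen_basicOpen, ?_⟩
  ext ⟨q, hq⟩
  simp only [Set.mem_preimage, SetLike.mem_coe, PrimeSpectrum.mem_basicOpen, Set.mem_singleton_iff]
  rw [Subtype.ext_iff, PrimeSpectrum.ext_iff]
  constructor
  · intro hfq
    have hIq : I ≤ q.asIdeal := by
      rw [Ideal.map_le_iff_le_comap]
      have := congrArg PrimeSpectrum.asIdeal (Set.mem_singleton_iff.1 hq)
      exact (this : q.asIdeal.comap _ = m.comap _).ge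
    have hqp := q.2
    obtain ⟨P, hP, hPq⟩ := Ideal.exists_minimalPrimes_le hIq
    have hPm : P = m := by
      by_contra hne
      have hle : ∏ P ∈ hfin.toFinset.erase m, P ≤ P := Ideal.prod_le_inf.trans
        (Finset.inf_le (f := fun J : Ideal B => J)
          (Finset.mem_erase.2 ⟨hne, hfin.mem_toFinset.2 hP⟩))
      exact hfq (hPq (hle hf))
    exact (hm.eq_of_le hqp.ne_top (hPm ▸ hPq)).symm
  · intro h
    have h' : q.asIdeal = m := h
    rwa [← h'] at hfm

theorem exists_fg_of_mem_minimalPrimes_map {D B : Type u} [CommRing D] [IsDomain D]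
    [IsNoetherianRing D] (hD : IsNTwo D)
    [CommRing B] [IsDomain B] [IsNoetherianRing B] [Algebra D B] [FaithfulSMul D B]
    [Algebra.FiniteType D B] (m : Ideal B) [hm : m.IsMaximal]
    (hmin : m ∈ ((m.comap (algebraMap D B)).map (algebraMap D B)).minimalPrimes) :
    ∃ s ∉ m, ∃ N : Submodule B (FractionRing B), N.FG ∧
      ∀ y ∈ integralClosure B (FractionRing B), ∃ k : ℕ, s ^ k • y ∈ N := by
  have := Algebra.QuasiFiniteAt.of_mem_minimalPrimes_map m hmin
  obtain ⟨S', hfg, r, hr, hbij⟩ :=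
    Algebra.QuasiFiniteAt.exists_fg_and_exists_notMem_and_awayMap_bijective (R := D) m
  have : Module.Finite D S' := Module.Finite.iff_fg.2 hfg
  have : IsNoetherianRing S' := IsNoetherianRing.of_finite D S'
  have hfs : FaithfulSMul D S' := by
    rw [faithfulSMul_iff_algebraMap_injective]
    refine Function.Injective.of_comp (f := S'.val) ?_
    exact FaithfulSMul.algebraMap_injective D B
  refine ⟨r, hr, exists_fg_of_isNOne_subalgebra S' r ?_ ?_ (hD.isNOne_of_finite)⟩
  · rintro rfl
    exact hr (zero_mem _)
  · intro b
    obtain ⟨c, k, hck⟩ := Localization.awayMap_surjective_iff.1 hbij.2 b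
    exact ⟨k, hck ▸ c.2⟩

end ZariskiMain

section Integers

instance Int.isJacobsonRing : IsJacobsonRing ℤ := by
  rw [isJacobsonRing_iff_prime_eq]
  intro P hP
  by_cases h : P = ⊥
  · subst h
    refine le_antisymm (fun x hx => ?_) Ideal.le_jacobson
    have h1 := Int.isUnit_iff.1 (Ideal.mem_jacobson_bot.1 hx (3 * x))
    rw [Ideal.mem_bot]
    by_contra hx0
    have : 0 < x * x := mul_self_pos.2 hx0
    rcases h1 with h1 | h1 <;> nlinarith
  · have : P.IsMaximal := hP.isMaximal h
    exact Ideal.jacobson_eq_self_of_isMaximal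

theorem Ideal.isMaximal_comap_algebraMap_of_finiteType (R : Type*) {B : Type*} [CommRing R]
    [CommRing B] [Algebra R B] [IsJacobsonRing R] [Algebra.FiniteType R B] (m : Ideal B)
    [m.IsMaximal] : (m.comap (algebraMap R B)).IsMaximal := by
  let _ := Ideal.Quotient.field m
  have : Module.Finite R (B ⧸ m) := finite_of_finite_type_of_isJacobsonRing R (B ⧸ m)
  have h := Ideal.isMaximal_comap_of_isIntegral_of_isMaximal (R := R) (⊥ : Ideal (B ⧸ m))
  have h2 : (⊥ : Ideal (B ⧸ m)).comap (algebraMap R (B ⧸ m)) = m.comap (algebraMap R B) := by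
    rw [IsScalarTower.algebraMap_eq R B (B ⧸ m), ← Ideal.comap_comap, Ideal.Quotient.algebraMap_eq,
      ← RingHom.ker_eq_comap_bot, Ideal.mk_ker]
  rwa [h2] at h

theorem isNOne_of_finiteType_of_isPrincipalIdealRing (R B : Type u) [CommRing R] [IsDomain R]
    [IsPrincipalIdealRing R] [CharZero R] [IsJacobsonRing R] (hR : ¬ IsField R)
    [CommRing B] [IsDomain B] [Algebra R B] [FaithfulSMul R B] [Algebra.FiniteType R B] :
    IsNOne B := by
  classical
  have : IsNoetherianRing B := Algebra.FiniteType.isNoetherianRing R B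
  refine isNOne_of_forall_isMaximal fun m hm => ?_
  have hp0 : (m.comap (algebraMap R B)).IsMaximal :=
    Ideal.isMaximal_comap_algebraMap_of_finiteType R m
  have hp0' : m.comap (algebraMap R B) ≠ ⊥ := fun h => hR (by
    rw [h] at hp0
    exact Ring.isField_iff_maximal_bot.2 hp0)
  obtain ⟨p, hp⟩ := IsPrincipalIdealRing.principal (m.comap (algebraMap R B))
  change _ = Ideal.span {p} at hp
  have hpne : p ≠ 0 := by
    rintro rfl
    exact hp0' (by simpa using hp)
  have hpm : algebraMap R B p ∈ m := by
    rw [← Ideal.mem_comap, hp]; exact Ideal.mem_span_singleton_self p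
  set J : Ideal B := Ideal.span {algebraMap R B p}
  have hJm : J ≤ m := (Ideal.span_singleton_le_iff_mem _).2 hpm
  have hJ : J ≠ ⊥ := by
    rw [Ne, Ideal.span_singleton_eq_bot]
    simpa using hpne
  have hprime : (m.map (Ideal.Quotient.mk J)).IsPrime :=
    Ideal.map_isPrime_of_surjective Ideal.Quotient.mk_surjective (by simpa using hJm)
  obtain ⟨s, hs, hcard⟩ := Ideal.exists_finset_card_eq_height_of_isNoetherianRing
    (m.map (Ideal.Quotient.mk J))
  have hht := Ideal.height_map_quotientMk_add_one_le hJ hJm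
  rw [← hcard] at hht
  choose x hx using fun i : Fin s.card =>
    Ideal.Quotient.mk_surjective (s.equivFin.symm i : B ⧸ J)
  let _ : Algebra (MvPolynomial (Fin s.card) R) B := (MvPolynomial.aeval x).toRingHom.toAlgebra
  set D := MvPolynomial (Fin s.card) R
  have hDB : ∀ f : D, algebraMap D B f = MvPolynomial.aeval x f := fun _ => rfl
  have : IsScalarTower R D B := IsScalarTower.of_algebraMap_eq fun r => by
    rw [hDB, MvPolynomial.algebraMap_eq, MvPolynomial.aeval_C]
  have : Algebra.FiniteType D B := .of_restrictScalars_finiteType R D B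
  set n := m.comap (algebraMap D B) with hn
  have hcomap : Ideal.comap (Ideal.Quotient.mk J) (m.map (Ideal.Quotient.mk J)) = m := by
    rw [Ideal.comap_map_of_surjective _ Ideal.Quotient.mk_surjective, ← RingHom.ker_eq_comap_bot,
      Ideal.mk_ker, sup_eq_left.2 hJm]
  have hxm : ∀ i, x i ∈ m := by
    intro i
    rw [← hcomap, Ideal.mem_comap, hx]
    exact hs.1.2 (Ideal.subset_span (s.equivFin.symm i).2)
  have hXn : ∀ i, (MvPolynomial.X i : D) ∈ n := by
    intro i
    rw [hn, Ideal.mem_comap, hDB, MvPolynomial.aeval_X]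
    exact hxm i
  have hCn : ∀ r, (MvPolynomial.C r : D) ∈ n ↔ r ∈ Ideal.span {p} := by
    intro r
    rw [hn, Ideal.mem_comap, hDB, MvPolynomial.aeval_C, ← hp, Ideal.mem_comap]
  -- the maximal ideal of `D` below `m` is generated by `p` and the variables
  set T : Finset D := insert (MvPolynomial.C p) (Finset.univ.image MvPolynomial.X)
  have hspan : n = Ideal.span (T : Set D) := by
    apply le_antisymm
    · intro f hf
      have hXT : Ideal.span (Set.range (MvPolynomial.X : Fin s.card → D)) ≤
          Ideal.span (T : Set D) := Ideal.span_mono (by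
        rintro _ ⟨i, rfl⟩
        exact Finset.mem_insert_of_mem (Finset.mem_image_of_mem _ (Finset.mem_univ i)))
      have hXn' : Ideal.span (Set.range (MvPolynomial.X : Fin s.card → D)) ≤ n :=
        Ideal.span_le.2 (by rintro _ ⟨i, rfl⟩; exact hXn i)
      have h1 : f - MvPolynomial.C (MvPolynomial.constantCoeff f) ∈
          Ideal.span (Set.range (MvPolynomial.X : Fin s.card → D)) := by
        rw [← Set.image_univ, MvPolynomial.mem_ideal_span_X_image]
        intro d hd
        by_contra! hd0
        obtain rfl : d = 0 := Finsupp.ext fun i => hd0 i trivial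
        rw [MvPolynomial.mem_support_iff] at hd
        rw [MvPolynomial.coeff_sub, MvPolynomial.coeff_zero_C, MvPolynomial.constantCoeff_eq,
          sub_self] at hd
        exact hd rfl
      have h2 : (MvPolynomial.C (MvPolynomial.constantCoeff f) : D) ∈ n := by
        have := n.sub_mem hf (hXn' h1)
        rwa [sub_sub_cancel] at this
      obtain ⟨c, hc⟩ := Ideal.mem_span_singleton'.1 ((hCn _).1 h2)
      have h3 := (Ideal.span (T : Set D)).add_mem (hXT h1)
        (Ideal.mul_mem_left _ (MvPolynomial.C c)
          (Ideal.subset_span (Finset.mem_insert_self (MvPolynomial.C p) _)))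
      rwa [← map_mul, hc, sub_add_cancel] at h3
    · rw [Ideal.span_le]
      intro f hf
      rcases Finset.mem_insert.1 hf with rfl | hf
      · exact (hCn p).2 (Ideal.mem_span_singleton_self p)
      · obtain ⟨i, -, rfl⟩ := Finset.mem_image.1 hf
        exact hXn i
  have hnp : n.IsPrime := Ideal.IsPrime.comap _
  have hnht : n.height ≤ m.height := by
    have h1 : n.height ≤ T.card := Ideal.height_le_card_of_mem_minimalPrimes_span_finset (by
      rw [← hspan, Ideal.minimalPrimes_eq_subsingleton_self]; exact Set.mem_singleton n)
    have h2 : T.card ≤ s.card + 1 := (Finset.card_insert_le _ _).trans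
      (Nat.add_le_add_right (Finset.card_image_le.trans (by simp)) 1)
    exact h1.trans (le_trans (by exact_mod_cast h2) hht)
  have hmin : m ∈ (n.map (algebraMap D B)).minimalPrimes := by
    refine ⟨⟨inferInstance, Ideal.map_comap_le⟩, ?_⟩
    rintro q ⟨hq, hnq⟩ hqm
    have hJq : J ≤ q := by
      rw [Ideal.span_singleton_le_iff_mem, IsScalarTower.algebraMap_apply R D B]
      exact hnq (Ideal.mem_map_of_mem _ ((hCn p).2 (Ideal.mem_span_singleton_self p)))
    have hq' : (q.map (Ideal.Quotient.mk J)).IsPrime :=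
      Ideal.map_isPrime_of_surjective Ideal.Quotient.mk_surjective (by simpa using hJq)
    have := hs.2 ⟨hq', Ideal.span_le.2 fun y hy => ?_⟩ (Ideal.map_mono hqm)
    · have h3 := Ideal.comap_mono (f := Ideal.Quotient.mk J) this
      rwa [hcomap, Ideal.comap_map_of_surjective _ Ideal.Quotient.mk_surjective,
        ← RingHom.ker_eq_comap_bot, Ideal.mk_ker, sup_eq_left.2 hJq] at h3
    · have h4 := hx (s.equivFin ⟨y, hy⟩)
      rw [Equiv.symm_apply_apply] at h4
      change (Ideal.Quotient.mk J) _ = y at h4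
      rw [SetLike.mem_coe, ← h4]
      refine Ideal.mem_map_of_mem _ (hnq ?_)
      have := Ideal.mem_map_of_mem (algebraMap D B) (hXn (s.equivFin ⟨y, hy⟩))
      rwa [hDB, MvPolynomial.aeval_X] at this
  have hover : m.LiesOver n := ⟨rfl⟩
  have hfs : FaithfulSMul D B := (faithfulSMul_iff_algebraMap_injective _ _).2
    (Ideal.algebraMap_injective_of_height_le n m hmin hnht)
  have : CharZero D := charZero_of_injective_algebraMap (R := R) (MvPolynomial.C_injective _ _)
  exact exists_fg_of_mem_minimalPrimes_map (D := D) IsNTwo.of_charZero m hmin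

theorem isNOne_of_finiteType_int (B : Type u) [CommRing B] [IsDomain B]
    [Algebra.FiniteType ℤ B] : IsNOne B := by
  obtain ⟨p, hp⟩ := CharP.exists B
  rcases CharP.char_is_prime_or_zero B p with hprime | rfl
  · have : Fact p.Prime := ⟨hprime⟩
    let _ : Field (ULift.{u} (ZMod p)) := ULift.field
    let _ : Algebra (ZMod p) B := ZMod.algebra B p
    have : Algebra.FiniteType (ZMod p) B := .of_restrictScalars_finiteType ℤ (ZMod p) B
    let _ : Algebra (ULift.{u} (ZMod p)) B := ULift.algebra' _ _
    have : Algebra.FiniteType (ULift.{u} (ZMod p)) B :=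
      .of_restrictScalars_finiteType (ZMod p) (ULift.{u} (ZMod p)) B
    exact isNOne_of_finiteType_field (ULift.{u} (ZMod p)) B
  · have : CharZero B := CharP.charP_to_charZero B
    let _ : Algebra (ULift.{u} ℤ) B := ULift.algebra' _ _
    have : Algebra.FiniteType (ULift.{u} ℤ) B :=
      .of_restrictScalars_finiteType ℤ (ULift.{u} ℤ) B
    have e : ℤ ≃+* ULift.{u} ℤ := ULift.ringEquiv.symm
    have : IsPrincipalIdealRing (ULift.{u} ℤ) := .of_surjective e.toRingHom e.surjective
    have : IsJacobsonRing (ULift.{u} ℤ) := (isJacobsonRing_iso e).1 inferInstance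
    have : IsDomain (ULift.{u} ℤ) := e.symm.toMulEquiv.isDomain _
    have : CharZero (ULift.{u} ℤ) := charZero_of_injective_ringHom (f := e.toRingHom) e.injective
    have : FaithfulSMul (ULift.{u} ℤ) B := by
      rw [faithfulSMul_iff_algebraMap_injective]
      intro a b hab
      ext
      exact Int.cast_injective (α := B) hab
    refine isNOne_of_finiteType_of_isPrincipalIdealRing (ULift.{u} ℤ) B fun h => ?_
    exact Int.not_isField (e.toMulEquiv.isField h)

end Integers

section CompleteLocal
open IsLocalRing

/-- Cauchy sequences for the `I`-adic filtration converge. -/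
def CauchyConverges {A : Type*} [CommRing A] (I : Ideal A) : Prop :=
  ∀ f : ℕ → A, (∀ n, f (n + 1) - f n ∈ I ^ n) → ∃ L, ∀ n, L - f n ∈ I ^ n

theorem sub_mem_pow_of_succ {A : Type*} [CommRing A] {I : Ideal A} {f : ℕ → A}
    (hf : ∀ n, f (n + 1) - f n ∈ I ^ n) {m n : ℕ} (h : m ≤ n) : f n - f m ∈ I ^ m := by
  induction n, h using Nat.le_induction with
  | base => simp
  | succ n hmn ih =>
    have := add_mem (Ideal.pow_le_pow_right hmn (hf n)) ih
    simpa using this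

theorem cauchyConverges_of_isPrecomplete {A : Type*} [CommRing A] (I : Ideal A)
    [IsPrecomplete I A] : CauchyConverges I := by
  intro f hf
  obtain ⟨L, hL⟩ := IsPrecomplete.prec (I := I) (M := A) inferInstance (f := f) (by
    intro m n hmn
    rw [SModEq.comm, SModEq.sub_mem]
    simpa using sub_mem_pow_of_succ hf hmn)
  refine ⟨L, fun n => ?_⟩
  have := (hL n).symm
  rw [SModEq.sub_mem] at this
  simpa using this

theorem CauchyConverges.isPrecomplete {A : Type*} [CommRing A] {I : Ideal A}
    (h : CauchyConverges I) : IsPrecomplete I A := by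
  refine ⟨fun f hf => ?_⟩
  obtain ⟨L, hL⟩ := h f (fun n => by
    have := (hf (Nat.le_succ n)).symm
    rw [SModEq.sub_mem] at this
    simpa using this)
  refine ⟨L, fun n => ?_⟩
  rw [SModEq.comm, SModEq.sub_mem]
  simpa using hL n

theorem CauchyConverges.of_surjective {A B : Type*} [CommRing A] [CommRing B] {I : Ideal A}
    (h : CauchyConverges I) (φ : A →+* B) (hφ : Function.Surjective φ) :
    CauchyConverges (I.map φ) := by
  intro f hf
  have key : ∀ n, ∀ y ∈ (I.map φ) ^ n, ∃ x ∈ I ^ n, φ x = y := by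
    intro n y hy
    rw [← Ideal.map_pow, Ideal.mem_map_iff_of_surjective φ hφ] at hy
    exact hy
  choose d hd hdf using fun n => key n _ (hf n)
  obtain ⟨a, ha⟩ := hφ (f 0)
  obtain ⟨L, hL⟩ := h (fun n => a + ∑ i ∈ Finset.range n, d i) (fun n => by
    rw [Finset.sum_range_succ]
    simpa using hd n)
  have hs : ∀ n, φ (a + ∑ i ∈ Finset.range n, d i) = f n := by
    intro n
    rw [map_add, map_sum, ha]
    simp only [hdf]
    rw [Finset.sum_range_sub]
    ring
  refine ⟨φ L, fun n => ?_⟩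
  rw [← hs n, ← map_sub, ← Ideal.map_pow]
  exact Ideal.mem_map_of_mem _ (hL n)

/-- A complete Noetherian local ring. -/
class IsCompleteNoetherianLocal (A : Type*) [CommRing A] : Prop where
  isNoetherianRing : IsNoetherianRing A
  isLocalRing : IsLocalRing A
  cauchyConverges : CauchyConverges (maximalIdeal A)

attribute [instance] IsCompleteNoetherianLocal.isNoetherianRing
  IsCompleteNoetherianLocal.isLocalRing

theorem IsCompleteNoetherianLocal.isAdicComplete (A : Type*) [CommRing A]
    [IsCompleteNoetherianLocal A] : IsAdicComplete (maximalIdeal A) A :=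
  { toIsHausdorff := inferInstance
    toIsPrecomplete := IsCompleteNoetherianLocal.cauchyConverges.isPrecomplete }

theorem IsCompleteNoetherianLocal.of_surjective {A B : Type*} [CommRing A] [CommRing B]
    [IsCompleteNoetherianLocal A] [Nontrivial B] (φ : A →+* B) (hφ : Function.Surjective φ) :
    IsCompleteNoetherianLocal B := by
  have hl : IsLocalRing B := .of_surjective' φ hφ
  refine ⟨isNoetherianRing_of_surjective A B φ hφ, hl, ?_⟩
  have : maximalIdeal B = (maximalIdeal A).map φ := by
    have h1 : IsLocalHom φ := IsLocalHom.of_surjective φ hφ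
    apply le_antisymm
    · intro x hx
      obtain ⟨y, rfl⟩ := hφ x
      refine Ideal.mem_map_of_mem _ ?_
      rw [mem_maximalIdeal] at hx ⊢
      exact fun h => hx (h.map φ)
    · exact ((local_hom_TFAE φ).out 0 2).mp h1
  rw [this]
  exact IsCompleteNoetherianLocal.cauchyConverges.of_surjective φ hφ

theorem PowerSeries.mem_maximalIdeal_iff {A : Type*} [CommRing A] [IsLocalRing A]
    (f : PowerSeries A) :
    f ∈ maximalIdeal (PowerSeries A) ↔ PowerSeries.constantCoeff f ∈ maximalIdeal A := by
  rw [mem_maximalIdeal, mem_maximalIdeal, mem_nonunits_iff, mem_nonunits_iff,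
    PowerSeries.isUnit_iff_constantCoeff]

theorem PowerSeries.coeff_mem_of_mem_pow {A : Type*} [CommRing A] [IsLocalRing A]
    {k : ℕ} {f : PowerSeries A} (hf : f ∈ maximalIdeal (PowerSeries A) ^ k) (j : ℕ) :
    PowerSeries.coeff j f ∈ maximalIdeal A ^ (k - j) := by
  induction k generalizing f j with
  | zero => simp
  | succ k ih =>
    rw [pow_succ] at hf
    refine Submodule.mul_induction_on hf (fun g hg h hh => ?_)
      (fun x y hx hy => by rw [map_add]; exact add_mem hx hy)
    rw [PowerSeries.coeff_mul]
    refine sum_mem fun p hp => ?_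
    have hpj : p.1 + p.2 = j := by simpa using hp
    rcases Nat.eq_zero_or_pos p.2 with h0 | h0
    · have h1 : PowerSeries.coeff p.2 h ∈ maximalIdeal A := by
        rw [h0, PowerSeries.coeff_zero_eq_constantCoeff]
        exact (PowerSeries.mem_maximalIdeal_iff h).mp hh
      have := Ideal.mul_mem_mul (ih hg p.1) h1
      rw [← pow_succ] at this
      exact Ideal.pow_le_pow_right (by omega) this
    · exact Ideal.mul_mem_right _ _ (Ideal.pow_le_pow_right (by omega) (ih hg p.1))

theorem PowerSeries.eq_sum_add_X_pow_mul {A : Type*} [CommRing A] (f : PowerSeries A) (k : ℕ) :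
    f = ∑ j ∈ Finset.range k, PowerSeries.C (PowerSeries.coeff j f) * PowerSeries.X ^ j +
      PowerSeries.X ^ k * PowerSeries.mk fun i => PowerSeries.coeff (i + k) f := by
  have := PowerSeries.eq_X_pow_mul_shift_add_trunc k f
  rw [add_comm] at this
  conv_lhs => rw [this]
  congr 1
  ext n
  simp [PowerSeries.coeff_trunc, PowerSeries.coeff_X_pow]

theorem PowerSeries.mem_pow_of_coeff_mem {A : Type*} [CommRing A] [IsLocalRing A]
    {k : ℕ} {f : PowerSeries A}
    (hf : ∀ j < k, PowerSeries.coeff j f ∈ maximalIdeal A ^ (k - j)) :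
    f ∈ maximalIdeal (PowerSeries A) ^ k := by
  have hX : (PowerSeries.X : PowerSeries A) ∈ maximalIdeal (PowerSeries A) := by
    rw [PowerSeries.mem_maximalIdeal_iff]
    simp
  have hC : (maximalIdeal A).map PowerSeries.C ≤ maximalIdeal (PowerSeries A) := by
    rw [Ideal.map_le_iff_le_comap]
    intro a ha
    rw [Ideal.mem_comap, PowerSeries.mem_maximalIdeal_iff]
    simpa using ha
  rw [PowerSeries.eq_sum_add_X_pow_mul f k]
  refine add_mem (sum_mem fun j hj => ?_) (Ideal.mul_mem_right _ _ (Ideal.pow_mem_pow hX k))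
  have hj : j < k := by simpa using hj
  have h1 : PowerSeries.C (PowerSeries.coeff j f) ∈ maximalIdeal (PowerSeries A) ^ (k - j) := by
    refine Ideal.pow_right_mono hC _ ?_
    rw [← Ideal.map_pow]
    exact Ideal.mem_map_of_mem _ (hf j hj)
  have := Ideal.mul_mem_mul h1 (Ideal.pow_mem_pow hX j)
  rw [← pow_add] at this
  exact Ideal.pow_le_pow_right (by omega) this

instance PowerSeries.isCompleteNoetherianLocal (A : Type*) [CommRing A]
    [IsCompleteNoetherianLocal A] : IsCompleteNoetherianLocal (PowerSeries A) := by
  refine ⟨inferInstance, inferInstance, fun f hf => ?_⟩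
  have h : ∀ i, ∃ L : A, ∀ n, L - PowerSeries.coeff i (f (n + i)) ∈ maximalIdeal A ^ n := by
    intro i
    refine IsCompleteNoetherianLocal.cauchyConverges _ fun n => ?_
    have := PowerSeries.coeff_mem_of_mem_pow (hf (n + i)) i
    rw [map_sub] at this
    have h2 : n + 1 + i = n + i + 1 := by ring
    rw [h2]
    simpa using this
  choose L hL using h
  refine ⟨PowerSeries.mk L, fun n => PowerSeries.mem_pow_of_coeff_mem fun j hj => ?_⟩
  have := hL j (n - j)
  rw [Nat.sub_add_cancel hj.le] at this
  simpa using this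

end CompleteLocal

section Evaluation
open IsLocalRing

theorem eq_of_forall_sub_mem_pow {T : Type*} [CommRing T] [IsNoetherianRing T] [IsLocalRing T]
    {a b : T} (h : ∀ n, a - b ∈ maximalIdeal T ^ n) : a = b := by
  have := Ideal.iInf_pow_eq_bot_of_isLocalRing (maximalIdeal T) (Ideal.IsPrime.ne_top inferInstance)
  rw [← sub_eq_zero, ← Ideal.mem_bot, ← this]
  simpa using h

/-- A ring homomorphism to a complete local ring extends to power series, with the variable sent
to any given element of the maximal ideal. -/
theorem PowerSeries.exists_ringHom_extension {A T : Type*} [CommRing A] [CommRing T]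
    [IsCompleteNoetherianLocal T] (φ : A →+* T) {x : T} (hx : x ∈ maximalIdeal T) :
    ∃ ψ : PowerSeries A →+* T, ψ.comp PowerSeries.C = φ ∧ ψ PowerSeries.X = x := by
  set m := maximalIdeal T
  let s (n : ℕ) (f : PowerSeries A) : T := (PowerSeries.trunc n f).eval₂ φ x
  have hdvd : ∀ (n : ℕ) (p : A[X]), (∀ i < n, p.coeff i = 0) → p.eval₂ φ x ∈ m ^ n := by
    intro n p hp
    obtain ⟨q, rfl⟩ := Polynomial.X_pow_dvd_iff.mpr hp
    rw [Polynomial.eval₂_mul, Polynomial.eval₂_pow, Polynomial.eval₂_X]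
    exact Ideal.mul_mem_right _ _ (Ideal.pow_mem_pow hx n)
  have hcong : ∀ (n : ℕ) (p q : A[X]), (∀ i < n, p.coeff i = q.coeff i) →
      p.eval₂ φ x - q.eval₂ φ x ∈ m ^ n := by
    intro n p q hpq
    rw [← Polynomial.eval₂_sub]
    exact hdvd n _ fun i hi => by rw [coeff_sub, hpq i hi, sub_self]
  have hex : ∀ f : PowerSeries A, ∃ L, ∀ n, L - s n f ∈ m ^ n := by
    intro f
    refine IsCompleteNoetherianLocal.cauchyConverges _ fun n => hcong n _ _ fun i hi => ?_
    rw [PowerSeries.coeff_trunc, PowerSeries.coeff_trunc, if_pos hi, if_pos (by omega)]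
  choose ψ hψ using hex
  have huniq : ∀ f L, (∀ n, L - s n f ∈ m ^ n) → ψ f = L := by
    intro f L hL
    refine eq_of_forall_sub_mem_pow fun n => ?_
    simpa using sub_mem (hψ f n) (hL n)
  have hpoly : ∀ p : A[X], ψ p = p.eval₂ φ x := by
    intro p
    refine huniq _ _ fun n => hcong n _ _ fun i hi => ?_
    rw [PowerSeries.coeff_trunc, if_pos hi, Polynomial.coeff_coe]
  refine ⟨{ toFun := ψ
            map_one' := by simpa using hpoly 1
            map_zero' := by simpa using hpoly 0
            map_add' := fun f g => huniq _ _ fun n => ?_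
            map_mul' := fun f g => huniq _ _ fun n => ?_ }, ?_, ?_⟩
  · have : s n (f * g) - s n f * s n g ∈ m ^ n := by
      simp only [s]
      rw [← Polynomial.eval₂_mul]
      refine hcong n _ _ fun i hi => ?_
      rw [PowerSeries.coeff_trunc, if_pos hi, PowerSeries.coeff_mul, Polynomial.coeff_mul]
      refine Finset.sum_congr rfl fun p hp => ?_
      have : p.1 + p.2 = i := by simpa using hp
      rw [PowerSeries.coeff_trunc, PowerSeries.coeff_trunc, if_pos (by omega),
        if_pos (by omega)]
    have h1 := Ideal.mul_mem_right (ψ g) _ (hψ f n)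
    have h2 := Ideal.mul_mem_left _ (s n f) (hψ g n)
    have := sub_mem (add_mem h1 h2) this
    convert this using 1
    ring
  · have := add_mem (hψ f n) (hψ g n)
    simp only [s, map_add, Polynomial.eval₂_add] at this ⊢
    convert this using 1
    ring
  · ext a
    simpa using hpoly (Polynomial.C a)
  · simpa using hpoly Polynomial.X

theorem exists_complete_cover_of_list {S : Type u} [CommRing S] [IsCompleteNoetherianLocal S]
    (I : Ideal S) (l : List S) (hl : ∀ f ∈ l, f ∈ I) :
    ∃ (R : Type u) (_ : CommRing R) (_ : IsCompleteNoetherianLocal R)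
      (ψ : R →+* PowerSeries S), (∀ a, PowerSeries.C a ∈ ψ.range) ∧
      (∀ f ∈ l, PowerSeries.monomial 1 f ∈ ψ.range) ∧
      ∀ r n, PowerSeries.coeff n (ψ r) ∈ I ^ n := by
  induction l with
  | nil =>
    refine ⟨S, inferInstance, inferInstance, PowerSeries.C, fun a => ⟨a, rfl⟩, by simp, ?_⟩
    intro r n
    rw [PowerSeries.coeff_C]
    split_ifs with h
    · simp [h]
    · exact zero_mem _
  | cons f l ih =>
    obtain ⟨R, _, _, ψ, h1, h2, h3⟩ := ih fun g hg => hl g (List.mem_cons_of_mem _ hg)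
    have hf : f ∈ I := hl f List.mem_cons_self
    obtain ⟨ψ', hC, hX⟩ := PowerSeries.exists_ringHom_extension ψ
      (x := PowerSeries.monomial 1 f) (by
        rw [PowerSeries.mem_maximalIdeal_iff, ← PowerSeries.coeff_zero_eq_constantCoeff_apply,
          PowerSeries.coeff_monomial]
        simp)
    have hC' : ∀ r, ψ' (PowerSeries.C r) = ψ r := fun r => congrArg (· r) hC
    have hm : PowerSeries.monomial 1 f = PowerSeries.C f * PowerSeries.X := by
      ext n
      rw [PowerSeries.coeff_monomial, PowerSeries.coeff_C_mul, PowerSeries.coeff_X]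
      simp
    refine ⟨PowerSeries R, inferInstance, inferInstance, ψ', fun a => ?_, fun g hg => ?_, ?_⟩
    · obtain ⟨r, hr⟩ := h1 a
      exact ⟨PowerSeries.C r, (hC' r).trans hr⟩
    · rcases List.mem_cons.mp hg with rfl | hg
      · exact ⟨PowerSeries.X, hX⟩
      · obtain ⟨r, hr⟩ := h2 g hg
        exact ⟨PowerSeries.C r, (hC' r).trans hr⟩
    · intro g n
      rw [PowerSeries.eq_sum_add_X_pow_mul g (n + 1), map_add, map_mul, map_pow, hX, map_add,
        map_sum, map_sum, hm, mul_pow, mul_assoc, ← map_pow]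
      refine add_mem (sum_mem fun i hi => ?_) ?_
      · have hi : i ≤ n := by simpa [Nat.lt_succ_iff] using hi
        rw [map_mul, map_pow, hC', hX, hm, mul_pow, ← mul_assoc, PowerSeries.coeff_mul_X_pow',
          if_pos hi, ← map_pow, PowerSeries.coeff_mul_C]
        have := Ideal.mul_mem_mul (h3 (PowerSeries.coeff i g) (n - i)) (Ideal.pow_mem_pow hf i)
        rwa [← pow_add, Nat.sub_add_cancel hi] at this
      · rw [PowerSeries.coeff_C_mul, PowerSeries.coeff_X_pow_mul', if_neg (by omega), mul_zero]
        exact zero_mem _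

theorem exists_intClosure_pow_le_of_complete {S : Type u} [CommRing S] [IsDomain S]
    [IsCompleteNoetherianLocal S] (I : Ideal S)
    (hN : ∀ (T : Type u) [CommRing T] [IsDomain T] [IsCompleteNoetherianLocal T], IsNOne T) :
    ∃ c, ∀ n, intClosure (I ^ (n + c)) ≤ I ^ n := by
  obtain ⟨s, hs⟩ := IsNoetherian.noetherian I
  obtain ⟨R, _, _, ψ, h1, h2, h3⟩ := exists_complete_cover_of_list I s.toList fun f hf => by
    rw [← hs]
    exact Submodule.subset_span (by simpa using hf)
  have : IsCompleteNoetherianLocal ψ.range :=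
    .of_surjective ψ.rangeRestrict ψ.rangeRestrict_surjective
  refine exists_intClosure_pow_le_of_isNOne (T := ψ.range) (hN _) ψ.range.subtype
    Subtype.val_injective ?_ ?_
  · rintro ⟨_, r, rfl⟩ n
    exact h3 r n
  · have hone : ∀ x ∈ I, PowerSeries.monomial 1 x ∈ ψ.range := by
      intro x hx
      rw [← hs] at hx
      induction hx using Submodule.span_induction with
      | mem x hx => exact h2 x (by simpa using hx)
      | zero => simp
      | add x y _ _ hx hy => rw [map_add]; exact add_mem hx hy
      | smul a x _ hx =>
        rw [map_smul, PowerSeries.smul_eq_C_mul]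
        exact mul_mem (h1 a) hx
    have hall : ∀ n, ∀ x ∈ I ^ n, PowerSeries.monomial n x ∈ ψ.range := by
      intro n
      induction n with
      | zero => exact fun x _ => by simpa using h1 x
      | succ n ih =>
        intro x hx
        rw [pow_succ] at hx
        refine Submodule.mul_induction_on hx (fun a ha b hb => ?_)
          (fun a b ha hb => by rw [map_add]; exact add_mem ha hb)
        rw [← PowerSeries.monomial_mul_monomial]
        exact mul_mem (ih a ha) (hone b hb)
    exact fun n x hx => ⟨⟨_, hall n x hx⟩, rfl⟩

end Evaluation

section PBasis

/-- The monomials with exponents less than `p ^ N` in the elements of `B` are linearly independent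
over the subfield of `p ^ N`-th powers. -/
def IsPIndependent (p : ℕ) {K : Type u} [Field K] (B : Set K) (N : ℕ) : Prop :=
  ∀ (J : Type u) (s : Finset J) (ε : J → K →₀ ℕ) (F : J → K), Set.InjOn ε s →
    (∀ j ∈ s, ↑(ε j).support ⊆ B ∧ ∀ b, ε j b < p ^ N) →
    ∑ j ∈ s, F j ^ p ^ N * (ε j).prod (fun b n => b ^ n) = 0 → ∀ j ∈ s, F j = 0

variable {p : ℕ} [hp : Fact p.Prime] {K : Type u} [Field K] [CharP K p]

theorem IsPIndependent.eq_zero_of_forall_eq {p : ℕ} {K : Type u} [Field K] {N : ℕ} {J : Type u}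
    {s : Finset J} {ε : J → K →₀ ℕ} {F : J → K} (hε : Set.InjOn ε s) (h0 : ∀ j ∈ s, ε j = 0)
    (h : ∑ j ∈ s, F j ^ p ^ N * (ε j).prod (fun b n => b ^ n) = 0) {j : J} (hj : j ∈ s) :
    F j = 0 := by
  rw [Finset.sum_eq_single_of_mem j hj fun i hi hij =>
    (hij (hε hi hj ((h0 i hi).trans (h0 j hj).symm))).elim, h0 j hj] at h
  simpa using eq_zero_of_pow_eq_zero (by simpa using h : F j ^ p ^ N = 0)

theorem IsPIndependent.of_one {B : Set K} (h : IsPIndependent p B 1) (N : ℕ) :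
    IsPIndependent p B N := by
  induction N with
  | zero =>
    intro J s ε F hε hs hsum j hj
    refine eq_zero_of_forall_eq hε (fun i hi => ?_) hsum hj
    ext b
    have := (hs i hi).2 b
    simpa using this
  | succ N ih =>
    intro J s ε F hε hs hsum j hj
    classical
    let r (j : J) : K →₀ ℕ := (ε j).mapRange (· % p) (by simp)
    let q (j : J) : K →₀ ℕ := (ε j).mapRange (· / p) (by simp)
    have hr : ∀ j b, r j b = ε j b % p := fun _ _ => rfl
    have hq : ∀ j b, q j b = ε j b / p := fun _ _ => rfl
    have hrq : ∀ j, ε j = r j + p • q j := by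
      intro j
      ext b
      rw [Finsupp.add_apply, Finsupp.smul_apply, hr, hq, smul_eq_mul, Nat.mod_add_div]
    have hmon : ∀ j, (ε j).prod (fun b n => b ^ n) =
        (q j).prod (fun b n => b ^ n) ^ p * (r j).prod (fun b n => b ^ n) := by
      intro j
      conv_lhs => rw [hrq j]
      rw [Finsupp.prod_add_index' (by simp) (by simp [pow_add]), mul_comm]
      congr 1
      rw [Finsupp.prod_of_support_subset _ Finsupp.support_smul _ (by simp), Finsupp.prod,
        ← Finset.prod_pow]
      exact Finset.prod_congr rfl fun b _ => by
        rw [← pow_mul, mul_comm, Finsupp.smul_apply, smul_eq_mul]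
    let G (e : K →₀ ℕ) : K := ∑ i ∈ s with r i = e, F i ^ p ^ N * (q i).prod (fun b n => b ^ n)
    have hG : ∀ e ∈ s.image r, G e = 0 := by
      refine h _ (s.image r) id G Function.injective_id.injOn ?_ ?_
      · intro e he
        obtain ⟨i, hi, rfl⟩ := Finset.mem_image.mp he
        refine ⟨fun b hb => (hs i hi).1 ?_, fun b => ?_⟩
        · simp only [id, Finset.mem_coe, Finsupp.mem_support_iff, hr] at hb ⊢
          intro h0
          simp [h0] at hb
        · simpa [hr] using Nat.mod_lt _ hp.out.pos
      · rw [← hsum, ← Finset.sum_fiberwise_of_maps_to (g := r) (t := s.image r)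
          fun i hi => Finset.mem_image_of_mem r hi]
        refine Finset.sum_congr rfl fun e _ => ?_
        rw [pow_one, sum_pow_char, Finset.sum_mul]
        refine Finset.sum_congr rfl fun i hi => ?_
        have hi : r i = e := (Finset.mem_filter.mp hi).2
        rw [hmon i, hi, mul_pow, id, ← pow_mul, ← pow_succ, mul_assoc]
    refine ih J (s.filter fun i => r i = r j) q F ?_ ?_ (hG _ (Finset.mem_image_of_mem r hj)) j
      (by simp [hj])
    · intro a ha b hb hab
      simp only [Finset.coe_filter, Set.mem_ofPred_eq] at ha hb
      exact hε ha.1 hb.1 (by rw [hrq a, hrq b, ha.2, hb.2, hab])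
    · intro i hi
      have hi := (Finset.mem_filter.mp hi).1
      refine ⟨fun b hb => (hs i hi).1 ?_, fun b => ?_⟩
      · simp only [Finset.mem_coe, Finsupp.mem_support_iff, hq] at hb ⊢
        intro h0
        simp [h0] at hb
      · rw [hq, Nat.div_lt_iff_lt_mul hp.out.pos, ← pow_succ]
        exact (hs i hi).2 b

theorem IsPIndependent.insert {B : Set K} (h : IsPIndependent p B 1) {x : K}
    (hx : x ∉ IntermediateField.adjoin (frobenius K p).fieldRange B) :
    IsPIndependent p (insert x B) 1 := by
  intro J s ε F hε hs hsum j hj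
  classical
  set E := IntermediateField.adjoin (frobenius K p).fieldRange B with hE
  have hpow : ∀ y : K, y ^ p ∈ E := fun y =>
    E.algebraMap_mem ⟨y ^ p, ⟨y, rfl⟩⟩
  have hmem : ∀ i ∈ s, F i ^ p * ((ε i).erase x).prod (fun b n => b ^ n) ∈ E := by
    intro i hi
    refine mul_mem (hpow _) (prod_mem fun b hb => pow_mem ?_ _)
    refine IntermediateField.subset_adjoin _ _ ?_
    rw [Finsupp.support_erase, Finset.mem_erase] at hb
    exact ((hs i hi).1 hb.2).resolve_left hb.1
  let c (i : J) : E := if hi : i ∈ s then ⟨_, hmem i hi⟩ else 0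
  have hc : ∀ i ∈ s, (c i : K) = F i ^ p * ((ε i).erase x).prod (fun b n => b ^ n) := by
    intro i hi
    simp [c, hi]
  let P : E[X] := ∑ i ∈ s, Polynomial.monomial (ε i x) (c i)
  have hPx : aeval x P = 0 := by
    rw [← hsum, map_sum]
    refine Finset.sum_congr rfl fun i hi => ?_
    rw [aeval_monomial, IntermediateField.algebraMap_apply, hc i hi, pow_one, mul_assoc]
    congr 1
    rw [mul_comm]
    exact Finsupp.mul_prod_erase' (ε i) x (fun b n => b ^ n) (by simp)
  have hdeg : P.natDegree < p := by
    refine (Polynomial.natDegree_sum_le_of_forall_le (n := p - 1) s _ fun i hi => ?_).trans_lt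
      (Nat.sub_lt hp.out.pos one_pos)
    refine (Polynomial.natDegree_monomial_le _).trans ?_
    have := (hs i hi).2 x
    rw [pow_one] at this
    omega
  have hirr : Irreducible (X ^ p - C (⟨x ^ p, hpow x⟩ : E)) := by
    refine X_pow_sub_C_irreducible_of_prime hp.out fun b hb => hx ?_
    have : (b : K) ^ p = x ^ p := congrArg Subtype.val hb
    rw [← frobenius_inj K p this]
    exact b.2
  have hmin : X ^ p - C (⟨x ^ p, hpow x⟩ : E) = minpoly E x :=
    minpoly.eq_of_irreducible_of_monic hirr (by simp) (monic_X_pow_sub_C _ hp.out.ne_zero)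
  have hP : P = 0 := by
    refine Polynomial.eq_zero_of_dvd_of_natDegree_lt (minpoly.dvd E x hPx) ?_
    rwa [← hmin, natDegree_X_pow_sub_C]
  have hcoef : P.coeff (ε j x) = 0 := by rw [hP, coeff_zero]
  rw [Polynomial.finsetSum_coeff] at hcoef
  simp only [Polynomial.coeff_monomial] at hcoef
  rw [← Finset.sum_filter] at hcoef
  refine h J (s.filter fun i => ε i x = ε j x) (fun i => (ε i).erase x) F ?_ ?_ ?_ j (by simp [hj])
  · intro a ha b hb hab
    simp only [Finset.coe_filter, Set.mem_ofPred_eq] at ha hb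
    refine hε ha.1 hb.1 ?_
    rw [← Finsupp.single_add_erase x (ε a), ← Finsupp.single_add_erase x (ε b), ha.2, hb.2]
    exact congrArg _ hab
  · intro i hi
    have hi := (Finset.mem_filter.mp hi).1
    refine ⟨fun b hb => ?_, fun b => ?_⟩
    · rw [Finset.mem_coe, Finsupp.support_erase, Finset.mem_erase] at hb
      exact ((hs i hi).1 hb.2).resolve_left hb.1
    · rw [Finsupp.erase_apply]
      split_ifs
      · exact pow_pos hp.out.pos _
      · exact (hs i hi).2 b
  · have := congrArg (Subtype.val : E → K) hcoef
    rw [AddSubmonoidClass.coe_finsetSum] at this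
    rw [← ZeroMemClass.coe_zero E, ← this]
    refine Finset.sum_congr rfl fun i hi => ?_
    rw [hc i (Finset.mem_filter.mp hi).1, pow_one]

/-- Every field of characteristic `p` has a `p`-basis. -/
theorem exists_pBasis (p : ℕ) [hp : Fact p.Prime] (K : Type u) [Field K] [CharP K p] :
    ∃ B : Set K, (∀ N, IsPIndependent p B N) ∧
      ∀ x, x ∈ AddSubgroup.closure {z : K | ∃ y, ∃ b ∈ Submonoid.closure B, z = y ^ p * b} := by
  have h0 : IsPIndependent p (∅ : Set K) 1 := by
    intro J s ε F hε hs hsum j hj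
    refine IsPIndependent.eq_zero_of_forall_eq hε (fun i hi => ?_) hsum hj
    have := (hs i hi).1
    simpa using this
  obtain ⟨B, -, hB⟩ := zorn_subset_nonempty {B : Set K | IsPIndependent p B 1} (by
    intro c hc hchain hne
    refine ⟨⋃₀ c, ?_, fun s hs => Set.subset_sUnion_of_mem hs⟩
    intro J s ε F hε hs hsum j hj
    classical
    have hfin : ((s.biUnion fun i => (ε i).support : Finset K) : Set K) ⊆ ⋃₀ c := by
      intro b hb
      obtain ⟨i, hi, hb⟩ := Finset.mem_biUnion.mp hb
      exact (hs i hi).1 hb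
    obtain ⟨t, ht, hst⟩ := hchain.directedOn.exists_mem_subset_of_finite_of_subset_sUnion hne
      (Finset.finite_toSet _) hfin
    refine hc ht J s ε F hε (fun i hi => ⟨fun b hb => hst ?_, (hs i hi).2⟩) hsum j hj
    exact Finset.mem_biUnion.mpr ⟨i, hi, hb⟩) ∅ h0
  refine ⟨B, hB.prop.of_one, fun x => ?_⟩
  have hx : x ∈ IntermediateField.adjoin (frobenius K p).fieldRange B := by
    by_contra hx
    have := hB.le_of_ge (hB.prop.insert hx) (Set.subset_insert x B) (Set.mem_insert x B)
    exact hx (IntermediateField.subset_adjoin _ _ this)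
  have halg : ∀ y ∈ B, IsAlgebraic (frobenius K p).fieldRange y := fun y _ => by
    refine IsAlgebraic.of_pow hp.out.pos ?_
    exact isAlgebraic_algebraMap (⟨y ^ p, ⟨y, rfl⟩⟩ : (frobenius K p).fieldRange)
  rw [← IntermediateField.mem_toSubalgebra,
    IntermediateField.adjoin_toSubalgebra_of_isAlgebraic halg, ← Subalgebra.mem_toSubmodule,
    Algebra.adjoin_eq_span] at hx
  induction hx using Submodule.span_induction with
  | mem x hx => exact AddSubgroup.subset_closure ⟨1, x, hx, by simp⟩
  | zero => exact zero_mem _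
  | add x y _ _ hx hy => exact add_mem hx hy
  | smul a x h hx =>
    clear h
    obtain ⟨_, a, rfl⟩ := a
    induction hx using AddSubgroup.closure_induction with
    | mem x hx =>
      obtain ⟨y, b, hb, rfl⟩ := hx
      refine AddSubgroup.subset_closure ⟨a * y, b, hb, ?_⟩
      rw [Subfield.smul_def, smul_eq_mul, mul_pow, mul_assoc]
      rfl
    | zero => simp
    | add x y _ _ hx hy => rw [smul_add]; exact add_mem hx hy
    | neg x _ hx => rw [smul_neg]; exact neg_mem hx

end PBasis

section WittSpan

/-- The additive subgroup generated by the elements `p ^ i * a ^ (p ^ (N - i)) * b` with `i ≤ N`,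
`a` arbitrary and `b` in the submonoid `M`. -/
def wittSpan {T : Type*} [CommRing T] (p : ℕ) (M : Submonoid T) (N : ℕ) : AddSubgroup T :=
  AddSubgroup.closure {x | ∃ i ≤ N, ∃ a, ∃ b ∈ M, x = p ^ i * a ^ p ^ (N - i) * b}

variable {T : Type*} [CommRing T] {p : ℕ} {M : Submonoid T}

theorem mem_wittSpan {N i : ℕ} (hi : i ≤ N) (a : T) {b : T} (hb : b ∈ M) :
    p ^ i * a ^ p ^ (N - i) * b ∈ wittSpan p M N :=
  AddSubgroup.subset_closure ⟨i, hi, a, b, hb, rfl⟩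

theorem one_mem_wittSpan (N : ℕ) : (1 : T) ∈ wittSpan p M N := by
  simpa using mem_wittSpan (p := p) (M := M) (Nat.zero_le N) (1 : T) M.one_mem

theorem wittSpan_zero (x : T) : x ∈ wittSpan p M 0 := by
  simpa using mem_wittSpan (p := p) (M := M) (Nat.zero_le 0) x M.one_mem

theorem wittSpan_mul_mem {N : ℕ} {x y : T} (hx : x ∈ wittSpan p M N) (hy : y ∈ wittSpan p M N) :
    x * y ∈ wittSpan p M N := by
  have key : ∀ i j, i ≤ j → j ≤ N → ∀ a c : T, ∀ b ∈ M, ∀ d ∈ M,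
      (p ^ i * a ^ p ^ (N - i) * b) * (p ^ j * c ^ p ^ (N - j) * d) ∈ wittSpan p M N := by
    intro i j hij hj a c b hb d hd
    have h1 := mem_wittSpan (p := p) hj (a ^ p ^ (j - i) * c) (mul_mem hb hd)
    have h2 := AddSubgroup.nsmul_mem _ h1 (p ^ i)
    convert h2 using 1
    rw [mul_pow, ← pow_mul, ← pow_add, show j - i + (N - j) = N - i by omega, nsmul_eq_mul]
    push_cast
    ring
  induction hx, hy using AddSubgroup.closure_induction₂ with
  | mem x y hx hy =>
    obtain ⟨i, hi, a, b, hb, rfl⟩ := hx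
    obtain ⟨j, hj, c, d, hd, rfl⟩ := hy
    rcases le_total i j with h | h
    · exact key i j h hj a c b hb d hd
    · rw [mul_comm]
      exact key j i h hi c a d hd b hb
  | zero_left => simp
  | zero_right => simp
  | add_left x y z _ _ _ h1 h2 => rw [add_mul]; exact add_mem h1 h2
  | add_right x y z _ _ _ h1 h2 => rw [mul_add]; exact add_mem h1 h2
  | neg_left x y _ _ h => rw [neg_mul]; exact neg_mem h
  | neg_right x y _ _ h => rw [mul_neg]; exact neg_mem h

theorem wittSpan_mul_mem_of_mem {N : ℕ} {x b : T} (hx : x ∈ wittSpan p M N) (hb : b ∈ M) :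
    x * b ∈ wittSpan p M N :=
  wittSpan_mul_mem hx (by simpa using mem_wittSpan (p := p) (Nat.zero_le N) (1 : T) hb)

theorem wittSpan_succ_le (N : ℕ) : wittSpan p M (N + 1) ≤ wittSpan p M N := by
  refine (AddSubgroup.closure_le _).mpr ?_
  rintro _ ⟨i, hi, a, b, hb, rfl⟩
  rcases hi.eq_or_lt with rfl | hi
  · have := mem_wittSpan (p := p) le_rfl (p * a : T) hb (N := N)
    rw [SetLike.mem_coe]
    convert this using 1
    simp [pow_succ, mul_assoc]
  · have := mem_wittSpan (p := p) (Nat.lt_succ_iff.mp hi) (a ^ p : T) hb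
    rw [← pow_mul, ← pow_succ', show N - i + 1 = N + 1 - i by omega] at this
    exact this

theorem wittSpan_antitone : Antitone (wittSpan p M) := antitone_nat_of_succ_le wittSpan_succ_le

theorem add_pow_prime_pow_sub_mem (hp : p.Prime) (a b : T) (k : ℕ) :
    (a + b) ^ p ^ k - a ^ p ^ k - b ^ p ^ k ∈
      AddSubgroup.closure {x : T | ∃ v < k, ∃ z, x = p ^ (k - v) * z ^ p ^ v} := by
  rw [add_pow, Finset.sum_range_succ, Finset.sum_range_eq_add_Ico _ (pow_pos hp.pos k)]
  have : ∀ s : T, (a ^ 0 * b ^ (p ^ k - 0) * ((p ^ k).choose 0 : T) + s +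
      a ^ p ^ k * b ^ (p ^ k - p ^ k) * ((p ^ k).choose (p ^ k) : T)) - a ^ p ^ k - b ^ p ^ k =
        s := by
    intro s
    simp
  rw [this]
  refine sum_mem fun n hn => ?_
  obtain ⟨h1, h2⟩ := Finset.mem_Ico.mp hn
  obtain ⟨v, n', hn', rfl⟩ := Nat.exists_eq_pow_mul_and_not_dvd (n := n) (by omega) p hp.ne_one
  have hvk : v < k := by
    by_contra h
    have h3 : p ^ k ≤ p ^ v := Nat.pow_le_pow_right hp.pos (by omega)
    have h4 : p ^ v * 1 ≤ p ^ v * n' := Nat.mul_le_mul_left _ (Nat.pos_of_ne_zero (by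
      rintro rfl; simp at hn'))
    omega
  have hdvd : p ^ (k - v) ∣ (p ^ k).choose (p ^ v * n') := by
    have h3 := Nat.add_one_mul_choose_eq (p ^ k - 1) (p ^ v * n' - 1)
    rw [Nat.sub_add_cancel h1,
      Nat.sub_add_cancel (Nat.one_le_pow _ _ hp.pos)] at h3
    have h4 : p ^ v * p ^ (k - v) ∣ p ^ v * ((p ^ k).choose (p ^ v * n') * n') := by
      rw [← pow_add, show v + (k - v) = k by omega]
      exact ⟨_, by rw [h3]; ring⟩
    have h5 := Nat.dvd_of_mul_dvd_mul_left (pow_pos hp.pos v) h4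
    exact Nat.Coprime.dvd_of_dvd_mul_right
      (Nat.Coprime.pow_left _ ((Nat.Prime.coprime_iff_not_dvd hp).mpr hn')) h5
  obtain ⟨c, hc⟩ := hdvd
  have hsub : p ^ k - p ^ v * n' = p ^ v * (p ^ (k - v) - n') := by
    rw [Nat.mul_sub, ← pow_add, show v + (k - v) = k by omega]
  have h6 : (p : T) ^ (k - v) * (a ^ n' * b ^ (p ^ (k - v) - n')) ^ p ^ v ∈
      AddSubgroup.closure {x : T | ∃ v < k, ∃ z, x = p ^ (k - v) * z ^ p ^ v} :=
    AddSubgroup.subset_closure ⟨v, hvk, _, rfl⟩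
  convert AddSubgroup.nsmul_mem _ h6 c using 1
  rw [hsub, hc, mul_pow, ← pow_mul, ← pow_mul, nsmul_eq_mul]
  push_cast
  ring

theorem add_pow_prime_pow_sub_mem_map (hp : p.Prime) (a b : T) (N : ℕ) :
    (a + b) ^ p ^ (N + 1) - a ^ p ^ (N + 1) - b ^ p ^ (N + 1) ∈
      (wittSpan p M N).map (AddMonoidHom.mulLeft (p : T)) := by
  refine (AddSubgroup.closure_le _).mpr ?_ (add_pow_prime_pow_sub_mem hp a b (N + 1))
  rintro _ ⟨v, hv, z, rfl⟩
  refine ⟨_, mem_wittSpan (p := p) (show N - v ≤ N by omega) z M.one_mem, ?_⟩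
  rw [show N - (N - v) = v by omega, show N + 1 - v = N - v + 1 by omega]
  simp [pow_succ']
  ring

end WittSpan

section CoefficientRing
open IsLocalRing

variable {T : Type u} [CommRing T] [IsLocalRing T] {p : ℕ}

theorem wittSpan_le_sup (hp : p.Prime) {M : Submonoid T} (hpm : (p : T) ∈ maximalIdeal T)
    (hM : ∀ x : T, x ∈ AddSubgroup.closure {z | ∃ y, ∃ b ∈ M, z = y ^ p * b} ⊔
      (maximalIdeal T).toAddSubgroup) (N : ℕ) :
    wittSpan p M N ≤ wittSpan p M (N + 1) ⊔ (maximalIdeal T ^ (N + 1)).toAddSubgroup := by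
  have key : ∀ k i : ℕ, ∀ a : T, (p : T) ^ i * a ^ p ^ k ∈
      wittSpan p M (i + k + 1) ⊔ (maximalIdeal T ^ (i + k + 1)).toAddSubgroup := by
    intro k
    induction k using Nat.strong_induction_on with
    | _ k ih =>
    intro i a
    have hadd : ∀ x y : T, (p : T) ^ i * ((x + y) ^ p ^ k - x ^ p ^ k - y ^ p ^ k) ∈
        wittSpan p M (i + k + 1) ⊔ (maximalIdeal T ^ (i + k + 1)).toAddSubgroup := by
      intro x y
      refine (AddSubgroup.closure_le
        ((wittSpan p M (i + k + 1) ⊔ (maximalIdeal T ^ (i + k + 1)).toAddSubgroup).comap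
          (AddMonoidHom.mulLeft ((p : T) ^ i)))).mpr ?_ (add_pow_prime_pow_sub_mem hp x y k)
      rintro _ ⟨v, hv, z, rfl⟩
      have := ih v hv (i + (k - v)) z
      rw [show i + (k - v) + v + 1 = i + k + 1 by omega, pow_add (p : T), mul_assoc] at this
      exact this
    have hadd' : ∀ x y : T, (p : T) ^ i * x ^ p ^ k ∈
        wittSpan p M (i + k + 1) ⊔ (maximalIdeal T ^ (i + k + 1)).toAddSubgroup →
        (p : T) ^ i * y ^ p ^ k ∈
        wittSpan p M (i + k + 1) ⊔ (maximalIdeal T ^ (i + k + 1)).toAddSubgroup →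
        (p : T) ^ i * (x + y) ^ p ^ k ∈
        wittSpan p M (i + k + 1) ⊔ (maximalIdeal T ^ (i + k + 1)).toAddSubgroup := by
      intro x y hx hy
      have := add_mem (add_mem (hadd x y) hx) hy
      convert this using 1
      ring
    have hmem : ∀ x ∈ maximalIdeal T, (p : T) ^ i * x ^ p ^ k ∈
        wittSpan p M (i + k + 1) ⊔ (maximalIdeal T ^ (i + k + 1)).toAddSubgroup := by
      intro x hx
      refine AddSubgroup.mem_sup_right ?_
      have := Ideal.mul_mem_mul (Ideal.pow_mem_pow hpm i) (Ideal.pow_mem_pow hx (p ^ k))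
      rw [← pow_add] at this
      exact Ideal.pow_le_pow_right (by have := Nat.lt_pow_self hp.one_lt (n := k); omega) this
    obtain ⟨y, hy, z, hz, rfl⟩ := AddSubgroup.mem_sup.mp (hM a)
    refine hadd' y z ?_ (hmem z hz)
    clear hz
    have hgen : ∀ w : T, ∀ b ∈ M, (p : T) ^ i * (w ^ p * b) ^ p ^ k ∈
        wittSpan p M (i + k + 1) ⊔ (maximalIdeal T ^ (i + k + 1)).toAddSubgroup := by
      intro w b hb
      refine AddSubgroup.mem_sup_left ?_
      have := mem_wittSpan (p := p) (show i ≤ i + k + 1 by omega) w (pow_mem hb (p ^ k))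
      rw [show i + k + 1 - i = k + 1 by omega] at this
      convert this using 1
      rw [mul_pow, ← pow_mul, ← pow_succ']
      ring
    have hz0 : (p : T) ^ i * (0 : T) ^ p ^ k ∈
        wittSpan p M (i + k + 1) ⊔ (maximalIdeal T ^ (i + k + 1)).toAddSubgroup := by
      rw [zero_pow (pow_pos hp.pos k).ne', mul_zero]
      exact zero_mem _
    induction hy using AddSubgroup.closure_induction with
    | mem x hx =>
      obtain ⟨w, b, hb, rfl⟩ := hx
      exact hgen w b hb
    | zero => exact hz0
    | add x y _ _ hx hy => exact hadd' x y hx hy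
    | neg x _ hx =>
      have h1 := hadd x (-x)
      rw [add_neg_cancel] at h1
      have := sub_mem (sub_mem hz0 h1) hx
      convert this using 1
      ring
  refine (AddSubgroup.closure_le _).mpr ?_
  rintro _ ⟨i, hi, a, b, hb, rfl⟩
  have := key (N - i) i a
  rw [show i + (N - i) + 1 = N + 1 by omega] at this
  obtain ⟨y, hy, z, hz, h⟩ := AddSubgroup.mem_sup.mp this
  rw [SetLike.mem_coe, ← h, add_mul]
  exact add_mem (AddSubgroup.mem_sup_left (wittSpan_mul_mem_of_mem hy hb))
    (AddSubgroup.mem_sup_right (Ideal.mul_mem_right _ _ hz))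

end CoefficientRing

section CoefficientRing
open IsLocalRing

/-- A coefficient ring of a local ring, with maximal ideal generated by `ϖ` (possibly zero). -/
structure IsCoefficientRing {T : Type*} [CommRing T] [IsLocalRing T] (Λ : Subring T) (ϖ : T) :
    Prop where
  mem : ϖ ∈ Λ
  mem_maximalIdeal : ϖ ∈ maximalIdeal T
  exists_eq_mul : ∀ x ∈ Λ, x ∈ maximalIdeal T → ∃ y ∈ Λ, x = ϖ * y
  exists_sub_mem : ∀ x, ∃ y ∈ Λ, x - y ∈ maximalIdeal T
  mem_of_limit : ∀ f : ℕ → T, (∀ n, f n ∈ Λ) → ∀ L, (∀ n, L - f n ∈ maximalIdeal T ^ n) → L ∈ Λ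

theorem wittSpan_inter_maximalIdeal {T : Type u} [CommRing T] [IsLocalRing T] {p : ℕ}
    [hp : Fact p.Prime] (hpm : (p : T) ∈ maximalIdeal T) (σ : ResidueField T → T)
    (hσ : ∀ x, residue T (σ x) = x) {B : Set (ResidueField T)} {N : ℕ}
    (hB : IsPIndependent p B (N + 1)) {u : T}
    (hu : u ∈ wittSpan p (Submonoid.closure (σ '' B)) (N + 1)) (hum : u ∈ maximalIdeal T) :
    ∃ y ∈ wittSpan p (Submonoid.closure (σ '' B)) N, u - p * y ∈ maximalIdeal T ^ (N + 2) := by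
  classical
  set M := Submonoid.closure (σ '' B)
  set V := (wittSpan p M N).map (AddMonoidHom.mulLeft (p : T))
  let mon (e : ResidueField T →₀ ℕ) : T := e.prod fun b n => σ b ^ n
  have hmonM : ∀ e : ResidueField T →₀ ℕ, ↑e.support ⊆ B → mon e ∈ M := fun e he =>
    prod_mem fun b hb =>
      pow_mem (show σ b ∈ M from Submonoid.subset_closure ⟨b, he hb, rfl⟩) _
  have hVM : ∀ v ∈ V, ∀ b ∈ M, v * b ∈ V := by
    rintro _ ⟨v, hv, rfl⟩ b hb
    exact ⟨_, wittSpan_mul_mem_of_mem hv hb, by simp [mul_assoc]⟩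
  let ι := {e : ResidueField T →₀ ℕ // ↑e.support ⊆ B ∧ ∀ b, e b < p ^ (N + 1)}
  let φ (e : ι) : T →+ T ⧸ V :=
    { toFun := fun a => QuotientAddGroup.mk (a ^ p ^ (N + 1) * mon e)
      map_zero' := by
        rw [zero_pow (pow_pos hp.out.pos _).ne', zero_mul]
        rfl
      map_add' := fun a b => by
        rw [← QuotientAddGroup.mk_add, ← sub_eq_zero, ← QuotientAddGroup.mk_sub,
          QuotientAddGroup.eq_zero_iff]
        convert hVM _ (add_pow_prime_pow_sub_mem_map hp.out a b N (M := M)) _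
          (hmonM e e.2.1) using 1
        ring }
  let Φ : (ι →₀ T) →+ T ⧸ V := Finsupp.liftAddHom φ
  have hmonB : ∀ b ∈ M, ∃ e : ResidueField T →₀ ℕ, ↑e.support ⊆ B ∧ b = mon e := by
    intro b hb
    induction hb using Submonoid.closure_induction with
    | mem x hx =>
      obtain ⟨b, hb, rfl⟩ := hx
      refine ⟨Finsupp.single b 1, ?_, by simp [mon]⟩
      intro c hc
      have := Finsupp.support_single_subset hc
      simp only [Finset.mem_singleton] at this
      rwa [this]
    | one => exact ⟨0, by simp, by simp [mon]⟩
    | mul x y _ _ hx hy =>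
      obtain ⟨e, he, rfl⟩ := hx
      obtain ⟨f, hf, rfl⟩ := hy
      refine ⟨e + f, ?_, ?_⟩
      · intro c hc
        rcases Finset.mem_union.mp (Finsupp.support_add hc) with h | h
        · exact he h
        · exact hf h
      · exact (Finsupp.prod_add_index' (by simp) (by simp [pow_add])).symm
  have hrange : wittSpan p M (N + 1) ≤ Φ.range.comap (QuotientAddGroup.mk' V) := by
    refine (AddSubgroup.closure_le _).mpr ?_
    rintro _ ⟨i, hi, a, b, hb, rfl⟩
    rcases Nat.eq_zero_or_pos i with rfl | hi0
    · obtain ⟨e, he, rfl⟩ := hmonB b hb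
      set q : ResidueField T →₀ ℕ := e.mapRange (· / p ^ (N + 1)) (by simp)
      set r : ResidueField T →₀ ℕ := e.mapRange (· % p ^ (N + 1)) (by simp)
      have hq : ∀ b, q b = e b / p ^ (N + 1) := fun _ => rfl
      have hr : ∀ b, r b = e b % p ^ (N + 1) := fun _ => rfl
      have hqr : e = r + p ^ (N + 1) • q := by
        ext b
        rw [Finsupp.add_apply, Finsupp.smul_apply, hr, hq, smul_eq_mul, Nat.mod_add_div]
      have hmon : mon e = mon q ^ p ^ (N + 1) * mon r := by
        conv_lhs => rw [hqr]
        simp only [mon]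
        rw [Finsupp.prod_add_index' (by simp) (by simp [pow_add]), mul_comm]
        congr 1
        rw [Finsupp.prod_of_support_subset _ Finsupp.support_smul _ (by simp), Finsupp.prod,
          ← Finset.prod_pow]
        exact Finset.prod_congr rfl fun b _ => by
          rw [← pow_mul, mul_comm, Finsupp.smul_apply, smul_eq_mul]
      refine ⟨Finsupp.single ⟨r, fun b hb => he ?_, fun b => ?_⟩ (a * mon q), ?_⟩
      · simp only [Finset.mem_coe, Finsupp.mem_support_iff, hr] at hb ⊢
        intro h0
        simp [h0] at hb
      · rw [hr]
        exact Nat.mod_lt _ (pow_pos hp.out.pos _)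
      · rw [Finsupp.liftAddHom_apply_single]
        change QuotientAddGroup.mk _ = QuotientAddGroup.mk _
        rw [hmon]
        congr 1
        simp only [mul_pow, Nat.sub_zero, pow_zero]
        ring
    · have h0 : (p : T) ^ i * a ^ p ^ (N + 1 - i) * b ∈ V := by
        refine ⟨_, mem_wittSpan (p := p) (show i - 1 ≤ N by omega) a hb, ?_⟩
        obtain ⟨i, rfl⟩ := Nat.exists_eq_succ_of_ne_zero hi0.ne'
        rw [show N - (i.succ - 1) = N + 1 - i.succ by omega]
        simp [pow_succ']
        ring
      refine ⟨0, ?_⟩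
      rw [map_zero]
      exact ((QuotientAddGroup.eq_zero_iff _).mpr h0).symm
  obtain ⟨F, hF⟩ := hrange hu
  have hF' : u - ∑ e ∈ F.support, F e ^ p ^ (N + 1) * mon e ∈ V := by
    rw [← QuotientAddGroup.eq_zero_iff, QuotientAddGroup.mk_sub, sub_eq_zero]
    have h1 : (QuotientAddGroup.mk (∑ e ∈ F.support, F e ^ p ^ (N + 1) * mon e) : T ⧸ V) =
        ∑ e ∈ F.support, QuotientAddGroup.mk' V (F e ^ p ^ (N + 1) * mon e) :=
      map_sum (QuotientAddGroup.mk' V) _ _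
    rw [h1]
    refine hF.symm.trans ?_
    simp only [Φ, Finsupp.liftAddHom_apply]
    rfl
  obtain ⟨y, hy, hyu⟩ := hF'
  have hyu : (p : T) * y = u - ∑ e ∈ F.support, F e ^ p ^ (N + 1) * mon e := hyu
  have hres : ∀ x ∈ maximalIdeal T, residue T x = 0 := fun x hx => (residue_eq_zero_iff x).mpr hx
  have hzero : ∀ e ∈ F.support, residue T (F e) = 0 := by
    refine hB ι F.support (fun e => (e : ResidueField T →₀ ℕ)) (fun e => residue T (F e))
      Subtype.val_injective.injOn (fun e _ => e.2) ?_
    have h2 := congrArg (residue T) hyu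
    rw [map_mul, hres _ hpm, zero_mul, map_sub, hres u hum, zero_sub, eq_comm, neg_eq_zero,
      map_sum] at h2
    rw [← h2]
    refine Finset.sum_congr rfl fun e _ => ?_
    rw [map_mul, map_pow]
    congr 1
    simp [mon, Finsupp.prod, map_prod, hσ]
  refine ⟨y, hy, ?_⟩
  rw [hyu, sub_sub_cancel]
  refine sum_mem fun e he => Ideal.mul_mem_right _ _ ?_
  have h3 : F e ∈ maximalIdeal T := (residue_eq_zero_iff _).mp (hzero e he)
  exact Ideal.pow_le_pow_right (Nat.lt_pow_self hp.out.one_lt) (Ideal.pow_mem_pow h3 _)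

end CoefficientRing

section CoefficientRing
open IsLocalRing

variable {T : Type u} [CommRing T]

theorem mem_of_forall_mem_sup_pow [IsNoetherianRing T] [IsLocalRing T] (I : Ideal T) {x : T}
    (h : ∀ n, x ∈ I ⊔ maximalIdeal T ^ n) : x ∈ I := by
  have hh : IsHausdorff (maximalIdeal T) (T ⧸ I) := inferInstance
  rw [← Ideal.Quotient.eq_zero_iff_mem]
  refine hh.haus _ fun n => ?_
  rw [SModEq.zero]
  obtain ⟨y, hy, z, hz, rfl⟩ := Submodule.mem_sup.mp (h n)
  rw [map_add, Ideal.Quotient.eq_zero_iff_mem.mpr hy, zero_add]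
  have : Ideal.Quotient.mk I z = z • (1 : T ⧸ I) := by
    rw [Algebra.smul_def, mul_one]; rfl
  rw [this]
  exact Submodule.smul_mem_smul hz trivial

theorem exists_mem_of_mul_mem_sup [IsNoetherianRing T] [IsLocalRing T] [IsDomain T] {q : T}
    {U : ℕ → AddSubgroup T} (hU : Antitone U) {x : T}
    (h : ∀ N, ∃ y ∈ U N, x - q * y ∈ maximalIdeal T ^ (N + 2)) :
    ∃ y, (∀ N, y ∈ U N ⊔ (maximalIdeal T ^ (N + 1)).toAddSubgroup) ∧ x = q * y := by
  rcases eq_or_ne q 0 with rfl | hq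
  · refine ⟨0, fun N => zero_mem _, ?_⟩
    refine eq_of_forall_sub_mem_pow fun n => ?_
    obtain ⟨y, -, hy⟩ := h n
    rw [zero_mul] at hy ⊢
    exact Ideal.pow_le_pow_right (by omega) hy
  have hx : x ∈ Ideal.span {q} := by
    refine mem_of_forall_mem_sup_pow _ fun n => ?_
    obtain ⟨y, -, hy⟩ := h n
    rw [← add_sub_cancel (q * y) x]
    exact Submodule.add_mem_sup (Ideal.mem_span_singleton.mpr ⟨y, rfl⟩)
      (Ideal.pow_le_pow_right (by omega) hy)
  obtain ⟨y, rfl⟩ := Ideal.mem_span_singleton.mp hx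
  refine ⟨y, fun N => ?_, rfl⟩
  obtain ⟨c, hc⟩ := Ideal.exists_pow_inf_eq_pow_smul (maximalIdeal T) (Ideal.span {q})
  obtain ⟨z, hz, hyz⟩ := h (N + c)
  rw [← mul_sub] at hyz
  have h1 : q * (y - z) ∈ maximalIdeal T ^ (N + c + 2) • (⊤ : Ideal T) ⊓ Ideal.span {q} :=
    ⟨by simpa using hyz, Ideal.mem_span_singleton.mpr ⟨_, rfl⟩⟩
  rw [hc _ (by omega)] at h1
  have h2 : q * (y - z) ∈ maximalIdeal T ^ (N + c + 2 - c) * Ideal.span {q} :=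
    Submodule.smul_mono le_rfl inf_le_right h1
  obtain ⟨w, hw, hwq⟩ := Ideal.mem_mul_span_singleton.mp h2
  have h3 : w = y - z := mul_left_cancel₀ hq (by rw [← hwq, mul_comm])
  have := AddSubgroup.add_mem_sup (hU (Nat.le_add_right N c) hz)
    (show w ∈ (maximalIdeal T ^ (N + 1)).toAddSubgroup from
      Ideal.pow_le_pow_right (by omega) hw)
  rwa [h3, add_sub_cancel] at this

theorem exists_isCoefficientRing_of_prime [IsDomain T] [IsCompleteNoetherianLocal T] (p : ℕ)
    [hp : Fact p.Prime] (hpm : (p : T) ∈ maximalIdeal T) :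
    ∃ Λ : Subring T, IsCoefficientRing Λ (p : T) := by
  have hchar : CharP (ResidueField T) p := by
    rw [CharP.charP_iff_prime_eq_zero hp.out, ← map_natCast (residue T)]
    exact (residue_eq_zero_iff _).mpr hpm
  obtain ⟨B, hB, hspan⟩ := exists_pBasis p (ResidueField T)
  choose σ hσ using residue_surjective (R := T)
  set M := Submonoid.closure (σ '' B)
  set m := maximalIdeal T
  have hBM : ∀ b ∈ Submonoid.closure B, ∃ b' ∈ M, residue T b' = b := by
    intro b hb
    induction hb using Submonoid.closure_induction with
    | mem x hx => exact ⟨σ x, Submonoid.subset_closure ⟨x, hx, rfl⟩, hσ x⟩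
    | one => exact ⟨1, M.one_mem, map_one _⟩
    | mul x y _ _ hx hy =>
      obtain ⟨x', hx', rfl⟩ := hx
      obtain ⟨y', hy', rfl⟩ := hy
      exact ⟨x' * y', mul_mem hx' hy', map_mul _ _ _⟩
  have hM : ∀ x : T, x ∈ AddSubgroup.closure {z | ∃ y, ∃ b ∈ M, z = y ^ p * b} ⊔
      m.toAddSubgroup := by
    intro x
    have key : ∀ z ∈ AddSubgroup.closure
        {z : ResidueField T | ∃ y, ∃ b ∈ Submonoid.closure B, z = y ^ p * b},
        ∃ t ∈ AddSubgroup.closure {z | ∃ y, ∃ b ∈ M, z = y ^ p * b}, residue T t = z := by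
      intro z hz
      induction hz using AddSubgroup.closure_induction with
      | mem z hz =>
        obtain ⟨y, b, hb, rfl⟩ := hz
        obtain ⟨b', hb', rfl⟩ := hBM b hb
        exact ⟨σ y ^ p * b', AddSubgroup.subset_closure ⟨_, _, hb', rfl⟩, by simp [hσ]⟩
      | zero => exact ⟨0, zero_mem _, map_zero _⟩
      | add x y _ _ hx hy =>
        obtain ⟨x', hx', rfl⟩ := hx
        obtain ⟨y', hy', rfl⟩ := hy
        exact ⟨x' + y', add_mem hx' hy', map_add _ _ _⟩
      | neg x _ hx =>
        obtain ⟨x', hx', rfl⟩ := hx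
        exact ⟨-x', neg_mem hx', map_neg _ _⟩
    obtain ⟨t, ht, htx⟩ := key _ (hspan (residue T x))
    have := AddSubgroup.add_mem_sup ht (show x - t ∈ m.toAddSubgroup from
      (residue_eq_zero_iff _).mp (by rw [map_sub, htx, sub_self]))
    rwa [add_sub_cancel] at this
  have hstep := wittSpan_le_sup hp.out hpm hM
  let V (N : ℕ) : AddSubgroup T := wittSpan p M N ⊔ (m ^ (N + 1)).toAddSubgroup
  have hVone : ∀ N, (1 : T) ∈ V N := fun N => AddSubgroup.mem_sup_left (one_mem_wittSpan N)
  let Λ : Subring T :=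
    { carrier := {x | ∀ N, x ∈ V N}
      one_mem' := hVone
      zero_mem' := fun N => zero_mem _
      add_mem' := fun hx hy N => add_mem (hx N) (hy N)
      neg_mem' := fun hx N => neg_mem (hx N)
      mul_mem' := fun {x y} hx hy N => by
        obtain ⟨a, ha, b, hb, rfl⟩ := AddSubgroup.mem_sup.mp (hx N)
        obtain ⟨c, hc, d, hd, rfl⟩ := AddSubgroup.mem_sup.mp (hy N)
        rw [add_mul, mul_add, add_assoc]
        exact AddSubgroup.add_mem_sup (wittSpan_mul_mem ha hc)
          (add_mem (Ideal.mul_mem_left _ a hd) (Ideal.mul_mem_right (c + d) _ hb)) }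
  have hΛ : ∀ x, x ∈ Λ ↔ ∀ N, x ∈ V N := fun _ => Iff.rfl
  refine ⟨Λ, natCast_mem Λ p, hpm, ?_, ?_, ?_⟩
  · intro x hx hxm
    obtain ⟨y, hy, rfl⟩ := exists_mem_of_mul_mem_sup (q := (p : T)) (U := wittSpan p M) (x := x)
      wittSpan_antitone (fun N => by
        obtain ⟨u, hu, z, hz, rfl⟩ := AddSubgroup.mem_sup.mp (hx (N + 1))
        have hz : z ∈ m ^ (N + 2) := hz
        have hum : u ∈ m := by
          have := sub_mem hxm (Ideal.pow_le_self (by omega) hz)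
          rwa [add_sub_cancel_right] at this
        obtain ⟨y, hy, hyu⟩ := wittSpan_inter_maximalIdeal hpm σ hσ (hB (N + 1)) hu hum
        refine ⟨y, hy, ?_⟩
        have := add_mem hyu hz
        convert this using 1
        ring)
    exact ⟨y, hy, rfl⟩
  · intro x
    have hnext : ∀ N, ∀ u : wittSpan p M N, ∃ v : wittSpan p M (N + 1),
        (v : T) - u ∈ m ^ (N + 1) := by
      intro N u
      obtain ⟨v, hv, z, hz, h⟩ := AddSubgroup.mem_sup.mp (hstep N u.2)
      refine ⟨⟨v, hv⟩, ?_⟩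
      rw [← h]
      have hz : z ∈ m ^ (N + 1) := hz
      simpa using neg_mem hz
    choose g hg using hnext
    let u : ∀ N, wittSpan p M N := fun N =>
      Nat.rec (motive := fun N => wittSpan p M N) ⟨x, wittSpan_zero x⟩ g N
    have hu : ∀ N, (u (N + 1)).1 - (u N).1 ∈ m ^ (N + 1) := by
      intro N
      exact hg N (u N)
    obtain ⟨L, hL⟩ := IsCompleteNoetherianLocal.cauchyConverges (fun N => (u N).1) fun n =>
      Ideal.pow_le_pow_right (Nat.le_succ n) (hu n)
    have hL' : ∀ N, L - (u N).1 ∈ m ^ (N + 1) := by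
      intro N
      have := add_mem (hL (N + 1)) (hu N)
      simpa using this
    refine ⟨L, fun N => ?_, ?_⟩
    · have := AddSubgroup.add_mem_sup (u N).2
        (show L - (u N).1 ∈ (m ^ (N + 1)).toAddSubgroup from hL' N)
      rwa [add_sub_cancel] at this
    · have := neg_mem (hL' 0)
      rwa [zero_add, pow_one, neg_sub] at this
  · intro f hf L hL N
    have := add_mem (hf (N + 1) N) (AddSubgroup.mem_sup_right (S := wittSpan p M N)
      (show L - f (N + 1) ∈ (m ^ (N + 1)).toAddSubgroup from hL (N + 1)))
    rwa [add_sub_cancel] at this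

theorem exists_isCoefficientRing_of_charZero [IsCompleteNoetherianLocal T]
    (h : ∀ p : ℕ, p.Prime → (p : T) ∉ maximalIdeal T) :
    ∃ Λ : Subring T, IsCoefficientRing Λ (0 : T) := by
  have hunit : ∀ n : ℕ, n ≠ 0 → IsUnit (n : T) := by
    intro n hn
    induction n using Nat.recOnMul with
    | zero => exact (hn rfl).elim
    | one => simp
    | prime p hp => simpa using h p hp
    | mul a b ha hb =>
      rw [Nat.cast_mul]
      exact (ha (left_ne_zero_of_mul hn)).mul (hb (right_ne_zero_of_mul hn))
  have hunit' : ∀ y : nonZeroDivisors ℤ, IsUnit (Int.castRingHom T y) := by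
    rintro ⟨y, hy⟩
    have hy : y ≠ 0 := nonZeroDivisors.ne_zero hy
    obtain ⟨n, rfl | rfl⟩ := Int.eq_nat_or_neg y
    · simpa using hunit n (by simpa using hy)
    · simpa using hunit n (by simpa using hy)
  let φ : ℚ →+* T := IsLocalization.lift (M := nonZeroDivisors ℤ) hunit'
  let : Algebra ℚ T := φ.toAlgebra
  let : Field (T ⧸ maximalIdeal T) := Ideal.Quotient.field _
  have hs : Algebra.FormallySmooth ℚ (T ⧸ maximalIdeal T) := by
    obtain ⟨ι, v, hv⟩ := exists_isTranscendenceBasis' ℚ (T ⧸ maximalIdeal T)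
    have := hv.isAlgebraic_field
    exact .of_algebraicIndependent_of_isSeparable hv.1
  have := IsCompleteNoetherianLocal.isAdicComplete T
  obtain ⟨g, hg⟩ := Algebra.FormallySmooth.exists_mkₐ_comp_eq_of_isAdicComplete
    (AlgHom.id ℚ (T ⧸ maximalIdeal T))
  have hg' : ∀ k, Ideal.Quotient.mk _ (g k) = k := fun k => congrArg (· k) hg
  have hinj : ∀ k, g k ∈ maximalIdeal T → k = 0 := fun k hk => by
    rw [← hg' k, Ideal.Quotient.eq_zero_iff_mem]
    exact hk
  refine ⟨(g : (T ⧸ maximalIdeal T) →+* T).range, zero_mem _, zero_mem _, ?_, ?_, ?_⟩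
  · rintro _ ⟨k, rfl⟩ hk
    exact ⟨0, zero_mem _, by simp [hinj k hk]⟩
  · intro x
    refine ⟨g (Ideal.Quotient.mk _ x), ⟨_, rfl⟩, ?_⟩
    rw [← Ideal.Quotient.eq_zero_iff_mem, map_sub, hg', sub_self]
  · intro f hf L hL
    have hconst : ∀ n, f (n + 1) = f 1 := by
      intro n
      obtain ⟨k, hk⟩ := hf (n + 1)
      obtain ⟨l, hl⟩ := hf 1
      have h1 := sub_mem (hL 1) (Ideal.pow_le_pow_right (Nat.le_add_left 1 n) (hL (n + 1)))
      rw [sub_sub_sub_cancel_left, ← hk, ← hl, ← map_sub, pow_one] at h1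
      have := hinj _ h1
      rw [← hk, ← hl, sub_eq_zero.mp this]
    have : L = f 1 := eq_of_forall_sub_mem_pow fun n => by
      have := hL (n + 1)
      rw [hconst] at this
      exact Ideal.pow_le_pow_right (Nat.le_succ n) this
    rw [this]
    exact hf 1

end CoefficientRing

section CoefficientRingStructure
open IsLocalRing

variable {T : Type u} [CommRing T] [IsLocalRing T] {Λ : Subring T} {ϖ : T}

theorem IsCoefficientRing.isUnit_iff (h : IsCoefficientRing Λ ϖ) (x : Λ) :
    IsUnit x ↔ (x : T) ∉ maximalIdeal T := by
  refine ⟨fun hx => notMem_maximalIdeal.mpr (hx.map Λ.subtype), fun hx => ?_⟩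
  obtain ⟨⟨x', y, hxy, _⟩, rfl : x' = (x : T)⟩ := notMem_maximalIdeal.mp hx
  obtain ⟨μ, hμ, hμy⟩ := h.exists_sub_mem y
  have hy : y ∈ Λ := by
    refine h.mem_of_limit (fun n => μ * ∑ i ∈ Finset.range n, (1 - x * μ) ^ i)
      (fun n => mul_mem hμ (sum_mem fun i _ => pow_mem (sub_mem (one_mem _) (mul_mem x.2 hμ)) _))
      y fun n => ?_
    have hw : 1 - x * μ ∈ maximalIdeal T := by
      have := Ideal.mul_mem_left _ (x : T) hμy
      rwa [mul_sub, hxy] at this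
    have hg := mul_neg_geom_sum (1 - (x : T) * μ) n
    rw [sub_sub_cancel] at hg
    have : y - μ * ∑ i ∈ Finset.range n, (1 - (x : T) * μ) ^ i = y * (1 - x * μ) ^ n := by
      linear_combination (-y) * hg + (μ * ∑ i ∈ Finset.range n, (1 - (x : T) * μ) ^ i) * hxy
    rw [this]
    exact Ideal.mul_mem_left _ _ (Ideal.pow_mem_pow hw n)
  exact .of_mul_eq_one ⟨y, hy⟩ (Subtype.ext hxy)

theorem IsCoefficientRing.isLocalRing (h : IsCoefficientRing Λ ϖ) : IsLocalRing Λ := by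
  refine .of_isUnit_or_isUnit_one_sub_self fun x => ?_
  rw [h.isUnit_iff, h.isUnit_iff, ← not_and_or]
  rintro ⟨h1, h2⟩
  have := add_mem h1 h2
  simp at this

theorem IsCoefficientRing.mem_maximalIdeal_iff (h : IsCoefficientRing Λ ϖ) [IsLocalRing Λ]
    (x : Λ) : x ∈ maximalIdeal Λ ↔ (x : T) ∈ maximalIdeal T := by
  rw [IsLocalRing.mem_maximalIdeal, mem_nonunits_iff, h.isUnit_iff, not_not]

theorem IsCoefficientRing.maximalIdeal_eq (h : IsCoefficientRing Λ ϖ) [IsLocalRing Λ] :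
    maximalIdeal Λ = Ideal.span {⟨ϖ, h.mem⟩} := by
  ext x
  rw [h.mem_maximalIdeal_iff, Ideal.mem_span_singleton]
  constructor
  · intro hx
    obtain ⟨y, hy, hxy⟩ := h.exists_eq_mul x x.2 hx
    exact ⟨⟨y, hy⟩, Subtype.ext hxy⟩
  · rintro ⟨y, rfl⟩
    exact Ideal.mul_mem_right _ _ h.mem_maximalIdeal

theorem IsCoefficientRing.exists_associated [IsNoetherianRing T] (h : IsCoefficientRing Λ ϖ)
    {x : Λ} (hx : x ≠ 0) : ∃ k, Associated ((⟨ϖ, h.mem⟩ : Λ) ^ k) x := by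
  have hn : ∃ n, (x : T) ∉ maximalIdeal T ^ n := by
    by_contra! hall
    exact hx (Subtype.ext (eq_of_forall_sub_mem_pow fun n => by simpa using hall n))
  obtain ⟨n, hn⟩ := hn
  clear hx
  induction n generalizing x with
  | zero => simp at hn
  | succ n ih =>
    by_cases hu : (x : T) ∈ maximalIdeal T
    · obtain ⟨y, hy, hxy⟩ := h.exists_eq_mul x x.2 hu
      obtain ⟨k, hk⟩ := ih (x := ⟨y, hy⟩) fun hyn => hn (by
        rw [hxy, pow_succ']
        exact Ideal.mul_mem_mul h.mem_maximalIdeal hyn)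
      refine ⟨k + 1, ?_⟩
      have hx' : x = ⟨ϖ, h.mem⟩ * ⟨y, hy⟩ := Subtype.ext hxy
      rw [hx', pow_succ']
      exact hk.mul_left _
    · refine ⟨0, ?_⟩
      rw [pow_zero, associated_one_iff_isUnit.symm.trans (comm (r := Associated)) |>.symm]
      exact (h.isUnit_iff x).mpr hu

theorem IsCoefficientRing.isPrincipalIdealRing [IsNoetherianRing T]
    (h : IsCoefficientRing Λ ϖ) : IsPrincipalIdealRing Λ := by
  classical
  refine ⟨fun I => ?_⟩
  by_cases hI : I = ⊥
  · rw [hI]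
    exact bot_isPrincipal
  have hmem : ∀ x ∈ I, x ≠ 0 → ∃ k, (⟨ϖ, h.mem⟩ : Λ) ^ k ∈ I ∧ (⟨ϖ, h.mem⟩ : Λ) ^ k ∣ x := by
    intro x hx hx0
    obtain ⟨k, hk⟩ := h.exists_associated hx0
    exact ⟨k, I.mem_of_dvd hk.dvd' hx, hk.dvd⟩
  have hex : ∃ k, (⟨ϖ, h.mem⟩ : Λ) ^ k ∈ I := by
    obtain ⟨x, hx, hx0⟩ := Submodule.exists_mem_ne_zero_of_ne_bot hI
    obtain ⟨k, hk, _⟩ := hmem x hx hx0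
    exact ⟨k, hk⟩
  refine ⟨_, le_antisymm (fun x hx => ?_)
    ((Ideal.span_singleton_le_iff_mem _).mpr (Nat.find_spec hex))⟩
  by_cases hx0 : x = 0
  · rw [hx0]
    exact zero_mem _
  obtain ⟨k, hk, hkx⟩ := hmem x hx hx0
  exact Ideal.mem_span_singleton.mpr ((pow_dvd_pow _ (Nat.find_min' hex hk)).trans hkx)

theorem IsCoefficientRing.isCompleteNoetherianLocal [IsCompleteNoetherianLocal T]
    (h : IsCoefficientRing Λ ϖ) : IsCompleteNoetherianLocal Λ := by
  have := h.isPrincipalIdealRing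
  have := h.isLocalRing
  refine ⟨inferInstance, this, fun f hf => ?_⟩
  have hϖ := h.mem_maximalIdeal
  simp only [h.maximalIdeal_eq, Ideal.span_singleton_pow, Ideal.mem_span_singleton] at hf ⊢
  choose d hd using hf
  have hd' : ∀ n, (f (n + 1) : T) - f n = ϖ ^ n * d n := fun n => congrArg Subtype.val (hd n)
  obtain ⟨L, hL⟩ := IsCompleteNoetherianLocal.cauchyConverges (fun n => (f n : T)) fun n => by
    rw [hd']
    exact Ideal.mul_mem_right _ _ (Ideal.pow_mem_pow hϖ n)
  refine ⟨⟨L, h.mem_of_limit _ (fun n => (f n).2) L hL⟩, fun n => ?_⟩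
  let c (j : ℕ) : T := ∑ i ∈ Finset.range j, ϖ ^ i * d (n + i)
  obtain ⟨c', hc'⟩ := IsCompleteNoetherianLocal.cauchyConverges c fun j => by
    simp only [c, Finset.sum_range_succ, add_sub_cancel_left]
    exact Ideal.mul_mem_right _ _ (Ideal.pow_mem_pow hϖ j)
  have hcmem : c' ∈ Λ := h.mem_of_limit c
    (fun j => sum_mem fun i _ => mul_mem (pow_mem h.mem _) (d (n + i)).2) c' hc'
  have hc : ∀ j, (f (n + j) : T) - f n = ϖ ^ n * c j := by
    intro j
    induction j with
    | zero => simp [c]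
    | succ j ih =>
      have h1 := hd' (n + j)
      simp only [c, Finset.sum_range_succ] at ih ⊢
      rw [← add_assoc, mul_add, ← ih, ← mul_assoc, ← pow_add, ← h1]
      ring
  refine ⟨⟨c', hcmem⟩, Subtype.ext ?_⟩
  refine eq_of_forall_sub_mem_pow fun j => ?_
  change L - f n - ϖ ^ n * c' ∈ _
  have h1 := Ideal.pow_le_pow_right (Nat.le_add_left j n) (hL (n + j))
  have h2 := Ideal.mul_mem_left _ (ϖ ^ n) (hc' j)
  have := sub_mem h1 h2
  convert this using 1
  linear_combination hc j

end CoefficientRingStructure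

section CompleteFinite

theorem mem_smul_top_pi {R ι : Type*} [CommRing R] [Fintype ι] {I : Ideal R} {x : ι → R} :
    x ∈ (I • ⊤ : Submodule R (ι → R)) ↔ ∀ i, x i ∈ I := by
  classical
  refine ⟨fun hx i => ?_, fun hx => ?_⟩
  · refine Submodule.smul_induction_on hx (fun r hr y _ => Ideal.mul_mem_right _ _ hr)
      fun y z hy hz => add_mem hy hz
  · rw [pi_eq_sum_univ' x]
    exact sum_mem fun i _ => Submodule.smul_mem_smul (hx i) trivial

theorem isPrecomplete_pi {R : Type*} (ι : Type*) [CommRing R] [Fintype ι] (I : Ideal R)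
    [IsPrecomplete I R] : IsPrecomplete I (ι → R) := by
  refine ⟨fun f hf => ?_⟩
  have h : ∀ i, ∃ L, ∀ n, L - f n i ∈ I ^ n := fun i =>
    cauchyConverges_of_isPrecomplete I (fun n => f n i) fun n => by
      have := (hf (Nat.le_succ n)).symm
      rw [SModEq.sub_mem, mem_smul_top_pi] at this
      exact this i
  choose L hL using h
  refine ⟨L, fun n => ?_⟩
  rw [SModEq.comm, SModEq.sub_mem, mem_smul_top_pi]
  exact fun i => hL i n

/-- A separated module over a complete ring which is finitely generated modulo the ideal is
finitely generated. -/
theorem Module.Finite.of_sup_smul_top_eq_top {R M : Type*} [CommRing R] [AddCommGroup M]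
    [Module R M] (I : Ideal R) [IsPrecomplete I R] [IsHausdorff I M] {N : Submodule R M}
    (hN : N.FG) (h : N ⊔ I • ⊤ = ⊤) : Module.Finite R M := by
  obtain ⟨n, f, hf⟩ := (Submodule.fg_iff_exists_fin_linearMap R M).mp hN
  have := isPrecomplete_pi (Fin n) I
  refine Module.Finite.of_surjective f (surjective_of_mkQ_comp_surjective (I := I) fun y => ?_)
  obtain ⟨m, rfl⟩ := Submodule.mkQ_surjective _ y
  obtain ⟨a, ha, b, hb, rfl⟩ := Submodule.mem_sup.mp (h.ge (Submodule.mem_top (x := m)))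
  rw [← hf] at ha
  obtain ⟨v, rfl⟩ := ha
  refine ⟨v, ?_⟩
  have hb0 : Submodule.mkQ (I • ⊤) b = 0 := (Submodule.Quotient.mk_eq_zero _).mpr hb
  rw [LinearMap.comp_apply, map_add, hb0, add_zero]

end CompleteFinite

section PowerSeriesNormal

theorem isIntegral_div_iff {R K : Type*} [CommRing R] [IsDomain R] [IsNoetherianRing R] [Field K]
    [Algebra R K] [IsFractionRing R K] (f : R) {g : R} (hg : g ≠ 0) :
    IsIntegral R (algebraMap R K f / algebraMap R K g) ↔ ∃ r ≠ 0, ∀ n, g ^ n ∣ r * f ^ n := by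
  have hg' : algebraMap R K g ≠ 0 := by simpa using hg
  rw [← isAlmostIntegral_iff_isIntegral, IsAlmostIntegral]
  refine exists_congr fun r => ?_
  rw [mem_nonZeroDivisors_iff_ne_zero]
  refine and_congr_right fun _ => forall_congr' fun n => exists_congr fun s => ?_
  rw [Algebra.smul_def, div_pow, mul_div_assoc', eq_div_iff (pow_ne_zero _ hg'), ← map_pow,
    ← map_pow, ← map_mul, ← map_mul, (IsFractionRing.injective R K).eq_iff, mul_comm s, eq_comm]

theorem pow_dvd_of_pow_dvd_mul_pow {R : Type*} [CommRing R] [IsDomain R] {x g c : R}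
    (hx : Prime x) (hg : ¬ x ∣ g) {k n : ℕ} (h : g ^ n ∣ x ^ k * c) : g ^ n ∣ c := by
  obtain ⟨d, hd⟩ := h
  obtain ⟨e, rfl⟩ := hx.pow_dvd_of_dvd_mul_left k (fun h => hg (hx.dvd_of_dvd_pow h))
    (Dvd.intro _ hd)
  refine ⟨e, mul_left_cancel₀ (pow_ne_zero k hx.ne_zero) ?_⟩
  rw [hd]
  ring

theorem PowerSeries.isIntegrallyClosed (A : Type u) [CommRing A] [IsDomain A]
    [IsNoetherianRing A] [IsIntegrallyClosed A] : IsIntegrallyClosed (PowerSeries A) := by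
  let K := FractionRing (PowerSeries A)
  let F := FractionRing A
  have hX : Prime (PowerSeries.X : PowerSeries A) := PowerSeries.X_prime
  have key : ∀ f g : PowerSeries A, ¬ PowerSeries.X ∣ g →
      IsIntegral (PowerSeries A) (algebraMap _ K f / algebraMap _ K g) →
      ∃ a f', f = PowerSeries.C a * g + PowerSeries.X * f' ∧
        IsIntegral (PowerSeries A) (algebraMap _ K f' / algebraMap _ K g) := by
    intro f g hg h
    have hg0 : g ≠ 0 := fun h => hg (h ▸ dvd_zero _)
    obtain ⟨r, hr, hn⟩ := (isIntegral_div_iff f hg0).mp h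
    obtain ⟨r', hrr', hr'⟩ :=
      (FiniteMultiplicity.of_prime_left hX hr).exists_eq_pow_mul_and_not_dvd
    generalize multiplicity PowerSeries.X r = k at hrr'
    subst hrr'
    have hn' : ∀ n, g ^ n ∣ r' * f ^ n := fun n =>
      pow_dvd_of_pow_dvd_mul_pow hX hg (k := k) (by rw [← mul_assoc]; exact hn n)
    rw [PowerSeries.X_dvd_iff] at hg hr'
    have hint : IsIntegral A (algebraMap A F (PowerSeries.constantCoeff f) /
        algebraMap A F (PowerSeries.constantCoeff g)) := by
      refine (isIntegral_div_iff _ hg).mpr ⟨_, hr', fun n => ?_⟩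
      have := map_dvd PowerSeries.constantCoeff (hn' n)
      simpa using this
    obtain ⟨a, ha⟩ := IsIntegrallyClosed.isIntegral_iff.mp hint
    have ha : PowerSeries.constantCoeff f = a * PowerSeries.constantCoeff g := by
      rw [eq_div_iff (by simpa using hg), ← map_mul] at ha
      exact (IsFractionRing.injective A F ha).symm
    obtain ⟨f', hf'⟩ : PowerSeries.X ∣ f - PowerSeries.C a * g := by
      rw [PowerSeries.X_dvd_iff, map_sub, map_mul, PowerSeries.constantCoeff_C, ha, sub_self]
    refine ⟨a, f', by rw [← hf']; ring, ?_⟩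
    have h1 : IsIntegral (PowerSeries A)
        (algebraMap _ K (PowerSeries.X * f') / algebraMap _ K g) := by
      have h2 := h.sub (isIntegral_algebraMap (R := PowerSeries A) (A := K) (x := PowerSeries.C a))
      have hg' : algebraMap _ K g ≠ 0 := by simpa using hg0
      rw [← hf', map_sub, map_mul, sub_div, mul_div_assoc, div_self hg', mul_one]
      exact h2
    rw [isIntegral_div_iff _ hg0] at h1 ⊢
    obtain ⟨s, hs, hsn⟩ := h1
    refine ⟨s, hs, fun n =>
      pow_dvd_of_pow_dvd_mul_pow hX (by rwa [PowerSeries.X_dvd_iff]) (k := n) ?_⟩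
    convert hsn n using 1
    ring
  have key2 : ∀ f g : PowerSeries A, ¬ PowerSeries.X ∣ g →
      IsIntegral (PowerSeries A) (algebraMap _ K f / algebraMap _ K g) → g ∣ f := by
    intro f g hg h
    let P := {f : PowerSeries A // IsIntegral (PowerSeries A) (algebraMap _ K f / algebraMap _ K g)}
    choose a f' hf' hP using fun f : P => key f.1 g hg f.2
    let s : ℕ → P := fun n => Nat.rec (motive := fun _ => P) ⟨f, h⟩ (fun _ p => ⟨f' p, hP p⟩) n
    have hs : ∀ n, f = (∑ i ∈ Finset.range n, PowerSeries.C (a (s i)) * PowerSeries.X ^ i) * g +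
        PowerSeries.X ^ n * (s n).1 := by
      intro n
      induction n with
      | zero => simp [s]
      | succ n ih =>
        rw [Finset.sum_range_succ]
        conv_lhs => rw [ih, hf' (s n)]
        have : (s (n + 1)).1 = f' (s n) := rfl
        rw [this]
        ring
    refine ⟨PowerSeries.mk fun i => a (s i), ?_⟩
    have hdvd : ∀ n, PowerSeries.X ^ n ∣ f - g * PowerSeries.mk fun i => a (s i) := by
      intro n
      rw [PowerSeries.eq_sum_add_X_pow_mul (PowerSeries.mk fun i => a (s i)) n]
      simp only [PowerSeries.coeff_mk]
      conv_rhs => rw [hs n]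
      exact ⟨(s n).1 - g * PowerSeries.mk fun i => a (s (i + n)), by ring⟩
    rw [← sub_eq_zero]
    ext n
    exact PowerSeries.X_pow_dvd_iff.mp (hdvd (n + 1)) n (Nat.lt_succ_self n)
  refine (isIntegrallyClosed_iff K).mpr fun {x} hx => ?_
  obtain ⟨f, g, hg, rfl⟩ := IsFractionRing.div_surjective (A := PowerSeries A) x
  have hg0 : g ≠ 0 := nonZeroDivisors.ne_zero hg
  by_cases hf0 : f = 0
  · exact ⟨0, by simp [hf0]⟩
  obtain ⟨f', hf, hf'⟩ := (FiniteMultiplicity.of_prime_left hX hf0).exists_eq_pow_mul_and_not_dvd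
  obtain ⟨g', hg1, hg'⟩ := (FiniteMultiplicity.of_prime_left hX hg0).exists_eq_pow_mul_and_not_dvd
  generalize multiplicity PowerSeries.X f = t at hf
  generalize multiplicity PowerSeries.X g = s at hg1
  subst hf hg1
  have hX0 := (map_ne_zero_iff _ (IsFractionRing.injective (PowerSeries A) K)).mpr hX.ne_zero
  obtain ⟨r, hr, hn⟩ := (isIntegral_div_iff _ hg0).mp hx
  have hst : s ≤ t := by
    by_contra! hlt
    have hdvd : ∀ n, PowerSeries.X ^ n ∣ r := by
      intro n
      have h1 : PowerSeries.X ^ (t * n) * PowerSeries.X ^ n ∣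
          PowerSeries.X ^ (t * n) * (f' ^ n * r) := by
        rw [← pow_add]
        refine (pow_dvd_pow _ (by nlinarith : t * n + n ≤ s * n)).trans ?_
        have := (Dvd.intro _ (mul_pow (PowerSeries.X ^ s) g' n).symm).trans (hn n)
        rw [← pow_mul] at this
        convert this using 1
        ring
      exact hX.pow_dvd_of_dvd_mul_left n (fun h => hf' (hX.dvd_of_dvd_pow h))
        ((mul_dvd_mul_iff_left (pow_ne_zero _ hX.ne_zero)).mp h1)
    refine hr ?_
    ext n
    exact PowerSeries.X_pow_dvd_iff.mp (hdvd (n + 1)) n (Nat.lt_succ_self n)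
  obtain ⟨d, rfl⟩ := Nat.exists_eq_add_of_le hst
  have heq : algebraMap _ K (PowerSeries.X ^ (s + d) * f') / algebraMap _ K (PowerSeries.X ^ s * g')
      = algebraMap _ K (PowerSeries.X ^ d * f') / algebraMap _ K g' := by
    rw [pow_add, mul_assoc, map_mul, map_mul _ (PowerSeries.X ^ s), map_pow,
      mul_div_mul_left _ _ (pow_ne_zero _ hX0)]
  rw [heq] at hx ⊢
  obtain ⟨c, hc⟩ := key2 _ _ hg' hx
  have hg0' : algebraMap _ K g' ≠ 0 := by simpa using right_ne_zero_of_mul hg0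
  exact ⟨c, by rw [hc, map_mul, mul_div_cancel_left₀ _ hg0']⟩

end PowerSeriesNormal

section PowerSeriesNTwo

theorem IsNTwo.finite_of_rank_lt {A : Type u} [CommRing A] [IsDomain A] [IsNoetherianRing A]
    (hA : IsNTwo A) {D : Type u} [CommRing D] [IsDomain D] [Algebra A D] [FaithfulSMul A D]
    [Algebra.IsIntegral A D] (h : Module.rank A D < Cardinal.aleph0) : Module.Finite A D := by
  let K := FractionRing A
  let L := FractionRing D
  let _ : Algebra K L := FractionRing.liftAlgebra A L
  have : IsScalarTower A K L := inferInstance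
  have : FiniteDimensional K L := by
    rw [FiniteDimensional, ← Module.rank_lt_aleph0_iff]
    rwa [Algebra.IsAlgebraic.rank_fractionRing A D]
  have : Module.Finite A (integralClosure A L) := hA K L
  let f : D →ₗ[A] integralClosure A L :=
    { toFun := fun d => ⟨algebraMap D L d, (Algebra.IsIntegral.isIntegral (R := A) d).algebraMap⟩
      map_add' := fun x y => Subtype.ext (map_add _ x y)
      map_smul' := fun a x => Subtype.ext (by
        simp [Algebra.smul_def, ← IsScalarTower.algebraMap_apply]) }
  exact Module.Finite.of_injective f fun x y hxy =>
    IsFractionRing.injective D L (congrArg Subtype.val hxy)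

/-- For an N-2 domain `A`, a finite-rank domain `C` over `A⟦X⟧` is finite if its elements have
their `q`-th powers in `A⟦X⟧`, and it contains a `q`-th root of `X` dividing every element whose
`q`-th power is divisible by `X`. -/
theorem PowerSeries.finite_of_pow_mem {A : Type u} [CommRing A] [IsDomain A] [IsNoetherianRing A]
    (hA : IsNTwo A) {C : Type u} [CommRing C] [IsDomain C] [Algebra (PowerSeries A) C]
    [FaithfulSMul (PowerSeries A) C] {q : ℕ} (hq : q ≠ 0) (φ : C →+* PowerSeries A)
    (hφ : ∀ c, algebraMap (PowerSeries A) C (φ c) = c ^ q) {y : C}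
    (hy : y ^ q = algebraMap (PowerSeries A) C PowerSeries.X)
    (hdvd : ∀ c, PowerSeries.X ∣ φ c → y ∣ c)
    (hrank : Module.rank (PowerSeries A) C < Cardinal.aleph0) :
    Module.Finite (PowerSeries A) C := by
  classical
  set B := PowerSeries A
  have hinj : Function.Injective (algebraMap B C) := FaithfulSMul.algebraMap_injective B C
  have hφB : ∀ b, φ (algebraMap B C b) = b ^ q := fun b => hinj (by rw [hφ, map_pow])
  have hφy : φ y = PowerSeries.X := hinj (by rw [hφ, hy])
  have hX : Prime (PowerSeries.X : B) := PowerSeries.X_prime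
  have hydvd : ∀ c, y ∣ c ↔ PowerSeries.X ∣ φ c := fun c =>
    ⟨fun h => hφy ▸ map_dvd φ h, hdvd c⟩
  let J : Ideal C := Ideal.span {y}
  have hJ : J = (Ideal.span {(PowerSeries.X : B)}).comap φ := by
    ext c
    rw [Ideal.mem_comap, Ideal.mem_span_singleton, Ideal.mem_span_singleton, hydvd]
  have hJprime : J.IsPrime := by
    rw [hJ]
    have := (Ideal.span_singleton_prime hX.ne_zero).mpr hX
    exact Ideal.comap_isPrime φ _
  let D := C ⧸ J
  have hmk : ∀ c : C, (Ideal.Quotient.mk J c = 0) ↔ PowerSeries.X ∣ φ c := fun c => by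
    rw [Ideal.Quotient.eq_zero_iff_mem, Ideal.mem_span_singleton, hydvd]
  let ι : A →+* D := ((Ideal.Quotient.mk J).comp (algebraMap B C)).comp PowerSeries.C
  let _ : Algebra A D := ι.toAlgebra
  have hι : ∀ b : B, Ideal.Quotient.mk J (algebraMap B C b) =
      algebraMap A D (PowerSeries.constantCoeff b) := by
    intro b
    rw [← sub_eq_zero]
    change Ideal.Quotient.mk J _ - Ideal.Quotient.mk J (algebraMap B C (PowerSeries.C _)) = 0
    rw [← map_sub, ← map_sub, hmk, hφB]
    exact dvd_pow (by simp [PowerSeries.X_dvd_iff]) hq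
  have hfaith : FaithfulSMul A D := by
    rw [faithfulSMul_iff_algebraMap_injective, injective_iff_map_eq_zero]
    intro a ha
    have h1 : Ideal.Quotient.mk J (algebraMap B C (PowerSeries.C a)) = 0 := ha
    rw [hmk, hφB, PowerSeries.X_dvd_iff] at h1
    simpa [hq] using h1
  have hint : Algebra.IsIntegral A D := by
    refine ⟨fun d => ?_⟩
    obtain ⟨c, rfl⟩ := Ideal.Quotient.mk_surjective d
    refine IsIntegral.of_pow (Nat.pos_of_ne_zero hq) ?_
    rw [← map_pow, ← hφ, hι]
    exact isIntegral_algebraMap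
  have hlift : ∀ (s : Finset D), LinearIndependent A (fun i : s => (i : D)) →
      LinearIndependent B (fun i : s => (i : D).out) := by
    intro s hs
    rw [Fintype.linearIndependent_iff] at hs ⊢
    intro g hg
    have hpow : ∀ k i, PowerSeries.X ^ k ∣ g i := by
      intro k
      induction k with
      | zero => simp
      | succ k ih =>
        choose h hh using ih
        have h0 : ∑ i, h i • (i : D).out = 0 := by
          have : (PowerSeries.X ^ k : B) • ∑ i, h i • (i : D).out = 0 := by
            rw [Finset.smul_sum, ← hg]
            exact Finset.sum_congr rfl fun i _ => by rw [hh, mul_smul]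
          rw [Algebra.smul_def, mul_eq_zero, map_pow] at this
          refine this.resolve_left (pow_ne_zero _ ?_)
          rw [map_ne_zero_iff _ hinj]
          exact hX.ne_zero
        have h1 := hs (fun i => PowerSeries.constantCoeff (h i)) (by
          have := congrArg (Ideal.Quotient.mk J) h0
          rw [map_zero, map_sum] at this
          rw [← this]
          refine Finset.sum_congr rfl fun i _ => ?_
          rw [Algebra.smul_def, Algebra.smul_def, map_mul, hι]
          congr 1
          exact (Ideal.Quotient.mk_out _).symm)
        intro i
        rw [hh i, pow_succ]
        exact mul_dvd_mul_left _ (PowerSeries.X_dvd_iff.mpr (h1 i))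
    intro i
    ext n
    exact PowerSeries.X_pow_dvd_iff.mp (hpow (n + 1) i) n (Nat.lt_succ_self n)
  obtain ⟨n, hn⟩ := Cardinal.lt_aleph0.mp hrank
  have hrankD : Module.rank A D ≤ n := rank_le fun s hs => by
    have := (hlift s hs).cardinal_le_rank
    rw [hn] at this
    simpa using this
  have hDfin : Module.Finite A D := hA.finite_of_rank_lt
    (hrankD.trans_lt (Cardinal.natCast_lt_aleph0 (n := n)))
  obtain ⟨G, hG⟩ := hDfin.fg_top
  let N : Submodule B C := Submodule.span B (G.image Quotient.out : Finset C)
  have hN : ∀ c : C, ∃ a ∈ N, ∃ d, c = a + y * d := by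
    intro c
    have key : ∀ d : D, ∃ a ∈ N, Ideal.Quotient.mk J a = d := by
      intro d
      have hd : d ∈ Submodule.span A (G : Set D) := hG ▸ Submodule.mem_top
      induction hd using Submodule.span_induction with
      | mem d hd =>
        exact ⟨d.out, Submodule.subset_span (Finset.mem_coe.mpr (Finset.mem_image_of_mem _ hd)),
          Ideal.Quotient.mk_out _⟩
      | zero => exact ⟨0, zero_mem _, map_zero _⟩
      | add x y _ _ hx hy =>
        obtain ⟨x', hx', rfl⟩ := hx
        obtain ⟨y', hy', rfl⟩ := hy
        exact ⟨x' + y', add_mem hx' hy', map_add _ _ _⟩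
      | smul a x h hx =>
        clear h
        obtain ⟨x', hx', rfl⟩ := hx
        refine ⟨(PowerSeries.C a : B) • x', N.smul_mem _ hx', ?_⟩
        rw [Algebra.smul_def, Algebra.smul_def, map_mul]
        rfl
    obtain ⟨a, ha, hac⟩ := key (Ideal.Quotient.mk J c)
    have : c - a ∈ J := by
      rw [← Ideal.Quotient.eq_zero_iff_mem, map_sub, hac, sub_self]
    obtain ⟨d, hd⟩ := Ideal.mem_span_singleton.mp this
    exact ⟨a, ha, d, by rw [← hd]; ring⟩
  have hNk : ∀ k, ∃ N' : Submodule B C, N'.FG ∧ ∀ c : C, ∃ a ∈ N', ∃ d, c = a + y ^ k * d := by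
    intro k
    induction k with
    | zero => exact ⟨⊥, Submodule.fg_bot, fun c => ⟨0, zero_mem _, c, by simp⟩⟩
    | succ k ih =>
      obtain ⟨N', hfg, h⟩ := ih
      refine ⟨N' ⊔ N.map (LinearMap.mulLeft B (y ^ k)), hfg.sup ?_, fun c => ?_⟩
      · exact (Submodule.fg_span (Finset.finite_toSet _)).map _
      · obtain ⟨a, ha, d, rfl⟩ := h c
        obtain ⟨b, hb, e, rfl⟩ := hN d
        refine ⟨a + y ^ k * b, Submodule.add_mem_sup ha ⟨b, hb, rfl⟩, e, by ring⟩
  obtain ⟨N', hfg, h⟩ := hNk q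
  have hsmul : ∀ (k : ℕ) (c : C), c ∈ ((Ideal.span {(PowerSeries.X : B)}) ^ k • ⊤ : Submodule B C) →
      ∃ d, c = algebraMap B C PowerSeries.X ^ k * d := by
    intro k c hc
    rw [Ideal.span_singleton_pow, Submodule.ideal_span_singleton_smul] at hc
    obtain ⟨d, -, rfl⟩ := (Submodule.mem_smul_pointwise_iff_exists _ _ _).mp hc
    exact ⟨d, by rw [Algebra.smul_def, map_pow]⟩
  have hHaus : IsHausdorff (Ideal.span {(PowerSeries.X : B)}) C := by
    refine ⟨fun c hc => ?_⟩
    have h0 : φ c = 0 := by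
      have hall : ∀ k, PowerSeries.X ^ k ∣ φ c := by
        intro k
        have := hc k
        rw [SModEq.zero] at this
        obtain ⟨d, rfl⟩ := hsmul k c this
        rw [map_mul, map_pow, hφB, ← pow_mul]
        exact (pow_dvd_pow _ (Nat.le_mul_of_pos_left k (Nat.pos_of_ne_zero hq))).mul_right _
      ext n
      exact PowerSeries.X_pow_dvd_iff.mp (hall (n + 1)) n (Nat.lt_succ_self n)
    have := hφ c
    rw [h0, map_zero] at this
    exact eq_zero_of_pow_eq_zero this.symm
  refine Module.Finite.of_sup_smul_top_eq_top (Ideal.span {(PowerSeries.X : B)}) hfg ?_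
  refine eq_top_iff.mpr fun c _ => ?_
  obtain ⟨a, ha, d, rfl⟩ := h c
  rw [hy, ← Algebra.smul_def]
  exact Submodule.add_mem_sup ha
    (Submodule.smul_mem_smul (Ideal.mem_span_singleton_self _) Submodule.mem_top)

theorem IsNTwo.powerSeries {A : Type u} [CommRing A] [IsDomain A] [IsNoetherianRing A]
    [IsIntegrallyClosed A] (hA : IsNTwo A) : IsNTwo (PowerSeries A) := by
  have := PowerSeries.isIntegrallyClosed A
  refine IsNTwo.of_isPurelyInseparable fun K L _ _ _ _ _ _ _ _ _ => ?_
  let B := PowerSeries A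
  obtain ⟨p, hp⟩ := ExpChar.exists K
  have : ExpChar L p := expChar_of_injective_algebraMap (algebraMap K L).injective p
  have hinjK : Function.Injective (algebraMap B K) := IsFractionRing.injective B K
  let q := p ^ IsPurelyInseparable.exponent K L
  have hq : q ≠ 0 := pow_ne_zero _ (expChar_ne_zero K p)
  let Ω := AlgebraicClosure L
  have : ExpChar Ω p := expChar_of_injective_algebraMap (algebraMap L Ω).injective p
  obtain ⟨y, hy⟩ := IsAlgClosed.exists_pow_nat_eq
    (algebraMap L Ω (algebraMap B L PowerSeries.X)) (Nat.pos_of_ne_zero hq)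
  let E := IntermediateField.adjoin L {y}
  have : FiniteDimensional L E := IntermediateField.adjoin.finiteDimensional
    (Algebra.IsIntegral.isIntegral y)
  have : IsScalarTower B L E := .of_algebraMap_eq fun _ => rfl
  have : IsScalarTower K L E := .of_algebraMap_eq fun _ => rfl
  have : IsScalarTower B K E := .of_algebraMap_eq fun b => by
    rw [IsScalarTower.algebraMap_apply B L E, IsScalarTower.algebraMap_apply B K L]
    rfl
  have : FiniteDimensional K E := .trans K L E
  have hpow : ∀ c : E, ∃ k : K, algebraMap K E k = c ^ q := by
    rintro ⟨c, hc⟩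
    suffices ∃ k : K, algebraMap L Ω (algebraMap K L k) = c ^ q by
      obtain ⟨k, hk⟩ := this
      exact ⟨k, Subtype.ext hk⟩
    induction hc using IntermediateField.adjoin_induction with
    | mem x hx =>
      rw [Set.mem_singleton_iff] at hx
      exact ⟨algebraMap B K PowerSeries.X, by
        rw [hx, hy, ← IsScalarTower.algebraMap_apply B K L]⟩
    | algebraMap x =>
      obtain ⟨k, hk⟩ := IsPurelyInseparable.exponent_def' K p x
      exact ⟨k, by rw [hk, map_pow]⟩
    | add x z _ _ hx hz =>
      obtain ⟨k, hk⟩ := hx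
      obtain ⟨l, hl⟩ := hz
      exact ⟨k + l, by rw [map_add, map_add, hk, hl, add_pow_expChar_pow]⟩
    | inv x _ hx =>
      obtain ⟨k, hk⟩ := hx
      exact ⟨k⁻¹, by rw [map_inv₀, map_inv₀, hk, inv_pow]⟩
    | mul x z _ _ hx hz =>
      obtain ⟨k, hk⟩ := hx
      obtain ⟨l, hl⟩ := hz
      exact ⟨k * l, by rw [map_mul, map_mul, hk, hl, mul_pow]⟩
  let C := integralClosure B E
  have hinjE : Function.Injective (algebraMap B E) := by
    rw [IsScalarTower.algebraMap_eq B K E]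
    exact (algebraMap K E).injective.comp hinjK
  have hinj : Function.Injective (algebraMap B C) := fun a b hab =>
    hinjE (congrArg Subtype.val hab)
  have hfaith : FaithfulSMul B C := (faithfulSMul_iff_algebraMap_injective B C).mpr hinj
  have hB : ∀ c : E, IsIntegral B c → ∃ b : B, algebraMap B E b = c ^ q := by
    intro c hc
    obtain ⟨k, hk⟩ := hpow c
    have hki : IsIntegral B k := by
      have := hc.pow q
      rw [← hk] at this
      exact (isIntegral_algebraMap_iff (algebraMap K E).injective).mp this
    obtain ⟨b, rfl⟩ := IsIntegrallyClosed.isIntegral_iff.mp hki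
    exact ⟨b, by rw [← hk, ← IsScalarTower.algebraMap_apply]⟩
  have hBC : ∀ c : C, ∃ b : B, algebraMap B C b = c ^ q := fun c => by
    obtain ⟨b, hb⟩ := hB c c.2
    exact ⟨b, Subtype.ext hb⟩
  have : ExpChar C p := by
    have : ExpChar E p := expChar_of_injective_algebraMap (algebraMap K E).injective p
    exact (algebraMap C E).expChar Subtype.val_injective p
  choose f hf using hBC
  let φ : C →+* B :=
    { toFun := f
      map_one' := hinj (by rw [hf, one_pow, map_one])
      map_zero' := hinj (by rw [hf, zero_pow hq, map_zero])
      map_add' := fun a b => hinj (by rw [hf, map_add, hf, hf, add_pow_expChar_pow])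
      map_mul' := fun a b => hinj (by rw [hf, map_mul, hf, hf, mul_pow]) }
  have hyE : y ∈ E := IntermediateField.mem_adjoin_simple_self L y
  have hyq : (⟨y, hyE⟩ : E) ^ q = algebraMap B E PowerSeries.X := Subtype.ext hy
  have hyC : IsIntegral B (⟨y, hyE⟩ : E) := IsIntegral.of_pow (Nat.pos_of_ne_zero hq) (by
    rw [hyq]
    exact isIntegral_algebraMap)
  have hy0 : (⟨y, hyE⟩ : E) ≠ 0 := by
    intro h
    rw [h, zero_pow hq, eq_comm, map_eq_zero_iff _ hinjE] at hyq
    exact PowerSeries.X_ne_zero hyq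
  have hCfin : Module.Finite B C := by
    refine PowerSeries.finite_of_pow_mem hA hq φ hf (y := ⟨⟨y, hyE⟩, hyC⟩) (Subtype.ext hyq) ?_ ?_
    · rintro c ⟨b, hb⟩
      have h1 : (c : E) ^ q = algebraMap B E PowerSeries.X * algebraMap B E b := by
        rw [← map_mul, ← hb]
        exact (congrArg Subtype.val (hf c)).symm
      have h2 : IsIntegral B ((c : E) / ⟨y, hyE⟩) := by
        refine IsIntegral.of_pow (Nat.pos_of_ne_zero hq) ?_
        rw [div_pow, h1, hyq, mul_div_cancel_left₀ _ (hyq ▸ pow_ne_zero _ hy0)]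
        exact isIntegral_algebraMap
      exact ⟨⟨_, h2⟩, Subtype.ext (mul_div_cancel₀ _ hy0).symm⟩
    · refine (LinearMap.rank_le_of_injective (C.val.toLinearMap) Subtype.val_injective).trans_lt ?_
      rw [← IsLocalization.rank_eq (S := K) (nonZeroDivisors B) le_rfl]
      exact Module.rank_lt_aleph0 K E
  exact Module.Finite.integralClosure_of_algHom (IsScalarTower.toAlgHom B L E)
    (algebraMap L E).injective hCfin

end PowerSeriesNTwo

section NoetherNormalization
open IsLocalRing

theorem PowerSeries.maximalIdeal_eq {A : Type*} [CommRing A] [IsLocalRing A] :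
    maximalIdeal (PowerSeries A) =
      (maximalIdeal A).map PowerSeries.C ⊔ Ideal.span {PowerSeries.X} := by
  refine le_antisymm (fun f hf => ?_) (sup_le (Ideal.map_le_iff_le_comap.mpr fun a ha => ?_)
    ((Ideal.span_singleton_le_iff_mem _).mpr ?_))
  · rw [PowerSeries.eq_sum_add_X_pow_mul f 1]
    refine add_mem (Ideal.mem_sup_left ?_) (Ideal.mem_sup_right ?_)
    · rw [Finset.sum_range_one, PowerSeries.coeff_zero_eq_constantCoeff, pow_zero, mul_one]
      exact Ideal.mem_map_of_mem _ ((PowerSeries.mem_maximalIdeal_iff f).mp hf)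
    · rw [pow_one]
      exact Ideal.mul_mem_right _ _ (Ideal.mem_span_singleton_self _)
  · rwa [Ideal.mem_comap, PowerSeries.mem_maximalIdeal_iff, PowerSeries.constantCoeff_C]
  · rw [PowerSeries.mem_maximalIdeal_iff, PowerSeries.constantCoeff_X]
    exact zero_mem _

/-- Adjoining power series variables to a complete normal N-2 domain, every list of elements of
the maximal ideal of a complete local ring is hit by variables. -/
theorem exists_normal_cover_of_list {T : Type u} [CommRing T] [IsCompleteNoetherianLocal T]
    {Λ : Type u} [CommRing Λ] [IsDomain Λ] [IsCompleteNoetherianLocal Λ] [IsIntegrallyClosed Λ]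
    (hΛ : IsNTwo Λ) (φ : Λ →+* T) (hφ : ∀ x, ∃ a, x - φ a ∈ maximalIdeal T)
    (G₀ : Finset Λ) (hG₀ : Ideal.span (G₀ : Set Λ) = maximalIdeal Λ)
    (l : List T) (hl : ∀ x ∈ l, x ∈ maximalIdeal T) :
    ∃ (A : Type u) (_ : CommRing A) (_ : IsDomain A) (_ : IsCompleteNoetherianLocal A)
      (ψ : A →+* T) (G : Finset A), IsNTwo A ∧ IsIntegrallyClosed A ∧
      (∀ x, ∃ a, x - ψ a ∈ maximalIdeal T) ∧
      Ideal.span (G : Set A) = maximalIdeal A ∧ G.card ≤ G₀.card + l.length ∧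
      (maximalIdeal A).map ψ = (maximalIdeal Λ).map φ ⊔ Ideal.span {x | x ∈ l} := by
  classical
  induction l with
  | nil =>
    refine ⟨Λ, inferInstance, inferInstance, inferInstance, φ, G₀, hΛ, inferInstance, hφ, hG₀,
      by simp, ?_⟩
    have : {x : T | x ∈ ([] : List T)} = ∅ := by ext; simp
    rw [this, Ideal.span_empty, sup_bot_eq]
  | cons x l ih =>
    obtain ⟨A, _, _, _, ψ, G, h1, h2, h3, h4, h5, h6⟩ :=
      ih fun y hy => hl y (List.mem_cons_of_mem _ hy)
    obtain ⟨ψ', hC, hX⟩ := PowerSeries.exists_ringHom_extension ψ (hl x List.mem_cons_self)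
    have hC' : ∀ r, ψ' (PowerSeries.C r) = ψ r := fun r => congrArg (· r) hC
    refine ⟨PowerSeries A, inferInstance, inferInstance, inferInstance, ψ',
      insert PowerSeries.X (G.image PowerSeries.C), h1.powerSeries,
      PowerSeries.isIntegrallyClosed A, fun y => ?_, ?_, ?_, ?_⟩
    · obtain ⟨a, ha⟩ := h3 y
      exact ⟨PowerSeries.C a, by rwa [hC']⟩
    · rw [PowerSeries.maximalIdeal_eq, ← h4, Ideal.map_span, Finset.coe_insert, Finset.coe_image,
        Ideal.span_insert, sup_comm]
    · have := (Finset.card_insert_le (PowerSeries.X : PowerSeries A) (G.image PowerSeries.C)).trans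
        (Nat.add_le_add_right Finset.card_image_le 1)
      rw [List.length_cons]
      omega
    · have : {y : T | y ∈ x :: l} = insert x {y | y ∈ l} := by ext; simp
      rw [PowerSeries.maximalIdeal_eq, Ideal.map_sup, Ideal.map_map, hC, h6, Ideal.map_span,
        Set.image_singleton, hX, this, Ideal.span_insert, sup_assoc,
        sup_comm (Ideal.span {y | y ∈ l})]

theorem Module.Finite.of_maximalIdeal_mem_minimalPrimes {A T : Type*} [CommRing A] [CommRing T]
    [IsCompleteNoetherianLocal A] [IsCompleteNoetherianLocal T] [Algebra A T]
    (hres : ∀ x : T, ∃ a : A, x - algebraMap A T a ∈ maximalIdeal T)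
    (hmin : maximalIdeal T ∈ ((maximalIdeal A).map (algebraMap A T)).minimalPrimes) :
    Module.Finite A T := by
  classical
  set J := (maximalIdeal A).map (algebraMap A T) with hJ
  have hrad : maximalIdeal T ≤ J.radical := by
    rw [Ideal.radical_eq_sInf]
    exact le_sInf fun q hq => hmin.2 ⟨hq.2, hq.1⟩ (IsLocalRing.le_maximalIdeal hq.2.ne_top)
  obtain ⟨k, hk⟩ := Ideal.exists_pow_le_of_le_radical_of_fg hrad (IsNoetherian.noetherian _)
  have hsmul : ∀ n, (maximalIdeal A ^ n • ⊤ : Submodule A T) =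
      (J ^ n).restrictScalars A := fun n => by
    rw [Ideal.smul_top_eq_map, Ideal.map_pow]
  have hprec : IsPrecomplete (maximalIdeal A) A :=
    IsCompleteNoetherianLocal.cauchyConverges.isPrecomplete
  have hhaus : IsHausdorff (maximalIdeal A) T := by
    refine ⟨fun x hx => eq_of_forall_sub_mem_pow fun n => ?_⟩
    have := hx n
    rw [SModEq.sub_mem, hsmul] at this
    exact Ideal.pow_right_mono hmin.1.2 n this
  have key : ∀ j, ∃ N : Submodule A T, N.FG ∧ ∀ x, ∃ a ∈ N, x - a ∈ maximalIdeal T ^ j := by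
    intro j
    induction j with
    | zero => exact ⟨⊥, Submodule.fg_bot, fun x => ⟨0, zero_mem _, by simp⟩⟩
    | succ j ih =>
      obtain ⟨N, hN, hNx⟩ := ih
      obtain ⟨s, hs⟩ := IsNoetherian.noetherian (maximalIdeal T ^ j)
      refine ⟨N ⊔ Submodule.span A (s : Set T), hN.sup ⟨s, rfl⟩, fun x => ?_⟩
      have hmem : ∀ y ∈ maximalIdeal T ^ j, ∃ b ∈ Submodule.span A (s : Set T),
          y - b ∈ maximalIdeal T ^ (j + 1) := by
        intro y hy
        have hsj : ∀ z ∈ Submodule.span A (s : Set T), z ∈ maximalIdeal T ^ j := by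
          intro z hz
          rw [← hs]
          exact Submodule.span_le_restrictScalars A T (s : Set T) hz
        rw [← hs] at hy
        induction hy using Submodule.span_induction with
        | mem y hy => exact ⟨y, Submodule.subset_span hy, by simp⟩
        | zero => exact ⟨0, zero_mem _, by simp⟩
        | add y z _ _ hy hz =>
          obtain ⟨b, hb, hyb⟩ := hy
          obtain ⟨c, hc, hzc⟩ := hz
          exact ⟨b + c, add_mem hb hc, by rw [add_sub_add_comm]; exact add_mem hyb hzc⟩
        | smul t y _ hy =>
          obtain ⟨b, hb, hyb⟩ := hy
          obtain ⟨a, ha⟩ := hres t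
          refine ⟨a • b, Submodule.smul_mem _ a hb, ?_⟩
          have h1 := Ideal.mul_mem_left _ t hyb
          have h2 := Ideal.mul_mem_mul (hsj b hb) ha
          rw [← pow_succ] at h2
          convert add_mem h1 h2 using 1
          rw [Algebra.smul_def a b, smul_eq_mul]
          ring
      obtain ⟨a, ha, hxa⟩ := hNx x
      obtain ⟨b, hb, hxb⟩ := hmem _ hxa
      exact ⟨a + b, Submodule.add_mem_sup ha hb, by rwa [← sub_sub]⟩
  obtain ⟨N, hN, hNx⟩ := key k
  refine .of_sup_smul_top_eq_top (maximalIdeal A) hN (eq_top_iff.mpr fun x _ => ?_)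
  obtain ⟨a, ha, hxa⟩ := hNx x
  have h1 := hsmul 1
  rw [pow_one, pow_one] at h1
  rw [h1]
  exact Submodule.mem_sup.mpr ⟨a, ha, x - a, hk hxa, by ring⟩

/-- A prime ideal is minimal over an ideal generated by a prescribed element and a list whose
length is controlled by the height. -/
theorem Ideal.exists_list_mem_minimalPrimes {R : Type*} [CommRing R] [IsDomain R]
    [IsNoetherianRing R] (P : Ideal R) [P.IsPrime] {ϖ : R} (hϖ : ϖ ∈ P) [Decidable (ϖ = 0)] :
    ∃ l : List R, (∀ x ∈ l, x ∈ P) ∧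
      P ∈ (Ideal.span {ϖ} ⊔ Ideal.span {x | x ∈ l}).minimalPrimes ∧
      (((if ϖ = 0 then 0 else 1) + l.length : ℕ) : ℕ∞) ≤ P.height := by
  by_cases h0 : ϖ = 0
  · obtain ⟨s, hs, hcard⟩ := Ideal.exists_finset_card_eq_height_of_isNoetherianRing P
    refine ⟨s.toList, fun x hx => hs.1.2 (Ideal.subset_span (by simpa using hx)), ?_, ?_⟩
    · simpa [h0] using hs
    · simp [h0, hcard]
  · set J := Ideal.span {ϖ} with hJ
    have hJP : J ≤ P := (Ideal.span_singleton_le_iff_mem _).mpr hϖ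
    have hprime : ∀ q : Ideal R, q.IsPrime → J ≤ q → (q.map (Ideal.Quotient.mk J)).IsPrime :=
      fun q _ hq => Ideal.map_isPrime_of_surjective Ideal.Quotient.mk_surjective (by simpa using hq)
    have hcomap : ∀ q : Ideal R, J ≤ q →
        Ideal.comap (Ideal.Quotient.mk J) (q.map (Ideal.Quotient.mk J)) = q := fun q hq => by
      rw [Ideal.comap_map_of_surjective _ Ideal.Quotient.mk_surjective, ← RingHom.ker_eq_comap_bot,
        Ideal.mk_ker, sup_eq_left.2 hq]
    have := hprime P inferInstance hJP
    obtain ⟨s, hs, hcard⟩ := Ideal.exists_finset_card_eq_height_of_isNoetherianRing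
      (P.map (Ideal.Quotient.mk J))
    have hht := Ideal.height_map_quotientMk_add_one_le (by simpa [hJ] using h0) hJP
    choose g hg using Ideal.Quotient.mk_surjective (I := J)
    have hP : ∀ x ∈ s.toList.map g, x ∈ P := by
      intro x hx
      obtain ⟨y, hy, rfl⟩ := List.mem_map.mp hx
      rw [← hcomap P hJP, Ideal.mem_comap, hg]
      exact hs.1.2 (Ideal.subset_span (by simpa using hy))
    refine ⟨s.toList.map g, hP, ⟨⟨inferInstance, sup_le hJP (Ideal.span_le.mpr hP)⟩, ?_⟩, ?_⟩
    · rintro q ⟨hq, hlq⟩ hqP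
      have hJq := le_sup_left.trans hlq
      have := hs.2 ⟨hprime q hq hJq, Ideal.span_le.mpr fun y hy => ?_⟩ (Ideal.map_mono hqP)
      · have h3 := Ideal.comap_mono (f := Ideal.Quotient.mk J) this
        rwa [hcomap P hJP, hcomap q hJq] at h3
      · rw [SetLike.mem_coe, ← hg y]
        refine Ideal.mem_map_of_mem _ (le_sup_right.trans hlq (Ideal.subset_span ?_))
        exact List.mem_map.mpr ⟨y, by simpa using hy, rfl⟩
    · rw [if_neg h0, List.length_map, Finset.length_toList, add_comm, Nat.cast_add, hcard]
      exact hht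

theorem IsNTwo.of_isField {A : Type u} [CommRing A] [IsDomain A] (h : IsField A) : IsNTwo A := by
  intro K L _ _ _ _ _ _ _ _
  have : IsNoetherianRing A := by
    let _ := h.toField
    infer_instance
  have hsurj := (h.localization_map_bijective (Rₘ := K) (M := nonZeroDivisors A)
    zero_notMem_nonZeroDivisors).2
  have : Module.Finite A K := .of_surjective (Algebra.linearMap A K) hsurj
  have : Module.Finite A L := .trans K L
  exact inferInstanceAs (Module.Finite A (Subalgebra.toSubmodule (integralClosure A L)))

theorem IsCoefficientRing.isNOne {T : Type u} [CommRing T] [IsDomain T]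
    [IsCompleteNoetherianLocal T] {Λ : Subring T} {ϖ : T} (h : IsCoefficientRing Λ ϖ)
    (hϖ : ϖ = 0 ∨ CharZero T) : IsNOne T := by
  classical
  have := h.isPrincipalIdealRing
  have := h.isCompleteNoetherianLocal
  have hm := h.maximalIdeal_eq
  have hN : IsNTwo Λ := by
    rcases hϖ with rfl | hc
    · refine .of_isField (IsLocalRing.isField_iff_maximalIdeal_eq.mpr ?_)
      rw [hm, Ideal.span_singleton_eq_bot]
      rfl
    · exact .of_charZero
  obtain ⟨l, hl, hmin, hht⟩ := Ideal.exists_list_mem_minimalPrimes (maximalIdeal T)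
    h.mem_maximalIdeal
  obtain ⟨G₀, hG₀, hcard⟩ : ∃ G₀ : Finset Λ, Ideal.span (G₀ : Set Λ) = maximalIdeal Λ ∧
      G₀.card ≤ if ϖ = 0 then 0 else 1 := by
    by_cases h0 : ϖ = 0
    · refine ⟨∅, ?_, by simp⟩
      rw [hm, Finset.coe_empty, Ideal.span_empty, eq_comm, Ideal.span_singleton_eq_bot]
      exact Subtype.ext h0
    · exact ⟨{⟨ϖ, h.mem⟩}, by rw [hm, Finset.coe_singleton], by simp [h0]⟩
  obtain ⟨A, _, _, _, ψ, G, h1, h2, h3, h4, h5, h6⟩ := exists_normal_cover_of_list hN Λ.subtype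
    (fun x => by
      obtain ⟨y, hy, hxy⟩ := h.exists_sub_mem x
      exact ⟨⟨y, hy⟩, hxy⟩) G₀ hG₀ l hl
  rw [hm, Ideal.map_span, Set.image_singleton] at h6
  change _ = Ideal.span {ϖ} ⊔ _ at h6
  rw [← h6] at hmin
  let _ : Algebra A T := ψ.toAlgebra
  have hmin' : maximalIdeal T ∈ ((maximalIdeal A).map (algebraMap A T)).minimalPrimes := hmin
  have hover : (maximalIdeal T).LiesOver (maximalIdeal A) :=
    ⟨(maximalIdeal.isMaximal A).eq_of_le (Ideal.IsPrime.ne_top (Ideal.IsPrime.comap _))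
      (Ideal.map_le_iff_le_comap.mp hmin'.1.2)⟩
  have hhtA : (maximalIdeal A).height ≤ (maximalIdeal T).height := by
    have h7 : (maximalIdeal A).height ≤ G.card :=
      Ideal.height_le_card_of_mem_minimalPrimes_span_finset (by
        rw [h4, Ideal.minimalPrimes_eq_subsingleton_self]; exact Set.mem_singleton _)
    refine h7.trans (le_trans ?_ hht)
    exact_mod_cast h5.trans (Nat.add_le_add_right hcard _)
  have : FaithfulSMul A T := (faithfulSMul_iff_algebraMap_injective _ _).mpr
    (Ideal.algebraMap_injective_of_height_le _ _ hmin' hhtA)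
  have : Module.Finite A T := .of_maximalIdeal_mem_minimalPrimes h3 hmin'
  exact h1.isNOne_of_finite

theorem isNOne_of_isCompleteNoetherianLocal (T : Type u) [CommRing T] [IsDomain T]
    [IsCompleteNoetherianLocal T] : IsNOne T := by
  by_cases hp : ∃ p : ℕ, p.Prime ∧ (p : T) ∈ maximalIdeal T
  · obtain ⟨p, hp, hpm⟩ := hp
    have : Fact p.Prime := ⟨hp⟩
    obtain ⟨Λ, hΛ⟩ := exists_isCoefficientRing_of_prime p hpm
    refine hΛ.isNOne (or_iff_not_imp_left.mpr fun hp0 => ?_)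
    obtain ⟨q, hq⟩ := CharP.exists T
    rcases CharP.char_is_prime_or_zero T q with hqp | rfl
    · have hcop : IsCoprime (p : T) (q : T) :=
        Nat.Coprime.cast ((Nat.coprime_primes hp hqp).mpr fun hpq =>
          hp0 (by rw [hpq, CharP.cast_eq_zero]))
      rw [CharP.cast_eq_zero T q, isCoprime_zero_right] at hcop
      exact absurd hcop ((IsLocalRing.mem_maximalIdeal _).mp hpm)
    · exact CharP.charP_to_charZero T
  · obtain ⟨Λ, hΛ⟩ := exists_isCoefficientRing_of_charZero (T := T)
      fun p hp' hpm => hp ⟨p, hp', hpm⟩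
    exact hΛ.isNOne (.inl rfl)

end NoetherNormalization

theorem IsAdicComplete.isCompleteNoetherianLocal {S : Type*} [CommRing S] [IsNoetherianRing S]
    {m : Ideal S} (hm : m.IsMaximal) (huniq : ∀ I : Ideal S, I.IsMaximal → I = m)
    (h : IsAdicComplete m S) : IsCompleteNoetherianLocal S := by
  have : IsLocalRing S := IsLocalRing.of_unique_max_ideal ⟨m, hm, huniq⟩
  refine ⟨inferInstance, this, ?_⟩
  rw [huniq _ (IsLocalRing.maximalIdeal.isMaximal S)]
  exact cauchyConverges_of_isPrecomplete m

theorem isNOne_of_algebraInt_finiteType {B : Type u} [CommRing B] [IsDomain B]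
    [h : Algebra ℤ B] (hB : Algebra.FiniteType ℤ B) : IsNOne B := by
  obtain rfl : h = Ring.toIntAlgebra B := Subsingleton.elim _ _
  exact isNOne_of_finiteType_int B

/-- Linear equivalence of the integral closures of powers with the powers, for the domains
covered by `AdmissibleDomain`. -/
theorem exists_intClosure_pow_le_of_admissibleDomain {S : Type u} [CommRing S] [IsDomain S]
    [IsNoetherianRing S] (hS : AdmissibleDomain S) (I : Ideal S) :
    ∃ c, ∀ n, intClosure (I ^ (n + c)) ≤ I ^ n := by
  rcases hS with ⟨_, m, hm, huniq, h⟩ | h | h | h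
  · have := IsAdicComplete.isCompleteNoetherianLocal hm huniq h
    exact exists_intClosure_pow_le_of_complete I fun T _ _ _ =>
      isNOne_of_isCompleteNoetherianLocal T
  · exact exists_intClosure_pow_le_of_isNOne_reesAlgebra (isNOne_reesAlgebra_of_fieldBase h.some I)
  · have hfin : Algebra.FiniteType ℤ (reesAlgebra I) := .trans (S := S) h inferInstance
    exact exists_intClosure_pow_le_of_isNOne_reesAlgebra (isNOne_of_algebraInt_finiteType hfin)
  · exact exists_intClosure_pow_le_of_isNOne_reesAlgebra (isNOne_reesAlgebra_of_nagataBase h.some I)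

/-- **Theorem.** Let `S` be a domain which is a complete local Noetherian ring, or finitely
generated over a field or `ℤ`, or more generally finitely generated over a Noetherian
integrally closed domain `R` such that every finitely generated `R`-algebra has module-finite
integral closure. Let `a` be a filtration and `b` a graded family of nonzero ideals which is
`bb`-equivalent for some ideal `bb`. Then
`ρ̂(a, b) = ρ̂(a, b̄) = ρ(a, b̄) = ρ̂(a, bb^•)`. -/
theorem statement11 {S : Type u} [CommRing S] [IsDomain S] [IsNoetherianRing S]
    (hS : AdmissibleDomain S)
    (a b : ℕ → Ideal S) (ha : IdealFiltration a) (hb : GradedFamily b)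
    (hanz : ∀ i : ℕ, 1 ≤ i → a i ≠ ⊥) (hbnz : ∀ i : ℕ, 1 ≤ i → b i ≠ ⊥)
    (bb : Ideal S) (heq : BEquivalent bb b) :
    asympResurgence a b = asympResurgence a (fun i => intClosure (b i)) ∧
      asympResurgence a (fun i => intClosure (b i)) =
        resurgence a (fun i => intClosure (b i)) ∧
      resurgence a (fun i => intClosure (b i)) =
        asympResurgence a (fun i => bb ^ i) :=
  resurgence_eqs_of_intClosure_pow_le ha.1 hb hbnz heq
    (exists_intClosure_pow_le_of_admissibleDomain hS bb)
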